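/- There exists an absolute constant β₀ such that for every β > β₀, every λ ∈ (0,1], and every finite simply-connected V ⊂ ℤ²: (1) for every pair of integers 0 ≤ k < m and every boundary signing η, exp(−2|V| e^{−(4β−λ)(k+1)}) ≤ e^{−λ(m−k)|V|} · Z^el_{η,k,V} / Z^el_{η,m,V} ≤ 2 exp(−(1/2)|V̊| e^{−(4β−λ)(k+1)}); and (2) for every integer h ≥ 0, every h-elementary contour γ satisfies W^rn_h(γ) ≤ e^{−(β−2)|γ|}. -/

import Mathlib

open scoped BigOperators
open Filter

noncomputable section

attribute [local instance] Classical.propDecidable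

/-! ### Basic geometry of the square lattice -/

/-- Sites of the square lattice `ℤ²`. -/
abbrev Site := ℤ × ℤ

/-- The four unit directions. -/
def dirs : Finset Site := {(1, 0), (-1, 0), (0, 1), (0, -1)}

/-- The box `Λ_n = ⟦-n/2, n/2⟧² ∩ ℤ²`. -/
def box (n : ℕ) : Finset Site :=
  Finset.Icc (-((n : ℤ) / 2)) ((n : ℤ) / 2) ×ˢ Finset.Icc (-((n : ℤ) / 2)) ((n : ℤ) / 2)

/-- SOS gradient energy of a height function on a domain `V`: each nearest-neighbour
edge with at least one endpoint in `V` contributes the absolute height gradient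
(the directed sum below counts internal edges twice, whence the factor `1/2`). -/
def sosEnergy (V : Finset Site) (ψ : Site → ℤ) : ℝ :=
  ∑ v ∈ V, ∑ d ∈ dirs,
    (if v + d ∈ V then (1 : ℝ) / 2 else 1) * |(ψ v : ℝ) - (ψ (v + d) : ℝ)|

/-- The bulk field term `Σ_{v ∈ V} ψ_v`. -/
def sosField (V : Finset Site) (ψ : Site → ℤ) : ℝ := ∑ v ∈ V, (ψ v : ℝ)

/-- The SOS weight `exp(-β Σ|∇ψ| - λ Σ ψ)`. -/
def sosWt (β lam : ℝ) (V : Finset Site) (ψ : Site → ℤ) : ℝ :=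
  Real.exp (-(β * sosEnergy V ψ + lam * sosField V ψ))

/-- The inner boundary `∂_i V`. -/
def innerBdry (V : Finset Site) : Finset Site :=
  V.filter fun v => ∃ d ∈ dirs, v + d ∉ V

/-- The interior `V̊ = V ∖ ∂_i V`. -/
def interiorSites (V : Finset Site) : Finset Site := V \ innerBdry V

/-- The number of edges `|∂_e V|` between `V` and its complement. -/
def edgeBdryCard (V : Finset Site) : ℕ :=
  ∑ v ∈ V, (dirs.filter fun d => v + d ∉ V).card

/-- Nearest-neighbour adjacency. -/
def adjS (u v : Site) : Prop := v - u ∈ dirs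

/-- A set of sites is connected (as a subgraph of `ℤ²`). -/
def connectedIn (S : Set Site) : Prop :=
  ∀ x ∈ S, ∀ y ∈ S,
    Relation.ReflTransGen (fun a b => adjS a b ∧ a ∈ S ∧ b ∈ S) x y

/-- A finite set of sites is simply connected: it is connected and its complement is
connected. -/
def SimplyConn (V : Finset Site) : Prop :=
  connectedIn (↑V : Set Site) ∧ connectedIn ((↑V : Set Site)ᶜ)

/-! ### SOS measures with a boundary signing -/

/-- A boundary signing value: `+`, `-`, `∅` or free. -/
inductive BSign | plus | minus | zero | free

/-- The constraint imposed at an inner-boundary site by a signing, for boundary height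
`h`: `+` forces `≥ h`, `-` forces `≤ h`, `∅` forces `= h`, and `f` forces nothing. -/
def BSign.ok : BSign → ℤ → ℤ → Prop
  | .plus, h, t => h ≤ t
  | .minus, h, t => t ≤ h
  | .zero, h, t => t = h
  | .free, _, _ => True

/-- Height functions with boundary condition identically `h` outside `V`, floor `0`
on `V` (and no ceiling), compatible with the boundary signing `η` along `∂_i V`. -/
def signedConfigs (V : Finset Site) (η : Site → BSign) (h : ℤ) : Set (Site → ℤ) :=
  {ψ | (∀ x, x ∉ V → ψ x = h) ∧ (∀ v ∈ V, 0 ≤ ψ v) ∧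
       ∀ v ∈ innerBdry V, BSign.ok (η v) h (ψ v)}

/-- The partition function `Z_{η,h,V}`. -/
def Zsos (β lam : ℝ) (η : Site → BSign) (h : ℤ) (V : Finset Site) : ℝ :=
  ∑' ψ : Site → ℤ, Set.indicator (signedConfigs V η h) (sosWt β lam V) ψ

/-- Probability of an event under the SOS measure `μ_{η,h,V}`. -/
def Psos (β lam : ℝ) (η : Site → BSign) (h : ℤ) (V : Finset Site)
    (E : Set (Site → ℤ)) : ℝ :=
  (∑' ψ : Site → ℤ, Set.indicator (signedConfigs V η h ∩ E) (sosWt β lam V) ψ) /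
    Zsos β lam η h V

/-! ### Contours -/

/-- A (signed geometric) contour, encoded by the finite set of sites it encloses and its
sign (up/down); the contour itself is the dual circuit `(∂_e Int)^*`. -/
structure Contour where
  int : Finset Site
  up : Bool

/-- The length `|γ|` of a contour: the number of boundary edges of its interior. -/
def Contour.len (γ : Contour) : ℕ := edgeBdryCard γ.int

/-- A valid contour encloses a nonempty simply-connected set of sites. -/
def Contour.valid (γ : Contour) : Prop :=
  γ.int.Nonempty ∧ connectedIn (↑γ.int : Set Site) ∧ connectedIn ((↑γ.int : Set Site)ᶜ)

/-- The constant boundary signing. -/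
def constSign (s : BSign) : Site → BSign := fun _ => s

/-- The `h`-renormalized weight `W^rn_h(γ)`. -/
def Wrn (β lam : ℝ) (h : ℤ) (γ : Contour) : ℝ :=
  if γ.up then
    Real.exp (-β * (γ.len : ℝ)) *
      (Zsos β lam (constSign .plus) (h + 1) γ.int / Zsos β lam (constSign .plus) h γ.int)
  else
    Real.exp (-β * (γ.len : ℝ)) *
      (Zsos β lam (constSign .minus) (h - 1) γ.int / Zsos β lam (constSign .minus) h γ.int)

/-- The `h`-truncated weight `W^tr_h(γ) = min{W^rn_h(γ), e^{-(β-5)|γ|}}`. -/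
def Wtr (β lam : ℝ) (h : ℤ) (γ : Contour) : ℝ :=
  min (Wrn β lam h γ) (Real.exp (-(β - 5) * (γ.len : ℝ)))

/-- The elementary diameter bound `min{λ⁻¹, e^{3β(h+1)}}`. -/
def elemBound (β lam : ℝ) (h : ℤ) : ℝ := min (1 / lam) (Real.exp (3 * β * ((h : ℝ) + 1)))

/-- A set of sites is `h`-elementary small: the enclosing contour (whose ℓ∞-diameter is
one more than that of the enclosed set) has diameter at most `min{λ⁻¹, e^{3β(h+1)}}`. -/
def elemSet (β lam : ℝ) (h : ℤ) (S : Set Site) : Prop :=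
  ∀ x ∈ S, ∀ y ∈ S,
    ((max |x.1 - y.1| |x.2 - y.2| : ℤ) : ℝ) + 1 ≤ elemBound β lam h

/-- A contour is `h`-elementary if `diam(γ) ≤ min{λ⁻¹, e^{3β(h+1)}}`. -/
def IsElem (β lam : ℝ) (h : ℤ) (γ : Contour) : Prop := elemSet β lam h (↑γ.int : Set Site)

/-- Two finite sets of sites share a (primal, equivalently dual) boundary edge. -/
def shareEdge (A B : Finset Site) : Prop :=
  ∃ v, ∃ d ∈ dirs, (v ∈ A ∧ v + d ∉ A) ∧ ((v ∈ B ∧ v + d ∉ B) ∨ (v + d ∈ B ∧ v ∉ B))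

/-- Compatibility of a pair of signed contours: they may not cross, and if they overlap
on an edge their signs agree when nested and differ when mutually external. -/
def compatPair (γ γ' : Contour) : Prop :=
  (γ.int ⊆ γ'.int ∨ γ'.int ⊆ γ.int ∨ Disjoint γ.int γ'.int) ∧
  (shareEdge γ.int γ'.int →
    ((γ.int ⊆ γ'.int ∨ γ'.int ⊆ γ.int) → γ.up = γ'.up) ∧
    (Disjoint γ.int γ'.int → γ.up ≠ γ'.up))

/-- Admissible renormalized families of signed contours in `U`, compatible with the
boundary signing `η` at reference height `h` (no floor constraint except that no
down-contours are allowed when `h = 0`). -/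
def famOK (η : Site → BSign) (h : ℤ) (U : Finset Site) (Γ : Multiset Contour) : Prop :=
  (∀ γ ∈ Γ, Contour.valid γ ∧ γ.int ⊆ U) ∧
  (∀ γ ∈ Γ, ∀ γ' ∈ Γ, compatPair γ γ') ∧
  (∀ v ∈ innerBdry U, ∀ γ ∈ Γ, v ∈ γ.int →
    (γ.up = true → η v ≠ BSign.minus ∧ η v ≠ BSign.zero) ∧
    (γ.up = false → η v ≠ BSign.plus ∧ η v ≠ BSign.zero)) ∧
  (h = 0 → ∀ γ ∈ Γ, γ.up = true)

/-- The product of weights of a family of contours. -/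
def prodW (w : Contour → ℝ) (Γ : Multiset Contour) : ℝ := (Γ.map w).prod

/-- The truncated partition function `Z^tr_{η,h,U}`. -/
def Ztr (β lam : ℝ) (η : Site → BSign) (h : ℤ) (U : Finset Site) : ℝ :=
  Real.exp (-lam * (h : ℝ) * (U.card : ℝ)) *
    ∑' Γ : Multiset Contour, Set.indicator {Γ | famOK η h U Γ} (prodW (Wtr β lam h)) Γ

/-- The renormalized partition function `Z^rn_{η,h,U}`. -/
def Zrn (β lam : ℝ) (η : Site → BSign) (h : ℤ) (U : Finset Site) : ℝ :=
  Real.exp (-lam * (h : ℝ) * (U.card : ℝ)) *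
    ∑' Γ : Multiset Contour, Set.indicator {Γ | famOK η h U Γ} (prodW (Wrn β lam h)) Γ

/-- The renormalized elementary partition function `Z^{rn.el}_{η,h,U}`. -/
def Zrnel (β lam : ℝ) (η : Site → BSign) (h : ℤ) (U : Finset Site) : ℝ :=
  Real.exp (-lam * (h : ℝ) * (U.card : ℝ)) *
    ∑' Γ : Multiset Contour,
      Set.indicator {Γ | famOK η h U Γ ∧ ∀ γ ∈ Γ, IsElem β lam h γ}
        (prodW (Wrn β lam h)) Γ

/-! ### Elementary restriction of the SOS measure -/

/-- `*`-adjacency (adjacency allowing diagonal steps). -/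
def starAdj (u v : Site) : Prop := u ≠ v ∧ |u.1 - v.1| ≤ 1 ∧ |u.2 - v.2| ≤ 1

/-- The `*`-connected component of `x` within `S`. -/
def compStar (S : Set Site) (x : Site) : Set Site :=
  {y | Relation.ReflTransGen (fun a b => starAdj a b ∧ a ∈ S ∧ b ∈ S) x y}

/-- The fill of a set of sites: the set together with all sites whose
complement-component is finite. -/
def fill (C : Set Site) : Set Site :=
  C ∪ {x | {y | Relation.ReflTransGen (fun a b => adjS a b ∧ a ∉ C ∧ b ∉ C) x y}.Finite}

/-- All outermost contours of the configuration `ψ` (with boundary height `h` on `V`)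
are `h`-elementary: every filled deviation component is elementary-small. -/
def allOuterElem (β lam : ℝ) (h : ℤ) (V : Finset Site) (ψ : Site → ℤ) : Prop :=
  ∀ v ∈ V, ψ v ≠ h → elemSet β lam h (fill (compStar {u : Site | u ∈ V ∧ ψ u ≠ h} v))

/-- The elementary partition function `Z^el_{η,h,V}`: the contribution to `Z_{η,h,V}`
of configurations all of whose outermost contours are `h`-elementary. -/
def Zel (β lam : ℝ) (η : Site → BSign) (h : ℤ) (V : Finset Site) : ℝ :=
  ∑' ψ : Site → ℤ,
    Set.indicator (signedConfigs V η h ∩ {ψ | allOuterElem β lam h V ψ})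
      (sosWt β lam V) ψ

/-! ### Truncated free energies and the critical sequence -/

/-- `ftr h` is the truncated free energy `f^tr_h(λ)`: the infinite-volume limit of
`|Λ_n|⁻¹ log Z^tr_{η,h,Λ_n}`, for every boundary signing. -/
def FTRlimit (β : ℝ) (ftr : ℕ → ℝ → ℝ) : Prop :=
  ∀ h : ℕ, ∀ lam : ℝ, 0 < lam → lam ≤ 1 → ∀ η : Site → BSign,
    Tendsto (fun n => Real.log (Ztr β lam η (h : ℤ) (box n)) / ((box n).card : ℝ))
      atTop (nhds (ftr h lam))

/-- `lamc` is the strictly decreasing sequence `(λ_c^{(k)})_{k≥0}` of critical points,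
tending to `0`, at which the truncated free energies `ftr` exchange maximizer. -/
def CritSeq (ftr : ℕ → ℝ → ℝ) (lamc : ℕ → ℝ) : Prop :=
  StrictAnti lamc ∧ (∀ i, 0 < lamc i) ∧ Tendsto lamc atTop (nhds 0) ∧
  (∀ i : ℕ, ∀ lam : ℝ, 0 < lam → lam ≤ 1 → lamc i < lam →
    (i = 0 ∨ lam < lamc (i - 1)) → ∀ j : ℕ, j ≠ i → ftr j lam < ftr i lam) ∧
  (∀ i : ℕ, ftr (i + 1) (lamc i) = ftr i (lamc i) ∧
    ∀ j : ℕ, j ≠ i → j ≠ i + 1 → ftr j (lamc i) < ftr i (lamc i))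

/-- `d(x) = min_k |λ_c^{(k)} - x|`. -/
def dmin (lamc : ℕ → ℝ) (x : ℝ) : ℝ := ⨅ k : ℕ, |lamc k - x|

/-- `d⁺(x) = min{λ_c^{(k)} - x : λ_c^{(k)} > x}`. -/
def dplus (lamc : ℕ → ℝ) (x : ℝ) : ℝ := sInf {y : ℝ | ∃ k, x < lamc k ∧ y = lamc k - x}

/-! ### SOS measures with general boundary conditions (floor 0, no ceiling) -/

/-- Height functions equal to the boundary condition `φ` off `V` and nonnegative on `V`. -/
def bcConfigs (V : Finset Site) (φ : Site → ℤ) : Set (Site → ℤ) :=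
  {ψ | (∀ x, x ∉ V → ψ x = φ x) ∧ ∀ v ∈ V, 0 ≤ ψ v}

/-- The partition function with boundary condition `φ`. -/
def Zbc (β lam : ℝ) (V : Finset Site) (φ : Site → ℤ) : ℝ :=
  ∑' ψ : Site → ℤ, Set.indicator (bcConfigs V φ) (sosWt β lam V) ψ

/-- Probability of an event under the SOS measure `μ_{φ,V}` (floor 0, no ceiling). -/
def Pbc (β lam : ℝ) (V : Finset Site) (φ : Site → ℤ) (E : Set (Site → ℤ)) : ℝ :=
  (∑' ψ : Site → ℤ, Set.indicator (bcConfigs V φ ∩ E) (sosWt β lam V) ψ) /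
    Zbc β lam V φ

/-! ### Glauber dynamics on the box with a ceiling -/

/-- A configuration on `Λ_n` with floor `0` and ceiling `ℓ`. -/
abbrev Cfg (n ℓ : ℕ) := {x : Site // x ∈ box n} → Fin (ℓ + 1)

/-- Extension of a configuration by the zero boundary condition. -/
def cExt {n ℓ : ℕ} (ψ : Cfg n ℓ) : Site → ℤ :=
  fun x => if h : x ∈ box n then ((ψ ⟨x, h⟩ : ℕ) : ℤ) else 0

/-- The weight of a configuration (zero boundary conditions). -/
def cWt (n ℓ : ℕ) (β lam : ℝ) (ψ : Cfg n ℓ) : ℝ := sosWt β lam (box n) (cExt ψ)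

/-- The partition function on `Λ_n` with ceiling `ℓ` and zero boundary conditions. -/
def cZ (n ℓ : ℕ) (β lam : ℝ) : ℝ := ∑ ψ : Cfg n ℓ, cWt n ℓ β lam ψ

/-- The SOS probability measure `μ_{n,λ}` (ceiling `ℓ`, zero boundary conditions). -/
def cPi (n ℓ : ℕ) (β lam : ℝ) (ψ : Cfg n ℓ) : ℝ := cWt n ℓ β lam ψ / cZ n ℓ β lam

/-- Probability of an event under `μ_{n,λ}`. -/
def cProb (n ℓ : ℕ) (β lam : ℝ) (E : Set (Cfg n ℓ)) : ℝ :=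
  (∑ ψ : Cfg n ℓ, if ψ ∈ E then cWt n ℓ β lam ψ else 0) / cZ n ℓ β lam

/-- The Glauber (heat-bath) jump rate from `ψ` to `ψ' ≠ ψ`: nonzero only if they differ
at a single site `v` by exactly one, in which case `v`'s height is resampled among
`{ψ_v - 1, ψ_v, ψ_v + 1}` (truncated at the floor and the ceiling) according to the
conditional probabilities given the other heights. -/
def glRate (n ℓ : ℕ) (β lam : ℝ) (ψ ψ' : Cfg n ℓ) : ℝ :=
  if ψ = ψ' then 0
  else
    ∑ v : {x : Site // x ∈ box n},
      if (∀ u, u ≠ v → ψ u = ψ' u) ∧ (((ψ' v : ℕ) : ℤ) - ((ψ v : ℕ) : ℤ)) ^ 2 = 1 then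
        cWt n ℓ β lam ψ' /
          ∑ t : Fin (ℓ + 1),
            (if (((t : ℕ) : ℤ) - ((ψ v : ℕ) : ℤ)) ^ 2 ≤ 1 then
              cWt n ℓ β lam (Function.update ψ v t) else 0)
      else 0

/-- Mean of an observable under `μ_{n,λ}`. -/
def cMean (n ℓ : ℕ) (β lam : ℝ) (f : Cfg n ℓ → ℝ) : ℝ :=
  ∑ ψ : Cfg n ℓ, cPi n ℓ β lam ψ * f ψ

/-- Variance of an observable under `μ_{n,λ}`. -/
def cVar (n ℓ : ℕ) (β lam : ℝ) (f : Cfg n ℓ → ℝ) : ℝ :=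
  ∑ ψ : Cfg n ℓ, cPi n ℓ β lam ψ * (f ψ - cMean n ℓ β lam f) ^ 2

/-- The Dirichlet form of the Glauber dynamics. -/
def cDirichlet (n ℓ : ℕ) (β lam : ℝ) (f : Cfg n ℓ → ℝ) : ℝ :=
  (1 / 2) * ∑ ψ : Cfg n ℓ, ∑ ψ' : Cfg n ℓ,
    cPi n ℓ β lam ψ * glRate n ℓ β lam ψ ψ' * (f ψ' - f ψ) ^ 2

/-- The spectral gap `gap_{n,λ}` of the generator of the Glauber dynamics (ceiling `ℓ`):
by reversibility, the smallest nonzero eigenvalue of minus the generator equals the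
infimum of the Rayleigh quotients `E(f,f)/Var(f)`. -/
def specGap (n ℓ : ℕ) (β lam : ℝ) : ℝ :=
  sInf {r : ℝ | ∃ f : Cfg n ℓ → ℝ,
    cVar n ℓ β lam f ≠ 0 ∧ r = cDirichlet n ℓ β lam f / cVar n ℓ β lam f}

end

noncomputable section
open Filter
open scoped BigOperators
attribute [local instance] Classical.propDecidable

/-! ### Topology of fills -/

lemma rtg_symm {α : Type*} {r : α → α → Prop} (hs : ∀ a b, r a b → r b a) {x y : α}
    (h : Relation.ReflTransGen r x y) : Relation.ReflTransGen r y x := by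
  induction h with
  | refl => exact Relation.ReflTransGen.refl
  | tail _ h2 ih => exact Relation.ReflTransGen.head (hs _ _ h2) ih

lemma rtg_mono {α : Type*} {r p : α → α → Prop} (hs : ∀ a b, r a b → p a b) {x y : α}
    (h : Relation.ReflTransGen r x y) : Relation.ReflTransGen p x y := by
  induction h with
  | refl => exact Relation.ReflTransGen.refl
  | tail _ h2 ih => exact ih.tail (hs _ _ h2)

lemma mem_dirs_iff (d : Site) : d ∈ dirs ↔ d = (1, 0) ∨ d = (-1, 0) ∨ d = (0, 1) ∨ d = (0, -1) := by
  simp [dirs]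

lemma neg_mem_dirs {d : Site} (h : d ∈ dirs) : -d ∈ dirs := by
  rw [mem_dirs_iff] at *
  rcases h with h | h | h | h <;> subst h <;> simp

lemma adjS_iff (u v : Site) : adjS u v ↔
    (v.1 = u.1 + 1 ∧ v.2 = u.2) ∨ (v.1 = u.1 - 1 ∧ v.2 = u.2) ∨
    (v.1 = u.1 ∧ v.2 = u.2 + 1) ∨ (v.1 = u.1 ∧ v.2 = u.2 - 1) := by
  unfold adjS
  rw [mem_dirs_iff]
  simp only [Prod.ext_iff, Prod.fst_sub, Prod.snd_sub]
  constructor <;> intro h <;> omega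

lemma adjS_symm {u v : Site} (h : adjS u v) : adjS v u := by
  rw [adjS_iff] at *; omega

lemma adjS_add {u d : Site} (h : d ∈ dirs) : adjS u (u + d) := by
  unfold adjS; simpa using h

lemma starAdj_symm {u v : Site} (h : starAdj u v) : starAdj v u :=
  ⟨h.1.symm, by rw [abs_sub_comm]; exact h.2.1, by rw [abs_sub_comm]; exact h.2.2⟩

lemma starAdj_of_adjS {u v : Site} (h : adjS u v) : starAdj u v := by
  rw [adjS_iff] at h
  refine ⟨?_, ?_, ?_⟩
  · rintro rfl; omega
  · rw [abs_le]; omega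
  · rw [abs_le]; omega

/-- A diagonal or straight star step can be refined through an intermediate site. -/
lemma starAdj_cases {u v : Site} (h : starAdj u v) :
    adjS u v ∨ ∃ z, adjS u z ∧ adjS z v := by
  obtain ⟨h0, h1, h2⟩ := h
  rw [abs_le] at h1 h2
  by_cases ha : u.1 = v.1
  · left
    have : u.2 ≠ v.2 := fun hb => h0 (Prod.ext ha hb)
    rw [adjS_iff]; omega
  · by_cases hb : u.2 = v.2
    · left; rw [adjS_iff]; omega
    · right
      refine ⟨(v.1, u.2), ?_, ?_⟩ <;> rw [adjS_iff] <;> dsimp only <;> omega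

/-- Reachable set avoiding `C`. -/
def rch (C : Set Site) (x : Site) : Set Site :=
  {y | Relation.ReflTransGen (fun a b => adjS a b ∧ a ∉ C ∧ b ∉ C) x y}

lemma mem_fill {C : Set Site} {x : Site} : x ∈ fill C ↔ x ∈ C ∨ (rch C x).Finite := Iff.rfl

lemma rch_symm {C : Set Site} {x y : Site} (h : y ∈ rch C x) : x ∈ rch C y := by
  have : ∀ a b, (adjS a b ∧ a ∉ C ∧ b ∉ C) → (adjS b a ∧ b ∉ C ∧ a ∉ C) :=
    fun a b h => ⟨adjS_symm h.1, h.2.2, h.2.1⟩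
  exact rtg_symm this h

lemma rch_eq {C : Set Site} {x y : Site} (h : y ∈ rch C x) : rch C y = rch C x := by
  ext z
  exact ⟨fun hz => Relation.ReflTransGen.trans h hz,
    fun hz => Relation.ReflTransGen.trans (rch_symm h) hz⟩

lemma rch_notMem {C : Set Site} {x y : Site} (hx : x ∉ C) (h : y ∈ rch C x) : y ∉ C := by
  change Relation.ReflTransGen _ x y at h
  induction h with
  | refl => exact hx
  | tail _ h2 _ => exact h2.2.2

lemma notMem_fill_of_rch {C : Set Site} {x y : Site} (hx : x ∉ fill C) (h : y ∈ rch C x) :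
    y ∉ fill C := by
  rw [mem_fill] at *
  push Not at *
  exact ⟨rch_notMem hx.1 h, by rw [rch_eq h]; exact hx.2⟩

lemma subset_fill (C : Set Site) : C ⊆ fill C := Set.subset_union_left

lemma rch_mono {C C' : Set Site} (h : C ⊆ C') (x : Site) : rch C' x ⊆ rch C x := by
  intro y hy
  exact rtg_mono (fun a b hab => ⟨hab.1, fun hc => hab.2.1 (h hc), fun hc => hab.2.2 (h hc)⟩) hy

lemma fill_mono {C C' : Set Site} (h : C ⊆ C') : fill C ⊆ fill C' := by
  intro x hx
  rw [mem_fill] at *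
  rcases hx with hx | hx
  · exact Or.inl (h hx)
  · exact Or.inr (hx.subset (rch_mono h x))

lemma fill_subset_fill {B C : Set Site} (h : B ⊆ fill C) : fill B ⊆ fill C := by
  intro x hx
  by_contra hxC
  have key : rch C x ⊆ rch B x := by
    intro y hy
    change Relation.ReflTransGen _ x y at hy
    induction hy with
    | refl => exact Relation.ReflTransGen.refl
    | tail h1 h2 ih =>
      refine Relation.ReflTransGen.tail ih ⟨h2.1, fun hb => ?_, fun hb => ?_⟩
      · exact notMem_fill_of_rch hxC h1 (h hb)
      · exact notMem_fill_of_rch hxC (Relation.ReflTransGen.tail h1 h2) (h hb)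
  rcases mem_fill.1 hx with hx | hx
  · exact hxC (h hx)
  · exact hxC (mem_fill.2 (Or.inr (hx.subset key)))

lemma fill_bdry {C : Set Site} {x y : Site} (hx : x ∈ fill C) (hy : y ∉ fill C)
    (h : adjS x y) : x ∈ C := by
  by_contra hxC
  have hyC : y ∉ C := fun hc => hy (subset_fill C hc)
  have : x ∈ rch C y := Relation.ReflTransGen.single ⟨adjS_symm h, hyC, hxC⟩
  exact notMem_fill_of_rch hy this hx

lemma fill_star_bdry {C : Set Site} {x y : Site} (hx : x ∈ fill C) (hy : y ∉ fill C)
    (h : starAdj x y) : ∃ c ∈ C, starAdj c y := by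
  rcases starAdj_cases h with h1 | ⟨z, h1, h2⟩
  · exact ⟨x, fill_bdry hx hy h1, h⟩
  · by_cases hz : z ∈ fill C
    · exact ⟨z, fill_bdry hz hy h2, starAdj_of_adjS h2⟩
    · exact ⟨x, fill_bdry hx hz h1, h⟩

lemma site_infinite : (Set.univ : Set Site).Infinite := Set.infinite_univ

lemma compl_infinite (V : Finset Site) : ((↑V : Set Site)ᶜ).Infinite :=
  V.finite_toSet.infinite_compl

lemma rch_of_conn_compl {V : Finset Site} {C : Set Site} (hV : connectedIn ((↑V : Set Site)ᶜ))
    (hC : C ⊆ ↑V) {x : Site} (hx : x ∉ V) : (↑V : Set Site)ᶜ ⊆ rch C x := by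
  intro y hy
  exact rtg_mono
    (fun a b hab => ⟨hab.1, fun hc => hab.2.1 (hC hc), fun hc => hab.2.2 (hC hc)⟩)
    (hV x (by simpa using hx) y hy)

lemma fill_sub {V : Finset Site} {C : Set Site} (hV : connectedIn ((↑V : Set Site)ᶜ))
    (hC : C ⊆ ↑V) : fill C ⊆ ↑V := by
  intro x hx
  by_contra hxV
  rcases mem_fill.1 hx with h | h
  · exact hxV (hC h)
  · exact compl_infinite V (h.subset (rch_of_conn_compl hV hC (by simpa using hxV)))

lemma fill_compl_conn {V : Finset Site} {C : Set Site} (hV : connectedIn ((↑V : Set Site)ᶜ))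
    (hC : C ⊆ ↑V) : connectedIn (fill C)ᶜ := by
  have lift : ∀ x y, x ∉ fill C → y ∈ rch C x →
      Relation.ReflTransGen (fun a b => adjS a b ∧ a ∈ (fill C)ᶜ ∧ b ∈ (fill C)ᶜ) x y := by
    intro x y hx hy
    change Relation.ReflTransGen _ x y at hy
    induction hy with
    | refl => exact Relation.ReflTransGen.refl
    | tail h1 h2 ih =>
      exact ih.tail ⟨h2.1, notMem_fill_of_rch hx h1, notMem_fill_of_rch hx (h1.tail h2)⟩
  intro x hx y hy
  apply lift x y hx
  have esc : ∀ x, x ∉ fill C → ∃ z, z ∉ V ∧ z ∈ rch C x := by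
    intro x hx
    by_contra hcon
    push Not at hcon
    apply hx
    refine mem_fill.2 (Or.inr (V.finite_toSet.subset ?_))
    intro z hz
    by_contra hzV
    exact hcon z (by simpa using hzV) hz
  obtain ⟨z, hz, hzx⟩ := esc x hx
  obtain ⟨z', hz', hzy⟩ := esc y hy
  have h1 : z' ∈ rch C z := rch_of_conn_compl hV hC hz (by simpa using hz')
  exact Relation.ReflTransGen.trans hzx (Relation.ReflTransGen.trans h1 (rch_symm hzy))

/-- Star-connectedness. -/
def stc (S : Set Site) : Prop :=
  ∀ x ∈ S, ∀ y ∈ S, Relation.ReflTransGen (fun a b => starAdj a b ∧ a ∈ S ∧ b ∈ S) x y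

lemma star_rel_symm (S : Set Site) : ∀ a b, (starAdj a b ∧ a ∈ S ∧ b ∈ S) → (starAdj b a ∧ b ∈ S ∧ a ∈ S) :=
  fun _ _ h => ⟨starAdj_symm h.1, h.2.2, h.2.1⟩

lemma compStar_sub {S : Set Site} {x : Site} (hx : x ∈ S) : compStar S x ⊆ S := by
  intro y hy
  change Relation.ReflTransGen _ x y at hy
  induction hy with
  | refl => exact hx
  | tail _ h2 _ => exact h2.2.2

lemma self_mem_compStar (S : Set Site) (x : Site) : x ∈ compStar S x :=
  Relation.ReflTransGen.refl

lemma compStar_step {S : Set Site} {x y z : Site} (hy : y ∈ compStar S x) (hyS : y ∈ S)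
    (hz : z ∈ S) (h : starAdj y z) : z ∈ compStar S x :=
  Relation.ReflTransGen.tail hy ⟨h, hyS, hz⟩

lemma compStar_eq {S : Set Site} {x y : Site} (h : y ∈ compStar S x) :
    compStar S y = compStar S x := by
  ext z
  exact ⟨fun hz => Relation.ReflTransGen.trans h hz,
    fun hz => Relation.ReflTransGen.trans
      (rtg_symm (star_rel_symm S) h) hz⟩

lemma stc_compStar {S : Set Site} {x : Site} (hx : x ∈ S) : stc (compStar S x) := by
  have key : ∀ y, y ∈ compStar S x → Relation.ReflTransGen
      (fun a b => starAdj a b ∧ a ∈ compStar S x ∧ b ∈ compStar S x) x y := by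
    intro y hy
    change Relation.ReflTransGen _ x y at hy
    induction hy with
    | refl => exact Relation.ReflTransGen.refl
    | tail h1 h2 ih => exact ih.tail ⟨h2.1, h1, h1.tail h2⟩
  intro y hy z hz
  exact (rtg_symm (star_rel_symm _) (key y hy)).trans (key z hz)

/-- Nearest-neighbour component. -/
def comp4 (S : Set Site) (x : Site) : Set Site :=
  {y | Relation.ReflTransGen (fun a b => adjS a b ∧ a ∈ S ∧ b ∈ S) x y}

lemma comp4_sub {S : Set Site} {x : Site} (hx : x ∈ S) : comp4 S x ⊆ S := by
  intro y hy
  change Relation.ReflTransGen _ x y at hy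
  induction hy with
  | refl => exact hx
  | tail _ h2 _ => exact h2.2.2

lemma self_mem_comp4 (S : Set Site) (x : Site) : x ∈ comp4 S x :=
  Relation.ReflTransGen.refl

lemma comp4_step {S : Set Site} {x y z : Site} (hx : x ∈ S) (hy : y ∈ comp4 S x)
    (hz : z ∈ S) (h : adjS y z) : z ∈ comp4 S x :=
  Relation.ReflTransGen.tail hy ⟨h, comp4_sub hx hy, hz⟩

lemma stc_comp4 {S : Set Site} {x : Site} : stc (comp4 S x) := by
  have key : ∀ y, y ∈ comp4 S x → Relation.ReflTransGen
      (fun a b => starAdj a b ∧ a ∈ comp4 S x ∧ b ∈ comp4 S x) x y := by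
    intro y hy
    change Relation.ReflTransGen _ x y at hy
    induction hy with
    | refl => exact Relation.ReflTransGen.refl
    | tail h1 h2 ih => exact ih.tail ⟨starAdj_of_adjS h2.1, h1, h1.tail h2⟩
  intro y hy z hz
  exact (rtg_symm (star_rel_symm _) (key y hy)).trans (key z hz)

lemma comp4_sub_compStar {S S' : Set Site} {x : Site} (h : S ⊆ S') :
    comp4 S x ⊆ compStar S' x := by
  intro y hy
  exact rtg_mono (fun a b hab => ⟨starAdj_of_adjS hab.1, h hab.2.1, h hab.2.2⟩) hy

/-- The outer neighbours of the fill of a component are off the level set. -/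
lemma fill_comp4_bdry {S : Set Site} {v x y : Site} (hv : v ∈ S)
    (hx : x ∈ fill (comp4 S v)) (hy : y ∉ fill (comp4 S v)) (h : adjS x y) :
    x ∈ comp4 S v ∧ x ∈ S ∧ y ∉ S := by
  have hxC := fill_bdry hx hy h
  refine ⟨hxC, comp4_sub hv hxC, fun hyS => hy (subset_fill _ (comp4_step hv hxC hyS h))⟩

lemma ray_exit {C : Set Site} {x : Site} (hx : x ∉ C) (hf : (rch C x).Finite) :
    ∃ c ∈ C, Relation.ReflTransGen
      (fun a b => starAdj a b ∧ a ∈ fill C ∧ b ∈ fill C) x c := by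
  have h1 : ∃ n : ℕ, (x.1 + n, x.2) ∉ rch C x := by
    by_contra hcon
    push Not at hcon
    refine Set.infinite_of_injective_forall_mem (f := fun n : ℕ => ((x.1 + n, x.2) : Site)) ?_ hcon hf
    intro a b hab
    simpa using hab
  have h2 := Nat.find_spec h1
  have h3 : ∀ m < Nat.find h1, (x.1 + m, x.2) ∈ rch C x := fun m hm => by
    have := Nat.find_min h1 hm
    simpa using this
  set n := Nat.find h1 with hn
  have hpos : n ≠ 0 := by
    intro h0
    rw [h0] at h2
    apply h2
    have : ((x.1 + (0:ℕ), x.2) : Site) = x := by ext <;> simp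
    rw [this]; exact Relation.ReflTransGen.refl
  obtain ⟨k, hk⟩ := Nat.exists_eq_succ_of_ne_zero hpos
  rw [hk] at h2 h3
  have hadj : ∀ m : ℕ, adjS ((x.1 + m, x.2) : Site) (x.1 + (m+1 : ℕ), x.2) := by
    intro m; rw [adjS_iff]; left; push_cast; constructor <;> ring
  have hkr := h3 k (Nat.lt_succ_self k)
  have hc : ((x.1 + (k+1 : ℕ), x.2) : Site) ∈ C := by
    by_contra hc
    exact h2 (Relation.ReflTransGen.tail hkr ⟨hadj k, rch_notMem hx hkr, hc⟩)
  refine ⟨_, hc, ?_⟩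
  have hfillr : ∀ y ∈ rch C x, y ∈ fill C := fun y hy =>
    mem_fill.2 (Or.inr (by rw [rch_eq hy]; exact hf))
  have : ∀ m ≤ k, Relation.ReflTransGen
      (fun a b => starAdj a b ∧ a ∈ fill C ∧ b ∈ fill C) x ((x.1 + m, x.2) : Site) := by
    intro m
    induction m with
    | zero => intro _; simp; exact Relation.ReflTransGen.refl
    | succ m ih =>
      intro hm
      exact (ih (by omega)).tail ⟨starAdj_of_adjS (hadj m), hfillr _ (h3 m (by omega)),
        hfillr _ (h3 (m+1) (by omega))⟩
  exact (this k le_rfl).tail ⟨starAdj_of_adjS (hadj k), hfillr _ hkr, subset_fill _ hc⟩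

lemma stc_fill {C : Set Site} (hC : stc C) : stc (fill C) := by
  have key : ∀ x ∈ fill C, ∃ c ∈ C, Relation.ReflTransGen
      (fun a b => starAdj a b ∧ a ∈ fill C ∧ b ∈ fill C) x c := by
    intro x hx
    by_cases hxC : x ∈ C
    · exact ⟨x, hxC, Relation.ReflTransGen.refl⟩
    · rcases mem_fill.1 hx with h | h
      · exact absurd h hxC
      · exact ray_exit hxC h
  intro x hx y hy
  obtain ⟨c, hc, h1⟩ := key x hx
  obtain ⟨c', hc', h2⟩ := key y hy
  refine h1.trans (Relation.ReflTransGen.trans ?_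
    (rtg_symm (star_rel_symm _) h2))
  exact rtg_mono
    (fun a b hab => ⟨hab.1, subset_fill _ hab.2.1, subset_fill _ hab.2.2⟩) (hC c hc c' hc')

lemma fill_singleton (v : Site) : fill ({v} : Set Site) = {v} := by
  apply Set.Subset.antisymm _ (subset_fill _)
  intro x hx
  by_contra hne
  have hne' : x ≠ v := by simpa using hne
  rcases mem_fill.1 hx with h | h
  · exact hne h
  have go : ∀ g : ℕ → Site, g 0 = x → (∀ n, adjS (g n) (g (n+1))) → (∀ n, g n ≠ v) →
      ∀ n, g n ∈ rch {v} x := by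
    intro g h0 h1 h2 n
    induction n with
    | zero => rw [h0]; exact Relation.ReflTransGen.refl
    | succ n ih => exact Relation.ReflTransGen.tail ih ⟨h1 n, h2 n, h2 (n+1)⟩
  by_cases h1 : x.1 = v.1
  · have h2 : x.2 ≠ v.2 := fun hb => hne' (Prod.ext h1 hb)
    refine Set.infinite_of_injective_forall_mem (f := fun n : ℕ => ((x.1 + n, x.2) : Site)) ?_
      (go _ (by simp) ?_ ?_) h
    · intro a b hab; simpa using hab
    · intro n; rw [adjS_iff]; left; push_cast; constructor <;> ring
    · intro n hn; exact h2 (by rw [← hn])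
  · refine Set.infinite_of_injective_forall_mem (f := fun n : ℕ => ((x.1, x.2 + n) : Site)) ?_
      (go _ (by simp) ?_ ?_) h
    · intro a b hab; simpa using hab
    · intro n; rw [adjS_iff]; right; right; left; push_cast; constructor <;> ring
    · intro n hn; exact h1 (by rw [← hn])

end

noncomputable section
open Filter
open scoped BigOperators
attribute [local instance] Classical.propDecidable

/-! ### Isoperimetry -/

lemma sum_dirs {M : Type*} [AddCommMonoid M] (f : Site → M) :
    ∑ d ∈ dirs, f d = f (1, 0) + (f (-1, 0) + (f (0, 1) + f (0, -1))) := by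
  unfold dirs
  rw [Finset.sum_insert (by decide), Finset.sum_insert (by decide), Finset.sum_insert (by decide),
    Finset.sum_singleton]

lemma eb_eq (A : Finset Site) :
    edgeBdryCard A = ∑ d ∈ dirs, (A.filter fun v => v + d ∉ A).card := by
  unfold edgeBdryCard
  simp only [Finset.card_filter]
  exact Finset.sum_comm

def rowsF (A : Finset Site) : Finset ℤ := A.image Prod.snd
def colsF (A : Finset Site) : Finset ℤ := A.image Prod.fst

lemma rows_le (A : Finset Site) (d : Site) (hd : d = (1, 0) ∨ d = (-1, 0)) :
    (rowsF A).card ≤ (A.filter fun v => v + d ∉ A).card := by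
  have : rowsF A ⊆ (A.filter fun v => v + d ∉ A).image Prod.snd := by
    intro y hy
    obtain ⟨v, hv, hvy⟩ := Finset.mem_image.1 hy
    obtain ⟨w, hw, hmax⟩ := Finset.exists_max_image (A.filter fun u => u.2 = y)
      (fun u => u.1 * d.1) ⟨v, by simp [hv, hvy]⟩
    rw [Finset.mem_filter] at hw
    refine Finset.mem_image.2 ⟨w, Finset.mem_filter.2 ⟨hw.1, fun hc => ?_⟩, hw.2⟩
    have := hmax (w + d) (by
      rw [Finset.mem_filter]; refine ⟨hc, ?_⟩
      rcases hd with h | h <;> simp [h, hw.2])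
    rcases hd with h | h <;> simp [h] at this
  exact (Finset.card_le_card this).trans Finset.card_image_le

lemma cols_le (A : Finset Site) (d : Site) (hd : d = (0, 1) ∨ d = (0, -1)) :
    (colsF A).card ≤ (A.filter fun v => v + d ∉ A).card := by
  have : colsF A ⊆ (A.filter fun v => v + d ∉ A).image Prod.fst := by
    intro y hy
    obtain ⟨v, hv, hvy⟩ := Finset.mem_image.1 hy
    obtain ⟨w, hw, hmax⟩ := Finset.exists_max_image (A.filter fun u => u.1 = y)
      (fun u => u.2 * d.2) ⟨v, by simp [hv, hvy]⟩
    rw [Finset.mem_filter] at hw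
    refine Finset.mem_image.2 ⟨w, Finset.mem_filter.2 ⟨hw.1, fun hc => ?_⟩, hw.2⟩
    have := hmax (w + d) (by
      rw [Finset.mem_filter]; refine ⟨hc, ?_⟩
      rcases hd with h | h <;> simp [h, hw.2])
    rcases hd with h | h <;> simp [h] at this
  exact (Finset.card_le_card this).trans Finset.card_image_le

lemma eb_ge (A : Finset Site) : 2 * (rowsF A).card + 2 * (colsF A).card ≤ edgeBdryCard A := by
  rw [eb_eq, sum_dirs]
  have h1 := rows_le A (1, 0) (Or.inl rfl)
  have h2 := rows_le A (-1, 0) (Or.inr rfl)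
  have h3 := cols_le A (0, 1) (Or.inl rfl)
  have h4 := cols_le A (0, -1) (Or.inr rfl)
  omega

lemma card_le_rc (A : Finset Site) : A.card ≤ (colsF A).card * (rowsF A).card := by
  rw [← Finset.card_product]
  apply Finset.card_le_card
  intro v hv
  exact Finset.mem_product.2 ⟨Finset.mem_image_of_mem _ hv, Finset.mem_image_of_mem _ hv⟩

lemma rows_pos {A : Finset Site} (h : A.Nonempty) : 1 ≤ (rowsF A).card :=
  Finset.card_pos.2 (h.image _)
lemma cols_pos {A : Finset Site} (h : A.Nonempty) : 1 ≤ (colsF A).card :=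
  Finset.card_pos.2 (h.image _)

lemma eb_ge_four {A : Finset Site} (h : A.Nonempty) : 4 ≤ edgeBdryCard A := by
  have := eb_ge A
  have := rows_pos h
  have := cols_pos h
  omega

lemma eb_ge_six {A : Finset Site} {v d : Site} (hd : d ∈ dirs) (h1 : v ∈ A) (h2 : v + d ∈ A) :
    6 ≤ edgeBdryCard A := by
  have h3 := eb_ge A
  have h4 := rows_pos ⟨v, h1⟩
  have h5 := cols_pos ⟨v, h1⟩
  have : 2 ≤ (rowsF A).card ∨ 2 ≤ (colsF A).card := by
    rw [mem_dirs_iff] at hd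
    have hr1 : v.2 ∈ rowsF A := Finset.mem_image_of_mem _ h1
    have hr2 : (v + d).2 ∈ rowsF A := Finset.mem_image_of_mem _ h2
    have hc1 : v.1 ∈ colsF A := Finset.mem_image_of_mem _ h1
    have hc2 : (v + d).1 ∈ colsF A := Finset.mem_image_of_mem _ h2
    have hR : v.2 ≠ (v + d).2 → 2 ≤ (rowsF A).card := fun h => by
      have := Finset.one_lt_card.2 ⟨_, hr1, _, hr2, h⟩; omega
    have hC : v.1 ≠ (v + d).1 → 2 ≤ (colsF A).card := fun h => by
      have := Finset.one_lt_card.2 ⟨_, hc1, _, hc2, h⟩; omega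
    rcases hd with h | h | h | h <;> subst h
    · exact Or.inr (hC (by simp))
    · exact Or.inr (hC (by simp))
    · exact Or.inl (hR (by simp))
    · exact Or.inl (hR (by simp))
  omega

lemma eb_singleton (v : Site) : edgeBdryCard {v} = 4 := by
  unfold edgeBdryCard
  rw [Finset.sum_singleton, Finset.filter_true_of_mem]
  · decide
  · intro d hd
    rw [mem_dirs_iff] at hd
    rcases hd with h | h | h | h <;> subst h <;> simp

/-- Smallness of a set. -/
def small (D : ℝ) (S : Set Site) : Prop :=
  ∀ x ∈ S, ∀ y ∈ S, ((max |x.1 - y.1| |x.2 - y.2| : ℤ) : ℝ) + 1 ≤ D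

lemma small_mono {D D' : ℝ} {S S' : Set Site} (hD : D ≤ D') (hS : S' ⊆ S) (h : small D S) :
    small D' S' := fun x hx y hy => (h x (hS hx) y (hS hy)).trans hD

lemma small_cols {D : ℝ} {A : Finset Site} (hA : A.Nonempty) (h : small D ↑A) :
    ((colsF A).card : ℝ) ≤ D := by
  obtain ⟨a, ha, hmax⟩ := Finset.exists_max_image A Prod.fst hA
  obtain ⟨b, hb, hmin⟩ := Finset.exists_min_image A Prod.fst hA
  have h1 : colsF A ⊆ Finset.Icc b.1 a.1 := by
    intro t ht
    obtain ⟨v, hv, rfl⟩ := Finset.mem_image.1 ht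
    exact Finset.mem_Icc.2 ⟨hmin v hv, hmax v hv⟩
  have h2 := Finset.card_le_card h1
  rw [Int.card_Icc] at h2
  have h3 := h a ha b hb
  have h4 := hmin a ha
  have h5 : ((colsF A).card : ℤ) ≤ max |a.1 - b.1| |a.2 - b.2| + 1 := by
    have := le_max_left |a.1 - b.1| |a.2 - b.2|
    have := le_abs_self (a.1 - b.1)
    omega
  have h6 : ((colsF A).card : ℝ) ≤ ((max |a.1 - b.1| |a.2 - b.2| : ℤ) : ℝ) + 1 := by
    exact_mod_cast h5
  linarith

lemma small_card {D : ℝ} {A : Finset Site} (h : small D ↑A) :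
    (A.card : ℝ) ≤ D * edgeBdryCard A / 2 := by
  rcases A.eq_empty_or_nonempty with rfl | hA
  · simp [edgeBdryCard]
  have h1 := small_cols hA h
  have h2 : (A.card : ℝ) ≤ (colsF A).card * (rowsF A).card := by exact_mod_cast card_le_rc A
  have h3 : 2 * ((rowsF A).card : ℝ) ≤ edgeBdryCard A := by
    have := eb_ge A
    exact_mod_cast (show 2 * (rowsF A).card ≤ edgeBdryCard A by omega)
  have h4 : (0:ℝ) ≤ (rowsF A).card := by positivity
  have h5 : (0:ℝ) ≤ (colsF A).card := by positivity
  nlinarith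

lemma path_hits {S : Set Site} (f : Site → ℤ) (hf : ∀ a b, starAdj a b → |f a - f b| ≤ 1)
    {x y : Site} (hx : x ∈ S)
    (h : Relation.ReflTransGen (fun a b => starAdj a b ∧ a ∈ S ∧ b ∈ S) x y) :
    ∀ t, f x ≤ t → t ≤ f y → ∃ z ∈ S, f z = t := by
  induction h with
  | refl => intro t h1 h2; exact ⟨x, hx, le_antisymm h1 h2⟩
  | @tail b c h1 h2 ih =>
    intro t ht1 ht2
    by_cases hb : t ≤ f b
    · exact ih t ht1 hb
    · have := hf b c h2.1
      rw [abs_le] at this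
      exact ⟨c, h2.2.2, by omega⟩

lemma hits_card {A : Finset Site} (hA : stc ↑A) (f : Site → ℤ)
    (hf : ∀ a b, starAdj a b → |f a - f b| ≤ 1) {x y : Site} (hx : x ∈ A) (hy : y ∈ A) :
    |f x - f y| + 1 ≤ ((A.image f).card : ℤ) := by
  wlog hxy : f x ≤ f y generalizing x y with H
  · rw [abs_sub_comm]; exact H hy hx (by omega)
  have h1 : Finset.Icc (f x) (f y) ⊆ A.image f := by
    intro t ht
    rw [Finset.mem_Icc] at ht
    obtain ⟨z, hz, rfl⟩ := path_hits f hf (by simpa using hx) (hA x (by simpa using hx) y (by simpa using hy)) t ht.1 ht.2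
    exact Finset.mem_image_of_mem _ (by simpa using hz)
  have h2 := Finset.card_le_card h1
  rw [Int.card_Icc] at h2
  rw [abs_sub_comm, abs_of_nonneg (by omega)]
  omega

lemma not_small_eb {D : ℝ} {A : Finset Site} (hA : stc ↑A) (h : ¬ small D ↑A) :
    D ≤ edgeBdryCard A := by
  unfold small at h
  push Not at h
  obtain ⟨x, hx, y, hy, h⟩ := h
  have h1 := hits_card hA Prod.fst (fun a b h => h.2.1) (by simpa using hx) (by simpa using hy)
  have h2 := hits_card hA Prod.snd (fun a b h => h.2.2) (by simpa using hx) (by simpa using hy)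
  have h3 := eb_ge A
  unfold rowsF colsF at h3
  have h4 : max |x.1 - y.1| |x.2 - y.2| + 1 ≤ (edgeBdryCard A : ℤ) := by
    rcases max_cases |x.1 - y.1| |x.2 - y.2| with h | h <;> rw [h.1] <;> omega
  have h5 : ((max |x.1 - y.1| |x.2 - y.2| : ℤ) : ℝ) + 1 ≤ edgeBdryCard A := by exact_mod_cast h4
  linarith

end

noncomputable section
open Filter
open scoped BigOperators
attribute [local instance] Classical.propDecidable

/-! ### Counting contours -/

/-- Doubled midpoints of the boundary edges of `A`. -/
def mids (A : Finset Site) : Finset Site :=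
  A.biUnion fun v => (dirs.filter fun d => v + d ∉ A).image fun d => v + (v + d)

lemma mids_card (A : Finset Site) : (mids A).card ≤ edgeBdryCard A := by
  refine Finset.card_biUnion_le.trans (Finset.sum_le_sum fun v _ => Finset.card_image_le)

lemma mem_mids' {A : Finset Site} {m : Site} :
    m ∈ mids A ↔ ∃ u v, adjS u v ∧ u ∈ A ∧ v ∉ A ∧ m = u + v := by
  unfold mids
  simp only [Finset.mem_biUnion, Finset.mem_image, Finset.mem_filter]
  constructor
  · rintro ⟨v, hv, d, ⟨hd, hvd⟩, rfl⟩
    exact ⟨v, v + d, adjS_add hd, hv, hvd, rfl⟩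
  · rintro ⟨u, v, h, hu, hv, rfl⟩
    exact ⟨u, hu, v - u, ⟨h, by simpa using hv⟩, by simp⟩

lemma adj_mid_unique {u v u' v' : Site} (h : adjS u v) (h' : adjS u' v') (he : u + v = u' + v') :
    (u = u' ∧ v = v') ∨ (u = v' ∧ v = u') := by
  rw [adjS_iff] at h h'
  simp only [Prod.ext_iff, Prod.fst_add, Prod.snd_add] at *
  omega

lemma mem_mids {A : Finset Site} {u v : Site} (h : adjS u v) :
    u + v ∈ mids A ↔ (u ∈ A ↔ v ∉ A) := by
  rw [mem_mids']
  constructor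
  · rintro ⟨u', v', h', hu, hv, he⟩
    rcases adj_mid_unique h h' he with ⟨rfl, rfl⟩ | ⟨rfl, rfl⟩ <;> tauto
  · intro hh
    by_cases hu : u ∈ A
    · exact ⟨u, v, h, hu, hh.1 hu, rfl⟩
    · exact ⟨v, u, adjS_symm h, by tauto, hu, add_comm _ _⟩

lemma mids_parity {A : Finset Site} {m : Site} (h : m ∈ mids A) :
    (∃ x y : ℤ, m = (2 * x + 1, 2 * y)) ∨ (∃ x y : ℤ, m = (2 * x, 2 * y + 1)) := by
  obtain ⟨u, v, hh, -, -, rfl⟩ := mem_mids'.1 h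
  rw [adjS_iff] at hh
  rcases hh with h | h | h | h
  · left; exact ⟨u.1, u.2, by ext <;> simp <;> omega⟩
  · left; exact ⟨u.1 - 1, u.2, by ext <;> simp <;> omega⟩
  · right; exact ⟨u.1, u.2, by ext <;> simp <;> omega⟩
  · right; exact ⟨u.1, u.2 - 1, by ext <;> simp <;> omega⟩

lemma mids_inj {A B : Finset Site} (h : mids A = mids B) : A = B := by
  by_contra hne
  have hS : ((A \ B) ∪ (B \ A)).Nonempty := by
    rw [Finset.nonempty_iff_ne_empty]
    intro he
    rw [Finset.union_eq_empty, Finset.sdiff_eq_empty_iff_subset, Finset.sdiff_eq_empty_iff_subset] at he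
    exact hne (Finset.Subset.antisymm he.1 he.2)
  obtain ⟨x, hx, hmax⟩ := Finset.exists_max_image _ Prod.fst hS
  have hadj : adjS x (x + (1, 0)) := adjS_add (by simp [dirs])
  have h1 := mem_mids (A := A) hadj
  have h2 := mem_mids (A := B) hadj
  rw [h] at h1
  have h3 : x + (1, 0) ∉ (A \ B) ∪ (B \ A) := fun hc => by
    have := hmax _ hc
    simp at this
  simp only [Finset.mem_union, Finset.mem_sdiff] at hx h3
  tauto

/-- Range-two adjacency. -/
def near (a b : Site) : Prop := |a.1 - b.1| ≤ 2 ∧ |a.2 - b.2| ≤ 2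

lemma near_symm {a b : Site} (h : near a b) : near b a :=
  ⟨by rw [abs_sub_comm]; exact h.1, by rw [abs_sub_comm]; exact h.2⟩

/-- The crossing parity. -/
def gpar (E : Finset Site) (u : Site) : ZMod 2 :=
  ((E.filter fun m => m.2 = 2 * u.2 ∧ 2 * u.1 < m.1).card : ZMod 2)

def einn (E : Finset Site) (m : Site) : ZMod 2 := if m ∈ E then 1 else 0

lemma gpar_hor {E : Finset Site}
    (hE : ∀ m ∈ E, (∃ x y : ℤ, m = (2 * x + 1, 2 * y)) ∨ (∃ x y : ℤ, m = (2 * x, 2 * y + 1)))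
    (x y : ℤ) : gpar E (x, y) = gpar E (x + 1, y) + einn E (2 * x + 1, 2 * y) := by
  unfold gpar einn
  have h1 : (E.filter fun m => m.2 = 2 * y ∧ 2 * x < m.1) =
      (E.filter fun m => m.2 = 2 * y ∧ 2 * (x + 1) < m.1) ∪
        (E.filter fun m => m = (2 * x + 1, 2 * y)) := by
    ext m
    simp only [Finset.mem_filter, Finset.mem_union]
    constructor
    · rintro ⟨h1, h2, h3⟩
      rcases hE m h1 with ⟨a, b, rfl⟩ | ⟨a, b, rfl⟩
      · simp only [Prod.mk.injEq] at *
        by_cases h : 2 * (x + 1) < 2 * a + 1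
        · exact Or.inl ⟨h1, h2, h⟩
        · right; refine ⟨h1, ?_, h2⟩; omega
      · dsimp only at *; omega
    · rintro (⟨h1, h2, h3⟩ | ⟨h1, h2⟩)
      · exact ⟨h1, h2, by omega⟩
      · subst h2; exact ⟨h1, rfl, by dsimp only; omega⟩
  have h2 : Disjoint (E.filter fun m => m.2 = 2 * y ∧ 2 * (x + 1) < m.1)
        (E.filter fun m => m = (2 * x + 1, 2 * y)) := by
    rw [Finset.disjoint_filter]
    rintro m _ ⟨_, h⟩ rfl
    dsimp only at h; omega
  have h3 : ((E.filter fun m => m = (2 * x + 1, 2 * y)).card : ZMod 2) =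
      if ((2 * x + 1, 2 * y) : Site) ∈ E then 1 else 0 := by
    rw [Finset.filter_eq']
    split_ifs <;> simp
  dsimp only
  rw [h1, Finset.card_union_of_disjoint h2, Nat.cast_add, h3]

lemma zmod2_add_self (a : ZMod 2) : a + a = 0 := CharTwo.add_self_eq_zero a

lemma gpar_ver {E : Finset Site}
    (hE : ∀ m ∈ E, (∃ x y : ℤ, m = (2 * x + 1, 2 * y)) ∨ (∃ x y : ℤ, m = (2 * x, 2 * y + 1)))
    (hp : ∀ x y : ℤ, einn E (2 * x + 1, 2 * y) + einn E (2 * x + 1, 2 * (y + 1)) +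
      einn E (2 * x, 2 * y + 1) + einn E (2 * (x + 1), 2 * y + 1) = 0)
    (x y : ℤ) : gpar E (x, y) + gpar E (x, y + 1) = einn E (2 * x, 2 * y + 1) := by
  set G : ℤ → ZMod 2 := fun x => gpar E (x, y) + gpar E (x, y + 1) + einn E (2 * x, 2 * y + 1)
    with hG
  have step : ∀ x, G x = G (x + 1) := by
    intro x
    have h1 := gpar_hor hE x y
    have h2 := gpar_hor hE x (y + 1)
    have h3 := hp x y
    simp only [hG]
    rw [h1, h2]
    have h4 : einn E (2 * (x + 1), 2 * y + 1) = -(einn E (2 * x + 1, 2 * y) +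
      einn E (2 * x + 1, 2 * (y + 1)) + einn E (2 * x, 2 * y + 1)) := by
      rw [eq_neg_iff_add_eq_zero, add_comm]; exact h3
    rw [h4, CharTwo.neg_eq]; ring
  have stepn : ∀ n : ℕ, ∀ x, G x = G (x + n) := by
    intro n
    induction n with
    | zero => intro x; simp
    | succ n ih => intro x; rw [ih x, step (x + n)]; push_cast; ring_nf
  have big : ∃ N : ℤ, ∀ m ∈ E, m.1 < N := by
    rcases E.eq_empty_or_nonempty with h | h
    · exact ⟨0, by simp [h]⟩
    · obtain ⟨a, _, ha⟩ := Finset.exists_max_image E Prod.fst h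
      exact ⟨a.1 + 1, fun m hm => by have := ha m hm; omega⟩
  obtain ⟨N, hN⟩ := big
  have hz : ∀ t : ℤ, N ≤ t → 0 ≤ t → G t = 0 := by
    intro t ht h0
    have hg : ∀ s : ℤ, gpar E (t, s) = 0 := by
      intro s
      unfold gpar
      rw [Finset.filter_false_of_mem]
      · simp
      · rintro m hm ⟨_, h⟩
        have := hN m hm
        dsimp only at h
        omega
    have he : einn E (2 * t, 2 * y + 1) = 0 := by
      unfold einn
      rw [if_neg]
      intro hc
      have := hN _ hc
      dsimp only at this; omega
    simp only [hG, hg, he, add_zero]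
  have h0 : G x = 0 := by
    rw [stepn (Int.toNat (|N| + |x|)) x]
    have := le_abs_self N
    have := neg_abs_le x
    have := abs_nonneg N
    have := abs_nonneg x
    exact hz _ (by omega) (by omega)
  simp only [hG] at h0
  rw [eq_neg_of_add_eq_zero_left h0, CharTwo.neg_eq]

lemma gpar_adj {E : Finset Site}
    (hE : ∀ m ∈ E, (∃ x y : ℤ, m = (2 * x + 1, 2 * y)) ∨ (∃ x y : ℤ, m = (2 * x, 2 * y + 1)))
    (hp : ∀ x y : ℤ, einn E (2 * x + 1, 2 * y) + einn E (2 * x + 1, 2 * (y + 1)) +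
      einn E (2 * x, 2 * y + 1) + einn E (2 * (x + 1), 2 * y + 1) = 0)
    {u v : Site} (h : adjS u v) : gpar E u + gpar E v = einn E (u + v) := by
  have hor : ∀ x y : ℤ, gpar E (x, y) + gpar E (x + 1, y) = einn E ((x, y) + (x + 1, y)) := by
    intro x y
    rw [gpar_hor hE x y]
    have : ((x, y) + (x + 1, y) : Site) = (2 * x + 1, 2 * y) := by
      ext <;> simp <;> ring
    rw [this, add_right_comm, zmod2_add_self, zero_add]
  have ver : ∀ x y : ℤ, gpar E (x, y) + gpar E (x, y + 1) = einn E ((x, y) + (x, y + 1)) := by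
    intro x y
    rw [gpar_ver hE hp x y]
    have : ((x, y) + (x, y + 1) : Site) = (2 * x, 2 * y + 1) := by
      ext <;> simp <;> ring
    rw [this]
  rw [adjS_iff] at h
  obtain ⟨a, b⟩ := u
  obtain ⟨c, d⟩ := v
  dsimp only at h
  rcases h with ⟨rfl, rfl⟩ | ⟨rfl, rfl⟩ | ⟨rfl, rfl⟩ | ⟨rfl, rfl⟩
  · exact hor _ _
  · have := hor (a - 1) d
    rw [sub_add_cancel] at this
    rw [add_comm, this, add_comm]
  · exact ver _ _
  · have := ver c (b - 1)
    rw [sub_add_cancel] at this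
    rw [add_comm, this, add_comm]

lemma mids_conn {A : Finset Site} (hA : stc ↑A) (hc : connectedIn ((↑A : Set Site)ᶜ))
    {m0 : Site} (hm0 : m0 ∈ mids A) :
    ∀ m ∈ mids A, Relation.ReflTransGen (fun a b => near a b ∧ a ∈ mids A ∧ b ∈ mids A) m0 m := by
  set E := (mids A).filter fun m =>
    Relation.ReflTransGen (fun a b => near a b ∧ a ∈ mids A ∧ b ∈ mids A) m0 m with hEdef
  have hEsub : ∀ m ∈ E, m ∈ mids A := fun m hm => (Finset.mem_filter.1 hm).1
  have hnear : ∀ a b, near a b → a ∈ mids A → b ∈ mids A → (a ∈ E ↔ b ∈ E) := by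
    intro a b hab ha hb
    simp only [hEdef, Finset.mem_filter]
    constructor
    · rintro ⟨_, h⟩; exact ⟨hb, h.tail ⟨hab, ha, hb⟩⟩
    · rintro ⟨_, h⟩; exact ⟨ha, h.tail ⟨near_symm hab, hb, ha⟩⟩
  have hE : ∀ m ∈ E, (∃ x y : ℤ, m = (2 * x + 1, 2 * y)) ∨ (∃ x y : ℤ, m = (2 * x, 2 * y + 1)) :=
    fun m hm => mids_parity (hEsub m hm)
  have hp : ∀ x y : ℤ, einn E (2 * x + 1, 2 * y) + einn E (2 * x + 1, 2 * (y + 1)) +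
      einn E (2 * x, 2 * y + 1) + einn E (2 * (x + 1), 2 * y + 1) = 0 := by
    intro x y
    have e1 : ((2 * x + 1, 2 * y) : Site) = (x, y) + (x + 1, y) := by ext <;> simp <;> ring
    have e2 : ((2 * x + 1, 2 * (y + 1)) : Site) = (x, y + 1) + (x + 1, y + 1) := by
      ext <;> simp <;> ring
    have e3 : ((2 * x, 2 * y + 1) : Site) = (x, y) + (x, y + 1) := by ext <;> simp <;> ring
    have e4 : ((2 * (x + 1), 2 * y + 1) : Site) = (x + 1, y) + (x + 1, y + 1) := by
      ext <;> simp <;> ring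
    have m1 := mem_mids (A := A) (u := (x, y)) (v := (x + 1, y)) (by rw [adjS_iff]; simp)
    have m2 := mem_mids (A := A) (u := (x, y + 1)) (v := (x + 1, y + 1)) (by rw [adjS_iff]; simp)
    have m3 := mem_mids (A := A) (u := (x, y)) (v := (x, y + 1)) (by rw [adjS_iff]; simp)
    have m4 := mem_mids (A := A) (u := (x + 1, y)) (v := (x + 1, y + 1)) (by rw [adjS_iff]; simp)
    rw [← e1] at m1
    rw [← e2] at m2
    rw [← e3] at m3
    rw [← e4] at m4
    have n12 := hnear (2 * x + 1, 2 * y) (2 * x + 1, 2 * (y + 1))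
      ⟨by simp, by rw [abs_le]; dsimp only; omega⟩
    have n13 := hnear (2 * x + 1, 2 * y) (2 * x, 2 * y + 1)
      ⟨by rw [abs_le]; dsimp only; omega, by rw [abs_le]; dsimp only; omega⟩
    have n14 := hnear (2 * x + 1, 2 * y) (2 * (x + 1), 2 * y + 1)
      ⟨by rw [abs_le]; dsimp only; omega, by rw [abs_le]; dsimp only; omega⟩
    have n23 := hnear (2 * x + 1, 2 * (y + 1)) (2 * x, 2 * y + 1)
      ⟨by rw [abs_le]; dsimp only; omega, by rw [abs_le]; dsimp only; omega⟩
    have n24 := hnear (2 * x + 1, 2 * (y + 1)) (2 * (x + 1), 2 * y + 1)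
      ⟨by rw [abs_le]; dsimp only; omega, by rw [abs_le]; dsimp only; omega⟩
    have n34 := hnear (2 * x, 2 * y + 1) (2 * (x + 1), 2 * y + 1)
      ⟨by rw [abs_le]; dsimp only; omega, by rw [abs_le]; dsimp only; omega⟩
    have s1 := hEsub (2 * x + 1, 2 * y)
    have s2 := hEsub (2 * x + 1, 2 * (y + 1))
    have s3 := hEsub (2 * x, 2 * y + 1)
    have s4 := hEsub (2 * (x + 1), 2 * y + 1)
    unfold einn
    clear_value E
    generalize ((2 * x + 1, 2 * y) : Site) = p1 at *
    generalize ((2 * x + 1, 2 * (y + 1)) : Site) = p2 at *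
    generalize ((2 * x, 2 * y + 1) : Site) = p3 at *
    generalize ((2 * (x + 1), 2 * y + 1) : Site) = p4 at *
    clear hEsub hnear hE hEdef e1 e2 e3 e4
    have z2 : (1 + 1 : ZMod 2) = 0 := by decide
    have z4 : (1 + 1 + 1 + 1 : ZMod 2) = 0 := by decide
    by_cases a1 : ((x, y) : Site) ∈ A <;> by_cases a2 : ((x + 1, y) : Site) ∈ A <;>
    by_cases a3 : ((x, y + 1) : Site) ∈ A <;> by_cases a4 : ((x + 1, y + 1) : Site) ∈ A <;>
    simp only [a1, a2, a3, a4, not_true_eq_false, not_false_eq_true, iff_true, iff_false,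
      true_iff, false_iff] at m1 m2 m3 m4 <;>
    simp only [m1, m2, m3, m4, forall_true_left, IsEmpty.forall_iff, imp_false] at n12 n13 n14 n23 n24 n34 s1 s2 s3 s4 <;>
    (try simp only [s1, s2, s3, s4, if_false, n12, n13, n14, n23, n24, n34]) <;>
    (try split_ifs) <;> simp [z2, z4]
  have hadj := fun {u v : Site} (h : adjS u v) => gpar_adj hE hp h
  have eqof : ∀ u v : Site, gpar E u + gpar E v = 0 → gpar E u = gpar E v := by
    intro u v h
    rw [eq_neg_of_add_eq_zero_left h, CharTwo.neg_eq]
  -- constancy on A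
  have hin : ∀ u ∈ A, ∀ v ∈ A, gpar E u = gpar E v := by
    intro u hu v hv
    have hpth := hA u (by simpa using hu) v (by simpa using hv)
    induction hpth with
    | refl => rfl
    | @tail b c h1 h2 ih =>
      have hb : b ∈ A := by simpa using h2.2.1
      have hcA : c ∈ A := by simpa using h2.2.2
      rw [ih hb]
      have direct : ∀ b ∈ A, ∀ c ∈ A, adjS b c → gpar E b = gpar E c := by
        intro b hb c hcA h
        apply eqof
        rw [hadj h]
        unfold einn
        rw [if_neg]
        intro hm
        have := (mem_mids h).1 (hEsub _ hm)
        tauto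
      rcases starAdj_cases h2.1 with h | ⟨z, hz1, hz2⟩
      · exact direct b hb c hcA h
      · by_cases hz : z ∈ A
        · rw [direct b hb z hz hz1, direct z hz c hcA hz2]
        · apply eqof
          have k1 := hadj hz1
          have k2 := hadj hz2
          have k3 : b + z ∈ E ↔ z + c ∈ E := by
            apply hnear
            · obtain ⟨_, q1, q2⟩ := h2.1
              rw [abs_le] at q1 q2
              constructor <;> rw [abs_le] <;> simp <;> omega
            · exact (mem_mids hz1).2 (by tauto)
            · exact (mem_mids hz2).2 (by tauto)
          have k4 : einn E (b + z) = einn E (z + c) := by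
            unfold einn; simp only [k3]
          have : gpar E b + gpar E c = (gpar E b + gpar E z) + (gpar E z + gpar E c) := by
            have := zmod2_add_self (gpar E z)
            linear_combination -this
          rw [this, k1, k2, k4, zmod2_add_self]
  have hout : ∀ u, u ∉ A → ∀ v, v ∉ A → gpar E u = gpar E v := by
    intro u hu v hv
    have hpth := hc u (by simpa using hu) v (by simpa using hv)
    induction hpth with
    | refl => rfl
    | @tail b c h1 h2 ih =>
      have hb : b ∉ A := by simpa using h2.2.1
      have hcA : c ∉ A := by simpa using h2.2.2
      rw [ih hb]
      apply eqof
      rw [hadj h2.1]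
      unfold einn
      rw [if_neg]
      intro hm
      have := (mem_mids h2.1).1 (hEsub _ hm)
      tauto
  obtain ⟨u0, v0, h0, hu0, hv0, rfl⟩ := mem_mids'.1 hm0
  have hE0 : u0 + v0 ∈ E := Finset.mem_filter.2 ⟨hm0, Relation.ReflTransGen.refl⟩
  intro m hm
  obtain ⟨u, v, h, hu, hv, rfl⟩ := mem_mids'.1 hm
  have k1 := hadj h0
  have k2 := hadj h
  rw [hin u hu u0 hu0, hout v hv v0 hv0, k1] at k2
  have k3 : u + v ∈ E := by
    unfold einn at k2
    rw [if_pos hE0] at k2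
    by_contra hcon
    rw [if_neg hcon] at k2
    exact absurd k2 (by decide)
  exact (Finset.mem_filter.1 k3).2

end

noncomputable section
open Filter
open scoped BigOperators
attribute [local instance] Classical.propDecidable

/-! ### Animals -/

def visited : Site → List Site → Finset Site
  | m, [] => {m}
  | m, d :: l => insert m (visited (m + d) l)

def stepBox : Finset Site := Finset.Icc (-2) 2 ×ˢ Finset.Icc (-2) 2

lemma mem_stepBox {d : Site} : d ∈ stepBox ↔ (-2 ≤ d.1 ∧ d.1 ≤ 2) ∧ (-2 ≤ d.2 ∧ d.2 ≤ 2) := by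
  simp [stepBox, Finset.mem_product]

lemma self_mem_visited (m : Site) (l : List Site) : m ∈ visited m l := by
  cases l <;> simp [visited]

lemma visited_insert {d : Site} (hd : d ∈ stepBox) (l : List Site) :
    ∀ (m t : Site), t ∈ visited m l → (∀ e ∈ l, e ∈ stepBox) →
      ∃ l', l'.length = l.length + 2 ∧ (∀ e ∈ l', e ∈ stepBox) ∧
        visited m l' = insert (t + d) (visited m l) := by
  have hnd : -d ∈ stepBox := by
    rw [mem_stepBox] at *
    simp only [Prod.fst_neg, Prod.snd_neg]; omega
  induction l with
  | nil =>
    intro m t ht _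
    simp only [visited, Finset.mem_singleton] at ht
    subst ht
    refine ⟨[d, -d], rfl, by simp [hd, hnd], ?_⟩
    ext z
    simp only [visited, Finset.mem_insert, Finset.mem_singleton, add_neg_cancel_right]; tauto
  | cons e l ih =>
    intro m t ht hl
    by_cases h : t = m
    · subst h
      refine ⟨d :: -d :: e :: l, by simp, ?_, ?_⟩
      · intro e' he'
        simp only [List.mem_cons] at he' hl
        rcases he' with h | h | h
        · exact h ▸ hd
        · exact h ▸ hnd
        · exact hl _ h
      · ext z
        simp only [visited, Finset.mem_insert, add_neg_cancel_right]; tauto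
    · have ht' : t ∈ visited (m + e) l := by
        simp only [visited, Finset.mem_insert] at ht; tauto
      obtain ⟨l', h1, h2, h3⟩ := ih (m + e) t ht' (fun x hx => hl x (by simp [hx]))
      refine ⟨e :: l', by simp [h1], ?_, ?_⟩
      · intro x hx
        simp only [List.mem_cons] at hx
        rcases hx with h | h
        · exact hl x (by simp [h])
        · exact h2 x h
      · ext z
        simp only [visited, h3, Finset.mem_insert]; tauto

lemma visited_pad (m : Site) (l : List Site) (k : ℕ) :
    visited m (List.replicate k 0 ++ l) = visited m l := by
  induction k with
  | zero => simp
  | succ k ih =>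
    rw [List.replicate_succ, List.cons_append]
    simp only [visited, add_zero, ih]
    exact Finset.insert_eq_of_mem (self_mem_visited m l)

lemma near_step {a b : Site} (h : near a b) : b - a ∈ stepBox := by
  rw [mem_stepBox]
  obtain ⟨h1, h2⟩ := h
  rw [abs_le] at h1 h2
  simp only [Prod.fst_sub, Prod.snd_sub]; omega

lemma visited_grow {M : Finset Site} {m0 : Site} (hm0 : m0 ∈ M)
    (hM : ∀ m ∈ M, Relation.ReflTransGen (fun a b => near a b ∧ a ∈ M ∧ b ∈ M) m0 m)
    (n : ℕ) (hn : n + 1 ≤ M.card) :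
    ∃ l : List Site, l.length = 2 * n ∧ (∀ e ∈ l, e ∈ stepBox) ∧ visited m0 l ⊆ M ∧
      (visited m0 l).card = n + 1 := by
  induction n with
  | zero => exact ⟨[], rfl, by simp, by simp [visited, hm0], by simp [visited]⟩
  | succ n ih =>
    obtain ⟨l, h1, h2, h3, h4⟩ := ih (by omega)
    have hex : ∃ t ∈ visited m0 l, ∃ s ∈ M, s ∉ visited m0 l ∧ near t s := by
      by_contra hcon
      push Not at hcon
      have : M ⊆ visited m0 l := by
        intro m hm
        have hp := hM m hm
        clear hm
        induction hp with
        | refl => exact self_mem_visited _ _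
        | @tail b c _ h6 ih2 =>
          by_contra hc
          exact hcon b ih2 c h6.2.2 hc h6.1
      have := Finset.card_le_card this
      omega
    obtain ⟨t, ht, s, hs, hsn, hts⟩ := hex
    obtain ⟨l', k1, k2, k3⟩ := visited_insert (near_step hts) l m0 t ht h2
    have e : t + (s - t) = s := by abel
    rw [e] at k3
    refine ⟨l', by omega, k2, ?_, ?_⟩
    · rw [k3]; exact Finset.insert_subset hs h3
    · rw [k3, Finset.card_insert_of_notMem hsn, h4]

lemma visited_all {M : Finset Site} {m0 : Site} (hm0 : m0 ∈ M)
    (hM : ∀ m ∈ M, Relation.ReflTransGen (fun a b => near a b ∧ a ∈ M ∧ b ∈ M) m0 m)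
    {n : ℕ} (hn : M.card ≤ n) :
    ∃ l : List Site, l.length = 2 * n ∧ (∀ e ∈ l, e ∈ stepBox) ∧ visited m0 l = M := by
  have hpos : 1 ≤ M.card := Finset.card_pos.2 ⟨m0, hm0⟩
  obtain ⟨l, h1, h2, h3, h4⟩ := visited_grow hm0 hM (M.card - 1) (by omega)
  refine ⟨List.replicate (2 * n - l.length) 0 ++ l, by simp; omega, ?_, ?_⟩
  · intro e he
    rw [List.mem_append] at he
    rcases he with he | he
    · rw [List.eq_of_mem_replicate he, mem_stepBox]; simp
    · exact h2 e he
  · rw [visited_pad]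
    exact Finset.eq_of_subset_of_card_le h3 (by omega)

def Vis : ℕ → Site → Finset (Finset Site)
  | 0, m => {{m}}
  | n + 1, m => stepBox.biUnion fun d => (Vis n (m + d)).image (insert m)

lemma stepBox_card : stepBox.card = 25 := by
  unfold stepBox; rw [Finset.card_product]; simp

lemma Vis_card (n : ℕ) : ∀ m, (Vis n m).card ≤ 25 ^ n := by
  induction n with
  | zero => intro m; simp [Vis]
  | succ n ih =>
    intro m
    simp only [Vis]
    refine Finset.card_biUnion_le.trans ?_
    refine (Finset.sum_le_sum (g := fun _ => 25 ^ n) fun d _ => Finset.card_image_le.trans (ih _)).trans ?_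
    rw [Finset.sum_const, stepBox_card, pow_succ, smul_eq_mul, mul_comm]

lemma visited_mem_Vis (l : List Site) : ∀ m, (∀ e ∈ l, e ∈ stepBox) →
    visited m l ∈ Vis l.length m := by
  induction l with
  | nil => intro m _; simp [visited, Vis]
  | cons d l ih =>
    intro m hl
    simp only [visited, List.length_cons, Vis, Finset.mem_biUnion]
    exact ⟨d, hl d (by simp), Finset.mem_image_of_mem _ (ih _ fun e he => hl e (by simp [he]))⟩

lemma mids_root {A : Finset Site} {v : Site} (hv : v ∈ A) :
    ∃ r < edgeBdryCard A, ((2 * v.1 + 2 * (r : ℤ) + 1, 2 * v.2) : Site) ∈ mids A := by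
  have h1 : ∃ n : ℕ, ((v.1 + (n : ℤ) + 1, v.2) : Site) ∉ A := by
    by_contra hcon
    push Not at hcon
    refine Set.infinite_of_injective_forall_mem (s := (↑A : Set Site))
      (f := fun n : ℕ => ((v.1 + (n : ℤ) + 1, v.2) : Site)) ?_ (fun n => by simpa using hcon n) A.finite_toSet
    intro a b hab
    simpa using hab
  have h2 := Nat.find_spec h1
  have h3 : ∀ m < Nat.find h1, ((v.1 + (m : ℤ) + 1, v.2) : Site) ∈ A := fun m hm => by
    have := Nat.find_min h1 hm
    simpa using this
  set n := Nat.find h1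
  have h4 : ∀ m ≤ n, ((v.1 + (m : ℤ), v.2) : Site) ∈ A := by
    intro m hm
    cases m with
    | zero => simpa using hv
    | succ m => have := h3 m (by omega); push_cast; rw [← add_assoc]; exact this
  refine ⟨n, ?_, ?_⟩
  · have h5 : (Finset.range (n + 1)).image (fun m : ℕ => v.1 + (m : ℤ)) ⊆ colsF A := by
      intro t ht
      obtain ⟨m, hm, rfl⟩ := Finset.mem_image.1 ht
      exact Finset.mem_image.2 ⟨_, h4 m (by simpa [Nat.lt_succ_iff] using hm), rfl⟩
    have h6 := Finset.card_le_card h5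
    rw [Finset.card_image_of_injective _ (fun a b h => by simpa using h), Finset.card_range] at h6
    have := eb_ge A
    omega
  · have h5 := (mem_mids (A := A) (u := (v.1 + (n : ℤ), v.2)) (v := (v.1 + (n : ℤ) + 1, v.2))
      (by rw [adjS_iff]; simp)).2 (by have := h4 n le_rfl; tauto)
    have e : ((2 * v.1 + 2 * (n : ℤ) + 1, 2 * v.2) : Site) =
      (v.1 + (n : ℤ), v.2) + (v.1 + (n : ℤ) + 1, v.2) := by ext <;> simp <;> ring
    rw [e]; exact h5

lemma count_le (𝓕 : Finset (Finset Site)) (v : Site) (ℓ : ℕ)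
    (h : ∀ A ∈ 𝓕, v ∈ A ∧ stc ↑A ∧ connectedIn ((↑A : Set Site)ᶜ) ∧ edgeBdryCard A = ℓ) :
    𝓕.card ≤ ℓ * 625 ^ ℓ := by
  have h1 : 𝓕.image mids ⊆ (Finset.range ℓ).biUnion fun r =>
      Vis (2 * ℓ) ((2 * v.1 + 2 * (r : ℤ) + 1, 2 * v.2) : Site) := by
    intro M hM
    obtain ⟨A, hA, rfl⟩ := Finset.mem_image.1 hM
    obtain ⟨h1, h2, h3, h4⟩ := h A hA
    obtain ⟨r, hr, hm⟩ := mids_root h1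
    obtain ⟨l, k1, k2, k3⟩ := visited_all hm (mids_conn h2 h3 hm) (mids_card A)
    rw [h4] at k1 hr
    refine Finset.mem_biUnion.2 ⟨r, Finset.mem_range.2 hr, ?_⟩
    rw [← k1, ← k3]
    exact visited_mem_Vis l _ k2
  have h2 := Finset.card_le_card h1
  rw [Finset.card_image_of_injective _ (fun _ _ h => mids_inj h)] at h2
  refine h2.trans (Finset.card_biUnion_le.trans ?_)
  refine (Finset.sum_le_sum (g := fun _ => 25 ^ (2 * ℓ)) fun r _ => Vis_card _ _).trans ?_
  rw [Finset.sum_const, Finset.card_range, smul_eq_mul, pow_mul]; norm_num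

lemma exp8 : (2500 : ℝ) ≤ Real.exp 8 := by
  have h := Real.exp_one_gt_d9
  have : Real.exp 8 = Real.exp 1 ^ 8 := by rw [← Real.exp_nat_mul]; norm_num
  rw [this]
  calc (2500 : ℝ) ≤ 2.7 ^ 8 := by norm_num
    _ ≤ Real.exp 1 ^ 8 := by gcongr; linarith

lemma geo_half (N : ℕ) : ∑ ℓ ∈ Finset.Icc 1 N, ((1:ℝ) / 2) ^ ℓ ≤ 1 := by
  have : ∑ ℓ ∈ Finset.Icc 1 N, ((1:ℝ) / 2) ^ ℓ = 1 - (1/2) ^ N := by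
    induction N with
    | zero => simp
    | succ N ih => rw [Finset.sum_Icc_succ_top (by omega), ih, pow_succ]; ring
  rw [this]
  have : (0:ℝ) ≤ (1/2)^N := by positivity
  linarith

lemma count_sum (𝓕 : Finset (Finset Site)) (v : Site) (n : ℕ) (hn : 1 ≤ n) (α : ℝ) (hα : 8 ≤ α)
    (h : ∀ A ∈ 𝓕, v ∈ A ∧ stc ↑A ∧ connectedIn ((↑A : Set Site)ᶜ) ∧ n ≤ edgeBdryCard A) :
    ∑ A ∈ 𝓕, Real.exp (-α * edgeBdryCard A) ≤ Real.exp (-(α - 8) * n) := by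
  set N := 𝓕.sup edgeBdryCard
  have hN : ∀ A ∈ 𝓕, edgeBdryCard A ∈ Finset.Icc 1 N := fun A hA =>
    Finset.mem_Icc.2 ⟨hn.trans (h A hA).2.2.2, Finset.le_sup hA⟩
  rw [← Finset.sum_fiberwise_of_maps_to hN]
  have key : ∀ ℓ ∈ Finset.Icc 1 N, ∑ A ∈ 𝓕.filter (fun A => edgeBdryCard A = ℓ),
      Real.exp (-α * edgeBdryCard A) ≤ Real.exp (-(α - 8) * n) * (1 / 2) ^ ℓ := by
    intro ℓ hℓ
    rcases (𝓕.filter (fun A => edgeBdryCard A = ℓ)).eq_empty_or_nonempty with he | ⟨A0, hA0⟩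
    · rw [he, Finset.sum_empty]; positivity
    have hnl : n ≤ ℓ := by
      rw [Finset.mem_filter] at hA0
      exact hA0.2 ▸ (h A0 hA0.1).2.2.2
    have hc := count_le (𝓕.filter (fun A => edgeBdryCard A = ℓ)) v ℓ (by
      intro A hA
      rw [Finset.mem_filter] at hA
      have := h A hA.1
      exact ⟨this.1, this.2.1, this.2.2.1, hA.2⟩)
    have h1 : ∑ A ∈ 𝓕.filter (fun A => edgeBdryCard A = ℓ), Real.exp (-α * edgeBdryCard A) =
        ((𝓕.filter (fun A => edgeBdryCard A = ℓ)).card : ℝ) * Real.exp (-α * ℓ) := by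
      rw [← nsmul_eq_mul, ← Finset.sum_const]
      refine Finset.sum_congr rfl fun A hA => ?_
      rw [(Finset.mem_filter.1 hA).2]
    rw [h1]
    have h2 : ((𝓕.filter (fun A => edgeBdryCard A = ℓ)).card : ℝ) ≤ 1250 ^ ℓ := by
      have h3 : ℓ * 625 ^ ℓ ≤ 1250 ^ ℓ := by
        rw [show 1250 = 2 * 625 by norm_num, mul_pow]
        gcongr
        exact Nat.lt_two_pow_self.le
      exact_mod_cast hc.trans h3
    have h4 : (1250 : ℝ) ^ ℓ ≤ Real.exp (8 * ℓ) * (1 / 2) ^ ℓ := by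
      rw [mul_comm (8:ℝ), Real.exp_nat_mul, ← mul_pow]
      gcongr
      have := exp8
      linarith
    calc _ ≤ (Real.exp (8 * ℓ) * (1 / 2) ^ ℓ) * Real.exp (-α * ℓ) := by gcongr; exact h2.trans h4
      _ = Real.exp (-(α - 8) * ℓ) * (1 / 2) ^ ℓ := by
        rw [mul_right_comm, ← Real.exp_add]; congr 2; ring
      _ ≤ _ := by
        refine mul_le_mul_of_nonneg_right (Real.exp_le_exp.2 ?_) (by positivity)
        have : (n : ℝ) ≤ ℓ := by exact_mod_cast hnl
        nlinarith
  refine (Finset.sum_le_sum key).trans ?_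
  rw [← Finset.mul_sum]
  have := geo_half N
  have h0 := Real.exp_pos (-(α - 8) * n)
  nlinarith

end

noncomputable section
open Filter
open scoped BigOperators
attribute [local instance] Classical.propDecidable

/-! ### Energy decompositions -/

lemma sum_reversal (X Y : Finset Site) (F : Site → Site → ℝ) :
    ∑ v ∈ X, ∑ d ∈ dirs, (if v + d ∈ Y then F v (v + d) else 0) =
      ∑ w ∈ Y, ∑ d ∈ dirs, (if w + d ∈ X then F (w + d) w else 0) := by
  rw [← Finset.sum_product', ← Finset.sum_product', ← Finset.sum_filter, ← Finset.sum_filter]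
  refine Finset.sum_bij' (fun p _ => (p.1 + p.2, -p.2)) (fun p _ => (p.1 + p.2, -p.2)) ?_ ?_ ?_ ?_ ?_
  · rintro ⟨v, d⟩ h
    simp only [Finset.mem_filter, Finset.mem_product] at h ⊢
    exact ⟨⟨h.2, neg_mem_dirs h.1.2⟩, by simpa using h.1.1⟩
  · rintro ⟨v, d⟩ h
    simp only [Finset.mem_filter, Finset.mem_product] at h ⊢
    exact ⟨⟨h.2, neg_mem_dirs h.1.2⟩, by simpa using h.1.1⟩
  · rintro ⟨v, d⟩ h; simp
  · rintro ⟨v, d⟩ h; simp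
  · rintro ⟨v, d⟩ h; simp

lemma energy_decomp {A V : Finset Site} (hA : A ⊆ V) (ψ : Site → ℤ) :
    sosEnergy V ψ = sosEnergy A ψ + ∑ v ∈ V \ A, ∑ d ∈ dirs,
      (if v + d ∈ A then 0 else (if v + d ∈ V then (1 : ℝ) / 2 else 1) *
        |(ψ v : ℝ) - (ψ (v + d) : ℝ)|) := by
  unfold sosEnergy
  have h1 := sum_reversal (V \ A) A (fun v w => (1/2 : ℝ) * |(ψ v : ℝ) - (ψ w : ℝ)|)
  rw [← Finset.sum_sdiff hA]
  have h2 : ∑ v ∈ V \ A, ∑ d ∈ dirs, (if v + d ∈ V then (1 : ℝ) / 2 else 1) *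
        |(ψ v : ℝ) - (ψ (v + d) : ℝ)| =
      ∑ v ∈ V \ A, ∑ d ∈ dirs, (if v + d ∈ A then (1/2 : ℝ) * |(ψ v : ℝ) - (ψ (v + d) : ℝ)| else 0) +
      ∑ v ∈ V \ A, ∑ d ∈ dirs,
      (if v + d ∈ A then 0 else (if v + d ∈ V then (1 : ℝ) / 2 else 1) *
        |(ψ v : ℝ) - (ψ (v + d) : ℝ)|) := by
    rw [← Finset.sum_add_distrib]
    refine Finset.sum_congr rfl fun v _ => ?_
    rw [← Finset.sum_add_distrib]
    refine Finset.sum_congr rfl fun d _ => ?_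
    by_cases h : v + d ∈ A
    · simp [h, hA h]
    · simp [h]
  have h3 : ∑ v ∈ A, ∑ d ∈ dirs, (if v + d ∈ A then (1 : ℝ) / 2 else 1) *
        |(ψ v : ℝ) - (ψ (v + d) : ℝ)| =
      ∑ w ∈ A, ∑ d ∈ dirs, (if w + d ∈ V \ A then (1/2 : ℝ) * |(ψ (w + d) : ℝ) - (ψ w : ℝ)| else 0) +
      ∑ v ∈ A, ∑ d ∈ dirs, (if v + d ∈ V then (1 : ℝ) / 2 else 1) *
        |(ψ v : ℝ) - (ψ (v + d) : ℝ)| := by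
    rw [← Finset.sum_add_distrib]
    refine Finset.sum_congr rfl fun v _ => ?_
    rw [← Finset.sum_add_distrib]
    refine Finset.sum_congr rfl fun d _ => ?_
    by_cases h : v + d ∈ A
    · simp [h, hA h]
    · by_cases h' : v + d ∈ V
      · simp only [h, h', Finset.mem_sdiff, not_false_eq_true, and_self, if_true, if_false]
        rw [abs_sub_comm]; ring
      · simp [h, h']
  rw [h2, h1, h3]
  ring

/-- The energy difference between configurations agreeing off `A`. -/
lemma energy_local {A V : Finset Site} (hA : A ⊆ V) {ψ ψ' : Site → ℤ}
    (h : ∀ x, x ∉ A → ψ x = ψ' x) :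
    sosEnergy V ψ - sosEnergy A ψ = sosEnergy V ψ' - sosEnergy A ψ' := by
  rw [energy_decomp hA ψ, energy_decomp hA ψ', add_sub_cancel_left, add_sub_cancel_left]
  refine Finset.sum_congr rfl fun v hv => Finset.sum_congr rfl fun d _ => ?_
  rw [Finset.mem_sdiff] at hv
  split_ifs with h1
  · rfl
  · rw [h v hv.2, h (v + d) h1]
  · rw [h v hv.2, h (v + d) h1]

/-- Shift the heights on `A` by `s`. -/
def shiftOn (A : Finset Site) (s : ℤ) (ψ : Site → ℤ) : Site → ℤ :=
  fun x => if x ∈ A then ψ x + s else ψ x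

lemma shiftOn_in {A : Finset Site} {x : Site} (h : x ∈ A) (s : ℤ) (ψ : Site → ℤ) :
    shiftOn A s ψ x = ψ x + s := if_pos h
lemma shiftOn_out {A : Finset Site} {x : Site} (h : x ∉ A) (s : ℤ) (ψ : Site → ℤ) :
    shiftOn A s ψ x = ψ x := if_neg h

lemma shiftOn_inj (A : Finset Site) (s : ℤ) : Function.Injective (shiftOn A s) := by
  intro ψ ψ' h
  ext x
  have := congrFun h x
  unfold shiftOn at this
  split_ifs at this <;> omega

lemma field_shiftOn {A V : Finset Site} (hA : A ⊆ V) (s : ℤ) (ψ : Site → ℤ) :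
    sosField V (shiftOn A s ψ) = sosField V ψ + s * A.card := by
  unfold sosField
  have : ∀ v ∈ V, ((shiftOn A s ψ v : ℤ) : ℝ) = (ψ v : ℝ) + (if v ∈ A then (s : ℝ) else 0) := by
    intro v _
    unfold shiftOn
    split_ifs <;> push_cast <;> ring
  rw [Finset.sum_congr rfl this, Finset.sum_add_distrib, ← Finset.sum_filter,
    Finset.filter_mem_eq_inter, Finset.inter_eq_right.2 hA, Finset.sum_const, nsmul_eq_mul]
  ring

lemma energy_shiftOn {A V : Finset Site} (hA : A ⊆ V) {s : ℤ} {ψ : Site → ℤ}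
    (h : ∀ v ∈ A, ∀ d ∈ dirs, v + d ∉ A → |ψ v + s - ψ (v + d)| = |ψ v - ψ (v + d)| - 1) :
    sosEnergy V (shiftOn A s ψ) = sosEnergy V ψ - edgeBdryCard A := by
  have h1 := energy_local hA (ψ := shiftOn A s ψ) (ψ' := ψ) (fun x hx => shiftOn_out hx s ψ)
  have h2 : sosEnergy A (shiftOn A s ψ) = sosEnergy A ψ - edgeBdryCard A := by
    unfold sosEnergy edgeBdryCard
    push_cast
    rw [← Finset.sum_sub_distrib]
    refine Finset.sum_congr rfl fun v hv => ?_
    rw [Finset.card_filter]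
    push_cast
    rw [← Finset.sum_sub_distrib]
    refine Finset.sum_congr rfl fun d hd => ?_
    by_cases hvd : v + d ∈ A
    · rw [shiftOn_in hv, shiftOn_in hvd]; simp [hvd]
    · rw [shiftOn_in hv, shiftOn_out hvd]
      have := h v hv d hd hvd
      have h3 : |((ψ v + s : ℤ) : ℝ) - (ψ (v + d) : ℝ)| = |(ψ v : ℝ) - (ψ (v + d) : ℝ)| - 1 := by
        exact_mod_cast this
      simp only [hvd, if_false, not_false_eq_true, if_true, one_mul]
      rw [h3]
  linarith

lemma wt_raise (β lam : ℝ) {A V : Finset Site} (hA : A ⊆ V) {ψ : Site → ℤ}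
    (h : ∀ v ∈ A, ∀ d ∈ dirs, v + d ∉ A → ψ v + 1 ≤ ψ (v + d)) :
    sosWt β lam V ψ = Real.exp (-β * edgeBdryCard A + lam * A.card) *
      sosWt β lam V (shiftOn A 1 ψ) := by
  unfold sosWt
  rw [energy_shiftOn hA (s := 1) (ψ := ψ), field_shiftOn hA, ← Real.exp_add]
  · congr 1; push_cast; ring
  · intro v hv d hd hvd
    have := h v hv d hd hvd
    rw [abs_of_nonpos (by omega), abs_of_nonpos (by omega)]; ring

lemma wt_lower (β lam : ℝ) {A V : Finset Site} (hA : A ⊆ V) {ψ : Site → ℤ}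
    (h : ∀ v ∈ A, ∀ d ∈ dirs, v + d ∉ A → ψ (v + d) + 1 ≤ ψ v) :
    sosWt β lam V ψ = Real.exp (-β * edgeBdryCard A - lam * A.card) *
      sosWt β lam V (shiftOn A (-1) ψ) := by
  unfold sosWt
  rw [energy_shiftOn hA (s := -1) (ψ := ψ), field_shiftOn hA, ← Real.exp_add]
  · congr 1; push_cast; ring
  · intro v hv d hd hvd
    have := h v hv d hd hvd
    rw [abs_of_nonneg (by omega), abs_of_nonneg (by omega)]; ring

lemma wt_global (β lam : ℝ) (V : Finset Site) (ψ : Site → ℤ) (s : ℤ) :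
    sosWt β lam V (fun x => ψ x + s) = Real.exp (-lam * s * V.card) * sosWt β lam V ψ := by
  unfold sosWt sosEnergy sosField
  rw [← Real.exp_add]
  congr 1
  have h1 : ∀ v d : Site, |((ψ v + s : ℤ) : ℝ) - ((ψ (v + d) + s : ℤ) : ℝ)| =
    |(ψ v : ℝ) - (ψ (v + d) : ℝ)| := by intro v d; push_cast; congr 1; ring
  simp only [h1]
  push_cast
  rw [Finset.sum_add_distrib, Finset.sum_const, nsmul_eq_mul]
  ring

/-- Override `ψ` on `A` by `φ`. -/
def glue (A : Finset Site) (φ ψ : Site → ℤ) : Site → ℤ := fun x => if x ∈ A then φ x else ψ x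

lemma glue_in {A : Finset Site} {x : Site} (h : x ∈ A) (φ ψ : Site → ℤ) : glue A φ ψ x = φ x :=
  if_pos h
lemma glue_out {A : Finset Site} {x : Site} (h : x ∉ A) (φ ψ : Site → ℤ) : glue A φ ψ x = ψ x :=
  if_neg h

lemma energy_congr {A : Finset Site} {ψ ψ' : Site → ℤ} (h : ∀ v ∈ A, ψ v = ψ' v)
    (h' : ∀ v ∈ A, ∀ d ∈ dirs, v + d ∉ A → ψ (v + d) = ψ' (v + d)) :
    sosEnergy A ψ = sosEnergy A ψ' := by
  unfold sosEnergy
  refine Finset.sum_congr rfl fun v hv => Finset.sum_congr rfl fun d hd => ?_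
  have : ψ (v + d) = ψ' (v + d) := by
    by_cases hvd : v + d ∈ A
    · exact h _ hvd
    · exact h' v hv d hd hvd
  rw [h v hv, this]

/-- Factorization of the weight at a level-`H` collar. `o` is the outer configuration (equal
to `H` on `A`), `i` the inner one (equal to `H` off `A`). -/
lemma wt_glue (β lam : ℝ) {A V : Finset Site} (hA : A ⊆ V) {o i : Site → ℤ} {H : ℤ}
    (ho : ∀ x ∈ A, o x = H) (ho' : ∀ v ∈ A, ∀ d ∈ dirs, v + d ∉ A → o (v + d) = H)
    (hi : ∀ x, x ∉ A → i x = H) :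
    sosWt β lam V (glue A i o) =
      Real.exp (lam * H * A.card) * (sosWt β lam V o * sosWt β lam A i) := by
  have h1 := energy_local hA (ψ := glue A i o) (ψ' := o) (fun x hx => glue_out hx i o)
  have h2 : sosEnergy A o = 0 := by
    unfold sosEnergy
    refine Finset.sum_eq_zero fun v hv => Finset.sum_eq_zero fun d hd => ?_
    have : o (v + d) = H := by
      by_cases hvd : v + d ∈ A
      · exact ho _ hvd
      · exact ho' v hv d hd hvd
    rw [ho v hv, this]; simp
  have h3 : sosEnergy A (glue A i o) = sosEnergy A i := by
    apply energy_congr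
    · intro v hv; exact glue_in hv i o
    · intro v hv d hd hvd
      rw [glue_out hvd, ho' v hv d hd hvd, hi _ hvd]
  have h4 : sosField V (glue A i o) = sosField V o + sosField A i - H * A.card := by
    unfold sosField
    rw [← Finset.sum_sdiff hA, ← Finset.sum_sdiff hA (f := fun v => (o v : ℝ))]
    rw [Finset.sum_congr rfl (fun v hv => by rw [glue_out (Finset.mem_sdiff.1 hv).2] :
      ∀ v ∈ V \ A, ((glue A i o v : ℤ) : ℝ) = (o v : ℝ))]
    rw [Finset.sum_congr rfl (fun v hv => by rw [glue_in hv] :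
      ∀ v ∈ A, ((glue A i o v : ℤ) : ℝ) = (i v : ℝ))]
    rw [Finset.sum_congr rfl (fun v hv => by rw [ho v hv] :
      ∀ v ∈ A, ((o v : ℤ) : ℝ) = (H : ℝ)), Finset.sum_const, nsmul_eq_mul]
    ring
  have h5 : sosEnergy V (glue A i o) = sosEnergy V o + sosEnergy A i := by linarith
  unfold sosWt
  rw [h4, h5, ← Real.exp_add, ← Real.exp_add]
  congr 1; ring

/-- Spike weight. -/
lemma wt_spike (β lam : ℝ) {V : Finset Site} {v : Site} (hv : v ∈ V) {ψ : Site → ℤ} {H : ℤ}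
    (hH : 0 ≤ H) (h0 : ψ v = H) (h : ∀ d ∈ dirs, ψ (v + d) = H) :
    sosWt β lam V (Function.update ψ v 0) =
      Real.exp (-(4 * β - lam) * H) * sosWt β lam V ψ := by
  have hA : ({v} : Finset Site) ⊆ V := by simpa using hv
  have hne : ∀ d ∈ dirs, v + d ≠ v := by
    intro d hd; rw [mem_dirs_iff] at hd
    rcases hd with h | h | h | h <;> subst h <;> simp
  have h1 := energy_local hA (ψ := Function.update ψ v 0) (ψ' := ψ)
    (fun x hx => Function.update_of_ne (by simpa using hx) _ _)
  have h2 : sosEnergy {v} ψ = 0 := by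
    unfold sosEnergy
    refine Finset.sum_eq_zero fun w hw => Finset.sum_eq_zero fun d hd => ?_
    rw [Finset.mem_singleton.1 hw, h0, h d hd]; simp
  have h3 : sosEnergy {v} (Function.update ψ v 0) = 4 * H := by
    unfold sosEnergy
    rw [Finset.sum_singleton]
    have : ∀ d ∈ dirs, (if v + d ∈ ({v} : Finset Site) then (1 : ℝ) / 2 else 1) *
        |((Function.update ψ v 0 v : ℤ) : ℝ) - ((Function.update ψ v 0 (v + d) : ℤ) : ℝ)| = H := by
      intro d hd
      rw [if_neg (by simpa using hne d hd), Function.update_self, Function.update_of_ne (hne d hd),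
        h d hd]
      have : (0 : ℝ) ≤ H := by exact_mod_cast hH
      simp [abs_of_nonneg this]
    rw [Finset.sum_congr rfl this, Finset.sum_const, nsmul_eq_mul]
    rw [show dirs.card = 4 by decide]; norm_num
  have h4 : sosField V (Function.update ψ v 0) = sosField V ψ - H := by
    unfold sosField
    rw [← Finset.add_sum_erase V _ hv, ← Finset.add_sum_erase V (fun v => (ψ v : ℝ)) hv, h0]
    rw [Finset.sum_congr rfl (fun w hw => by
      rw [Function.update_of_ne (Finset.ne_of_mem_erase hw)] :
      ∀ w ∈ V.erase v, ((Function.update ψ v 0 w : ℤ) : ℝ) = (ψ w : ℝ))]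
    simp
  unfold sosWt
  rw [h4, ← Real.exp_add, show sosEnergy V (Function.update ψ v 0) = sosEnergy V ψ + 4 * H by linarith]
  congr 1; ring

lemma energy_nonneg (V : Finset Site) (ψ : Site → ℤ) : 0 ≤ sosEnergy V ψ := by
  unfold sosEnergy
  refine Finset.sum_nonneg fun v _ => Finset.sum_nonneg fun d _ => ?_
  split_ifs <;> positivity

lemma wt_pos (β lam : ℝ) (V : Finset Site) (ψ : Site → ℤ) : 0 < sosWt β lam V ψ := Real.exp_pos _

end

noncomputable section
open Filter
open scoped BigOperators ENNReal
attribute [local instance] Classical.propDecidable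

/-! ### Masses -/

/-- The total weight of a set. -/
def mass {α : Type*} (w : α → ℝ≥0∞) (S : Set α) : ℝ≥0∞ := ∑' x, S.indicator w x

lemma mass_mono {α : Type*} (w : α → ℝ≥0∞) {S T : Set α} (h : S ⊆ T) : mass w S ≤ mass w T :=
  ENNReal.tsum_le_tsum fun x => Set.indicator_le_indicator_of_subset h (fun _ => zero_le) x

lemma mass_union_le {α : Type*} (w : α → ℝ≥0∞) (S T : Set α) :
    mass w (S ∪ T) ≤ mass w S + mass w T := by
  unfold mass
  rw [← ENNReal.tsum_add]
  refine ENNReal.tsum_le_tsum fun x => ?_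
  by_cases h1 : x ∈ S
  · simp [h1]
  · by_cases h2 : x ∈ T <;> simp [h1, h2]

lemma mass_union_disj {α : Type*} (w : α → ℝ≥0∞) {S T : Set α} (h : Disjoint S T) :
    mass w (S ∪ T) = mass w S + mass w T := by
  unfold mass
  rw [← ENNReal.tsum_add, Set.indicator_union_of_disjoint h]

lemma mass_cover {α : Type*} (w : α → ℝ≥0∞) {S T U : Set α} (h : S ⊆ T ∪ U) :
    mass w S ≤ mass w T + mass w U := (mass_mono w h).trans (mass_union_le w T U)

lemma mass_biUnion_le {α ι : Type*} (w : α → ℝ≥0∞) {S : Set α} (t : Finset ι) (T : ι → Set α)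
    (h : ∀ x ∈ S, ∃ i ∈ t, x ∈ T i) : mass w S ≤ ∑ i ∈ t, mass w (T i) := by
  unfold mass
  rw [← Summable.tsum_finsetSum (fun _ _ => ENNReal.summable)]
  refine ENNReal.tsum_le_tsum fun x => ?_
  by_cases hx : x ∈ S
  · obtain ⟨i, hi, hxi⟩ := h x hx
    rw [Set.indicator_of_mem hx]
    calc w x = (T i).indicator w x := (Set.indicator_of_mem hxi w).symm
      _ ≤ _ := Finset.single_le_sum (f := fun i => (T i).indicator w x) (fun _ _ => zero_le) hi
  · rw [Set.indicator_of_notMem hx]; exact zero_le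

lemma mass_sub {α : Type*} (w : α → ℝ≥0∞) (S : Set α) : mass w S = ∑' x : S, w x :=
  (tsum_subtype S w).symm

lemma mass_transport {α γ : Type*} (w : α → ℝ≥0∞) (w' : γ → ℝ≥0∞) {S : Set α} {S' : Set γ}
    (T : α → γ) (hT : Set.InjOn T S) (hS : ∀ x ∈ S, T x ∈ S') (c : ℝ≥0∞)
    (hw : ∀ x ∈ S, w x ≤ c * w' (T x)) : mass w S ≤ c * mass w' S' := by
  rw [mass_sub, mass_sub, ← ENNReal.tsum_mul_left]
  let f : S → S' := fun x => ⟨T x, hS x x.2⟩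
  have hf : Function.Injective f := by
    intro x y h
    exact Subtype.ext (hT x.2 y.2 (congrArg Subtype.val h))
  refine (ENNReal.tsum_le_tsum fun x : S => hw x x.2).trans ?_
  exact ENNReal.tsum_comp_le_tsum_of_injective hf (fun y : S' => c * w' y)

lemma mass_prod {α γ : Type*} (w : α → ℝ≥0∞) (w' : γ → ℝ≥0∞) (S : Set α) (S' : Set γ) :
    mass (fun p : α × γ => w p.1 * w' p.2) (S ×ˢ S') = mass w S * mass w' S' := by
  unfold mass
  rw [ENNReal.tsum_prod', ← ENNReal.tsum_mul_right]
  refine tsum_congr fun a => ?_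
  rw [← ENNReal.tsum_mul_left]
  refine tsum_congr fun b => ?_
  by_cases h1 : a ∈ S <;> by_cases h2 : b ∈ S' <;> simp [h1, h2]

/-- Total SOS weight of a set of configurations. -/
def wE (β lam : ℝ) (V : Finset Site) (ψ : Site → ℤ) : ℝ≥0∞ := ENNReal.ofReal (sosWt β lam V ψ)

def Mw (β lam : ℝ) (V : Finset Site) (S : Set (Site → ℤ)) : ℝ≥0∞ := mass (wE β lam V) S

lemma Mw_toReal (β lam : ℝ) (V : Finset Site) (S : Set (Site → ℤ)) :
    (Mw β lam V S).toReal = ∑' ψ, S.indicator (sosWt β lam V) ψ := by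
  unfold Mw mass
  rw [ENNReal.tsum_toReal_eq]
  · refine tsum_congr fun ψ => ?_
    by_cases h : ψ ∈ S
    · simp [h, wE, ENNReal.toReal_ofReal (wt_pos β lam V ψ).le]
    · simp [h]
  · intro ψ
    by_cases h : ψ ∈ S
    · simp [h, wE]
    · simp [h]

lemma Mw_transport {β lam : ℝ} {V : Finset Site} {S S' : Set (Site → ℤ)}
    (T : (Site → ℤ) → (Site → ℤ)) (hT : Set.InjOn T S) (hS : ∀ ψ ∈ S, T ψ ∈ S') (c : ℝ) (hc : 0 ≤ c)
    (hw : ∀ ψ ∈ S, sosWt β lam V ψ ≤ c * sosWt β lam V (T ψ)) :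
    Mw β lam V S ≤ ENNReal.ofReal c * Mw β lam V S' := by
  refine mass_transport _ _ T hT hS _ fun ψ hψ => ?_
  unfold wE
  rw [← ENNReal.ofReal_mul hc]
  exact ENNReal.ofReal_le_ofReal (hw ψ hψ)

/-- Configurations with boundary value `h` and signing, and floor `f`. -/
def cfg (V : Finset Site) (η : Site → BSign) (h : ℤ) (f : Site → ℤ) : Set (Site → ℤ) :=
  {ψ | (∀ x, x ∉ V → ψ x = h) ∧ (∀ v ∈ V, f v ≤ ψ v) ∧
       ∀ v ∈ innerBdry V, BSign.ok (η v) h (ψ v)}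

lemma cfg_zero (V : Finset Site) (η : Site → BSign) (h : ℤ) :
    cfg V η h (fun _ => 0) = signedConfigs V η h := rfl

lemma geom_ne_top {lam : ℝ} (h : 0 < lam) :
    ∑' n : ℕ, ENNReal.ofReal (Real.exp (-lam * n)) ≠ ⊤ := by
  have h1 : ∀ n : ℕ, ENNReal.ofReal (Real.exp (-lam * n)) = (ENNReal.ofReal (Real.exp (-lam))) ^ n := by
    intro n
    rw [← ENNReal.ofReal_pow (Real.exp_pos _).le, ← Real.exp_nat_mul]; congr 2; ring
  simp only [h1]
  rw [ENNReal.tsum_geometric]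
  rw [ENNReal.inv_ne_top]
  have : ENNReal.ofReal (Real.exp (-lam)) < 1 := by
    rw [ENNReal.ofReal_lt_one, Real.exp_lt_one_iff]; linarith
  exact (tsub_pos_of_lt this).ne'

lemma field_mass_ne_top {lam : ℝ} (hl : 0 < lam) (h : ℤ) (V : Finset Site) :
    mass (fun ψ : Site → ℤ => ENNReal.ofReal (Real.exp (-lam * sosField V ψ)))
      {ψ | (∀ x, x ∉ V → ψ x = h) ∧ (∀ v ∈ V, 0 ≤ ψ v)} ≠ ⊤ := by
  induction V using Finset.induction_on with
  | empty =>
    have : {ψ : Site → ℤ | (∀ x, x ∉ (∅ : Finset Site) → ψ x = h) ∧ (∀ v ∈ (∅ : Finset Site), 0 ≤ ψ v)} =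
        {fun _ => h} := by
      ext ψ; simp [funext_iff]
    rw [this, mass_sub]
    simp
  | insert a V ha ih =>
    have key := mass_transport
      (fun ψ : Site → ℤ => ENNReal.ofReal (Real.exp (-lam * sosField (insert a V) ψ)))
      (fun p : ℕ × (Site → ℤ) => ENNReal.ofReal (Real.exp (-lam * p.1)) *
        ENNReal.ofReal (Real.exp (-lam * sosField V p.2)))
      (S := {ψ | (∀ x, x ∉ insert a V → ψ x = h) ∧ (∀ v ∈ insert a V, 0 ≤ ψ v)})
      (S' := (Set.univ : Set ℕ) ×ˢ {ψ | (∀ x, x ∉ V → ψ x = h) ∧ (∀ v ∈ V, 0 ≤ ψ v)})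
      (fun ψ => ((ψ a).toNat, Function.update ψ a h)) ?_ ?_ 1 ?_
    · rw [one_mul, mass_prod (fun n : ℕ => ENNReal.ofReal (Real.exp (-lam * n)))
        (fun ψ : Site → ℤ => ENNReal.ofReal (Real.exp (-lam * sosField V ψ)))] at key
      refine ne_top_of_le_ne_top (ENNReal.mul_ne_top ?_ ih) key
      unfold mass
      simpa using geom_ne_top hl
    · intro ψ hψ ψ' hψ' he
      simp only [Prod.mk.injEq] at he
      ext x
      by_cases hx : x = a
      · subst hx
        have h1 := hψ.2 x (by simp)
        have h2 := hψ'.2 x (by simp)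
        omega
      · have := congrFun he.2 x
        rwa [Function.update_of_ne hx, Function.update_of_ne hx] at this
    · intro ψ hψ
      refine ⟨trivial, ?_, ?_⟩
      · intro x hx
        by_cases hxa : x = a
        · subst hxa; simp
        · dsimp only; rw [Function.update_of_ne hxa]; exact hψ.1 x (by simp [hxa, hx])
      · intro v hv
        have hne : v ≠ a := fun hc => ha (hc ▸ hv)
        dsimp only
        rw [Function.update_of_ne hne]
        exact hψ.2 v (by simp [hv])
    · intro ψ hψ
      rw [one_mul, ← ENNReal.ofReal_mul (Real.exp_pos _).le, ← Real.exp_add]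
      refine ENNReal.ofReal_le_ofReal (Real.exp_le_exp.2 (le_of_eq ?_))
      have h1 : sosField V (Function.update ψ a h) = sosField V ψ := by
        unfold sosField
        refine Finset.sum_congr rfl fun v hv => ?_
        have hne : v ≠ a := fun hc => ha (hc ▸ hv)
        rw [Function.update_of_ne hne]
      have h2 : ((ψ a).toNat : ℝ) = (ψ a : ℝ) := by
        have := Int.toNat_of_nonneg (hψ.2 a (by simp))
        exact_mod_cast this
      rw [h1]
      dsimp only
      rw [h2]
      unfold sosField
      rw [Finset.sum_insert ha]; ring

lemma Mw_ne_top {β lam : ℝ} (hβ : 0 ≤ β) (hl : 0 < lam) {V : Finset Site} {η : Site → BSign} {h : ℤ}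
    {f : Site → ℤ} (hf : ∀ v, 0 ≤ f v)
    {S : Set (Site → ℤ)} (hS : S ⊆ cfg V η h f) : Mw β lam V S ≠ ⊤ := by
  refine ne_top_of_le_ne_top (field_mass_ne_top hl h V) ?_
  have := mass_transport (wE β lam V)
    (fun ψ : Site → ℤ => ENNReal.ofReal (Real.exp (-lam * sosField V ψ)))
    (S := S) (S' := {ψ | (∀ x, x ∉ V → ψ x = h) ∧ (∀ v ∈ V, 0 ≤ ψ v)}) id
    Function.injective_id.injOn (fun ψ hψ => ⟨(hS hψ).1, fun v hv => (hf v).trans ((hS hψ).2.1 v hv)⟩)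
    1 ?_
  · rwa [one_mul] at this
  · intro ψ _
    rw [one_mul]
    unfold wE sosWt
    refine ENNReal.ofReal_le_ofReal (Real.exp_le_exp.2 ?_)
    have := mul_nonneg hβ (energy_nonneg V ψ)
    simp only [id]; linarith

lemma Mw_pos {β lam : ℝ} {V : Finset Site} {S : Set (Site → ℤ)} {ψ : Site → ℤ} (h : ψ ∈ S) :
    0 < Mw β lam V S := by
  unfold Mw mass
  refine lt_of_lt_of_le ?_ (ENNReal.le_tsum ψ)
  rw [Set.indicator_of_mem h]
  unfold wE
  exact ENNReal.ofReal_pos.2 (wt_pos β lam V ψ)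

lemma Zel_eq (β lam : ℝ) (η : Site → BSign) (h : ℤ) (V : Finset Site) :
    Zel β lam η h V = (Mw β lam V (signedConfigs V η h ∩ {ψ | allOuterElem β lam h V ψ})).toReal :=
  (Mw_toReal _ _ _ _).symm

lemma Zsos_eq (β lam : ℝ) (η : Site → BSign) (h : ℤ) (V : Finset Site) :
    Zsos β lam η h V = (Mw β lam V (signedConfigs V η h)).toReal :=
  (Mw_toReal _ _ _ _).symm

end

noncomputable section
open Filter
open scoped BigOperators ENNReal
attribute [local instance] Classical.propDecidable

/-! ### Floor removal -/

/-- The sublevel component at `v`. -/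
def subComp (ψ : Site → ℤ) (v : Site) : Set Site := fill (comp4 {u | ψ u ≤ ψ v} v)

lemma comp4_sub_of_exit {S : Set Site} {R : Set Site} {v : Site} (hv : v ∈ R)
    (h : ∀ x ∈ R, ∀ y, adjS x y → y ∉ R → x ∈ S → y ∉ S) : comp4 S v ⊆ R := by
  intro y hy
  change Relation.ReflTransGen _ v y at hy
  induction hy with
  | refl => exact hv
  | @tail b c _ h2 ih =>
    by_contra hc
    exact h b ih c h2.1 hc h2.2.1 h2.2.2

lemma subComp_sub {R : Finset Site} (hRc : connectedIn ((↑R : Set Site)ᶜ)) {L : ℤ} {ψ : Site → ℤ}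
    (hbd : ∀ x ∈ R, ∀ d ∈ dirs, x + d ∉ R → L ≤ ψ x ∨ L ≤ ψ (x + d))
    {v : Site} (hv : v ∈ R) (hL : ψ v < L) : subComp ψ v ⊆ ↑R := by
  apply fill_sub hRc
  apply comp4_sub_of_exit (by simpa using hv)
  intro x hx y hxy hy hxS hyS
  have := hbd x (by simpa using hx) (y - x) hxy (by simpa using hy)
  simp only [add_sub_cancel, Set.mem_setOf_eq] at this hxS hyS
  omega

lemma exists_subComp {R : Finset Site} {C : Set Site} (h : C ⊆ ↑R) : ∃ A : Finset Site, (↑A : Set Site) = C ∧ A ⊆ R := by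
  refine ⟨R.filter (· ∈ C), ?_, Finset.filter_subset _ _⟩
  ext x
  simp only [Finset.coe_filter, Set.mem_setOf_eq]
  exact ⟨fun h => h.2, fun hx => ⟨by simpa using h hx, hx⟩⟩

lemma subComp_bdry {ψ : Site → ℤ} {v : Site} {A : Finset Site} (hA : (↑A : Set Site) = subComp ψ v) :
    ∀ x ∈ A, ∀ d ∈ dirs, x + d ∉ A → ψ x ≤ ψ v ∧ ψ v + 1 ≤ ψ (x + d) := by
  intro x hx d hd hxd
  have h1 : x ∈ subComp ψ v := by rw [← hA]; simpa using hx
  have h2 : x + d ∉ subComp ψ v := by rw [← hA]; simpa using hxd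
  have h3 := fill_comp4_bdry (S := {u | ψ u ≤ ψ v}) (by simp) h1 h2 (adjS_add hd)
  have h4 := h3.2.1
  have h5 := h3.2.2
  simp only [Set.mem_setOf_eq, not_le] at h4 h5
  exact ⟨h4, by omega⟩

lemma subComp_conn {R : Finset Site} (hRc : connectedIn ((↑R : Set Site)ᶜ)) {ψ : Site → ℤ} {v : Site}
    {A : Finset Site} (hA : (↑A : Set Site) = subComp ψ v) (hAR : A ⊆ R) :
    v ∈ A ∧ stc ↑A ∧ connectedIn ((↑A : Set Site)ᶜ) := by
  have hs : comp4 {u | ψ u ≤ ψ v} v ⊆ ↑R := by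
    refine (subset_fill _).trans ?_
    change subComp ψ v ⊆ _
    rw [← hA]; exact_mod_cast hAR
  refine ⟨?_, ?_, ?_⟩
  · have : v ∈ (↑A : Set Site) := by rw [hA]; exact subset_fill _ (self_mem_comp4 _ _)
    simpa using this
  · rw [hA]; exact stc_fill stc_comp4
  · rw [hA]; exact fill_compl_conn hRc hs

/-- The spike factor. -/
def qq (β lam : ℝ) : ℝ := Real.exp (-(4 * β - lam))

lemma qq_pos (β lam : ℝ) : 0 < qq β lam := Real.exp_pos _

lemma qq_lt_one {β lam : ℝ} (hβ : 1000 ≤ β) (hl1 : lam ≤ 1) : qq β lam ≤ 1 :=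
  Real.exp_le_one_iff.2 (by linarith)

lemma ten_le_exp : (10 : ℝ) ≤ Real.exp 100 := by
  have := Real.add_one_le_exp (100 : ℝ); linarith

lemma fatF_le {β lam : ℝ} (hβ : 1000 ≤ β) (hl0 : 0 < lam) :
    Real.exp (-(β - 1 / 2 - 8) * 6) ≤ qq β lam / 10 := by
  have h1 : Real.exp (-(β - 1 / 2 - 8) * 6) * Real.exp 100 ≤ qq β lam := by
    unfold qq
    rw [← Real.exp_add]
    exact Real.exp_le_exp.2 (by linarith)
  have := ten_le_exp
  have := Real.exp_pos (-(β - 1 / 2 - 8) * 6)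
  rw [le_div_iff₀ (by norm_num)]
  nlinarith

lemma sum_ofReal_mul {ι : Type*} (s : Finset ι) (g : ι → ℝ) (hg : ∀ i ∈ s, 0 ≤ g i) (X : ℝ≥0∞) :
    ∑ i ∈ s, ENNReal.ofReal (g i) * X = ENNReal.ofReal (∑ i ∈ s, g i) * X := by
  rw [← Finset.sum_mul, ENNReal.ofReal_sum_of_nonneg hg]

lemma floor_site {β lam : ℝ} (hβ : 1000 ≤ β) (hl0 : 0 < lam) (hl1 : lam ≤ 1)
    {V R : Finset Site} (hRV : R ⊆ V) (hRc : connectedIn ((↑R : Set Site)ᶜ)) (L : ℤ)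
    {𝒦 : Set (Site → ℤ)} {v : Site} (hv : v ∈ R)
    (hbd : ∀ ψ ∈ 𝒦, ∀ x ∈ R, ∀ d ∈ dirs, x + d ∉ R → L ≤ ψ x ∨ L ≤ ψ (x + d))
    (hraise : ∀ ψ ∈ 𝒦, ψ v < L → ∀ A : Finset Site, (↑A : Set Site) = subComp ψ v → A ⊆ R →
      lam * A.card ≤ edgeBdryCard A / 2 ∧ shiftOn A 1 ψ ∈ 𝒦) (i : ℕ) :
    Mw β lam V (𝒦 ∩ {ψ | ψ v = L - i}) ≤
      ENNReal.ofReal ((10 / 9) * qq β lam ^ i) * Mw β lam V (𝒦 ∩ {ψ | ψ v = L}) := by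
  set fat : Set (Site → ℤ) := {ψ | ∃ d ∈ dirs, ψ (v + d) ≤ ψ v} with hfat
  set a : ℤ → ℝ≥0∞ := fun j => Mw β lam V (𝒦 ∩ {ψ | ψ v = j}) with ha
  set b : ℤ → ℝ≥0∞ := fun j => Mw β lam V ((𝒦 ∩ {ψ | ψ v = j}) ∩ fat) with hb
  have hq := qq_pos β lam
  -- existence of the component
  have hex : ∀ ψ ∈ 𝒦, ψ v < L → ∃ A : Finset Site, (↑A : Set Site) = subComp ψ v ∧ A ⊆ R :=
    fun ψ hψ hL => exists_subComp (subComp_sub hRc (hbd ψ hψ) hv hL)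
  have hbstep : ∀ j < L, b j ≤ ENNReal.ofReal (qq β lam / 10) * b (j + 1) := by
    intro j hj
    set 𝓕 : Finset (Finset Site) := R.powerset.filter fun A =>
      v ∈ A ∧ stc ↑A ∧ connectedIn ((↑A : Set Site)ᶜ) ∧ 6 ≤ edgeBdryCard A with h𝓕
    have h1 : b j ≤ ∑ A ∈ 𝓕, Mw β lam V
        (((𝒦 ∩ {ψ | ψ v = j}) ∩ fat) ∩ {ψ | (↑A : Set Site) = subComp ψ v}) := by
      apply mass_biUnion_le
      rintro ψ ⟨⟨hψ, hψv⟩, hf⟩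
      have hψv' : ψ v = j := hψv
      obtain ⟨A, hA, hAR⟩ := hex ψ hψ (by omega)
      obtain ⟨k1, k2, k3⟩ := subComp_conn hRc hA hAR
      refine ⟨A, ?_, ⟨⟨⟨hψ, hψv⟩, hf⟩, hA⟩⟩
      refine Finset.mem_filter.2 ⟨Finset.mem_powerset.2 hAR, k1, k2, k3, ?_⟩
      obtain ⟨d, hd, hdv⟩ := hf
      refine eb_ge_six hd k1 ?_
      have : v + d ∈ (↑A : Set Site) := by
        rw [hA]
        exact subset_fill _ (comp4_step (by simp) (self_mem_comp4 _ _) hdv (adjS_add hd))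
      simpa using this
    have h2 : ∀ A ∈ 𝓕, Mw β lam V
        (((𝒦 ∩ {ψ | ψ v = j}) ∩ fat) ∩ {ψ | (↑A : Set Site) = subComp ψ v}) ≤
        ENNReal.ofReal (Real.exp (-(β - 1/2) * edgeBdryCard A)) * b (j + 1) := by
      intro A hA
      rw [Finset.mem_filter, Finset.mem_powerset] at hA
      refine Mw_transport (shiftOn A 1) (shiftOn_inj A 1).injOn ?_ _ (Real.exp_pos _).le ?_
      · rintro ψ ⟨⟨⟨hψ, hψv⟩, d, hd, hdv⟩, hAc⟩
        have hψv' : ψ v = j := hψv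
        have hvA : v ∈ A := hA.2.1
        refine ⟨⟨(hraise ψ hψ (by omega) A hAc hA.1).2, ?_⟩, d, hd, ?_⟩
        · change shiftOn A 1 ψ v = j + 1
          rw [shiftOn_in hvA, hψv']
        · rw [shiftOn_in hvA]
          have : v + d ∈ A := by
            have : v + d ∈ (↑A : Set Site) := by
              rw [hAc]
              exact subset_fill _ (comp4_step (by simp) (self_mem_comp4 _ _) hdv (adjS_add hd))
            simpa using this
          rw [shiftOn_in this]; omega
      · rintro ψ ⟨⟨⟨hψ, hψv⟩, hf⟩, hAc⟩
        have hψv' : ψ v = j := hψv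
        have hb := subComp_bdry hAc
        rw [wt_raise β lam (hA.1.trans hRV) (ψ := ψ) (fun x hx d hd hxd => by
          have := hb x hx d hd hxd; omega)]
        refine mul_le_mul_of_nonneg_right (Real.exp_le_exp.2 ?_) (wt_pos _ _ _ _).le
        have := (hraise ψ hψ (by omega) A hAc hA.1).1
        linarith
    refine h1.trans ((Finset.sum_le_sum h2).trans ?_)
    rw [sum_ofReal_mul _ _ (fun _ _ => (Real.exp_pos _).le)]
    gcongr
    refine (count_sum 𝓕 v 6 (by norm_num) (β - 1/2) (by linarith) ?_).trans ?_
    · intro A hA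
      exact (Finset.mem_filter.1 hA).2
    · exact_mod_cast fatF_le hβ hl0
  have hastep : ∀ j < L, a j ≤ ENNReal.ofReal (qq β lam) * a (j + 1) + b j := by
    intro j hj
    refine (mass_cover _ (T := (𝒦 ∩ {ψ | ψ v = j}) ∩ fatᶜ) (U := (𝒦 ∩ {ψ | ψ v = j}) ∩ fat) ?_).trans ?_
    · intro ψ hψ
      by_cases h : ψ ∈ fat
      · exact Or.inr ⟨hψ, h⟩
      · exact Or.inl ⟨hψ, h⟩
    refine add_le_add_left ?_ _
    have hsub : ∀ ψ ∈ (𝒦 ∩ {ψ | ψ v = j}) ∩ fatᶜ, (↑({v} : Finset Site) : Set Site) = subComp ψ v := by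
      rintro ψ ⟨⟨hψ, hψv⟩, hnf⟩
      have hnf' : ∀ d ∈ dirs, ψ v < ψ (v + d) := by
        intro d hd
        by_contra hc
        exact hnf ⟨d, hd, not_lt.1 hc⟩
      have h3 : comp4 {u | ψ u ≤ ψ v} v = {v} := by
        apply Set.Subset.antisymm
        · apply comp4_sub_of_exit (by simp)
          intro x hx y hxy hy hxS hyS
          rw [Set.mem_singleton_iff] at hx
          subst hx
          have := hnf' (y - x) hxy
          simp only [add_sub_cancel, Set.mem_setOf_eq] at this hyS
          omega
        · intro x hx
          rw [Set.mem_singleton_iff] at hx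
          subst hx; exact self_mem_comp4 _ _
      unfold subComp
      rw [h3, fill_singleton]; simp
    refine Mw_transport (shiftOn {v} 1) (shiftOn_inj _ 1).injOn ?_ _ hq.le ?_
    · intro ψ hψ
      have h4 := hsub ψ hψ
      have hψv' : ψ v = j := hψ.1.2
      refine ⟨(hraise ψ hψ.1.1 (by omega) _ h4 (by simpa using hv)).2, ?_⟩
      change shiftOn {v} 1 ψ v = j + 1
      rw [shiftOn_in (by simp), hψv']
    · intro ψ hψ
      have h4 := hsub ψ hψ
      have hb := subComp_bdry h4
      have hsV : ({v} : Finset Site) ⊆ V := by simpa using hRV hv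
      rw [wt_raise β lam hsV (ψ := ψ) (fun x hx d hd hxd => by
          have := hb x hx d hd hxd; omega)]
      refine mul_le_mul_of_nonneg_right (le_of_eq ?_) (wt_pos _ _ _ _).le
      unfold qq
      rw [eb_singleton]; congr 1; simp; ring
  have main : ∀ i : ℕ, b (L - i) ≤ ENNReal.ofReal ((qq β lam / 10) ^ i) * a L ∧
      a (L - i) ≤ ENNReal.ofReal ((10/9 - (1/9) * (1/10) ^ i) * qq β lam ^ i) * a L := by
    intro i
    induction i with
    | zero =>
      constructor
      · simp only [Nat.cast_zero, sub_zero, pow_zero, ENNReal.ofReal_one, one_mul]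
        exact mass_mono _ Set.inter_subset_left
      · norm_num
    | succ i ih =>
      have hj : L - ((i + 1 : ℕ) : ℤ) + 1 = L - i := by push_cast; ring
      have h1 := hbstep (L - ((i + 1 : ℕ) : ℤ)) (by push_cast; omega)
      have h2 := hastep (L - ((i + 1 : ℕ) : ℤ)) (by push_cast; omega)
      rw [hj] at h1 h2
      have h3 : b (L - ((i + 1 : ℕ) : ℤ)) ≤ ENNReal.ofReal ((qq β lam / 10) ^ (i + 1)) * a L := by
        refine h1.trans ((mul_le_mul_right ih.1 _).trans ?_)
        rw [← mul_assoc, ← ENNReal.ofReal_mul (by positivity), pow_succ']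
      refine ⟨h3, ?_⟩
      refine h2.trans ((add_le_add (mul_le_mul_right ih.2 _) h3).trans ?_)
      have hp : (1/10 : ℝ) ^ i ≤ 1 := pow_le_one₀ (by norm_num) (by norm_num)
      rw [← mul_assoc, ← ENNReal.ofReal_mul (by positivity), ← add_mul, ← ENNReal.ofReal_add]
      · gcongr
        rw [div_eq_mul_one_div (qq β lam) 10, mul_pow, pow_succ, pow_succ]
        nlinarith [pow_pos hq i]
      · have := pow_pos hq i
        have : 0 ≤ (10/9 - (1/9) * (1/10 : ℝ) ^ i) := by linarith
        positivity
      · positivity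
  refine (main i).2.trans ?_
  gcongr
  have : (0:ℝ) ≤ (1/9) * (1/10) ^ i := by positivity
  linarith

end

noncomputable section
open Filter
open scoped BigOperators ENNReal
attribute [local instance] Classical.propDecidable

/-- Removing the lowest level of the floor over a region. -/
lemma floorP {β lam : ℝ} (hβ : 1000 ≤ β) (hl0 : 0 < lam) (hl1 : lam ≤ 1)
    {V R : Finset Site} (hRV : R ⊆ V) (hRc : connectedIn ((↑R : Set Site)ᶜ)) (L : ℤ)
    {𝒦 : Set (Site → ℤ)}
    (hbd : ∀ ψ ∈ 𝒦, ∀ x ∈ R, ∀ d ∈ dirs, x + d ∉ R → L ≤ ψ x ∨ L ≤ ψ (x + d))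
    (hraise : ∀ ψ ∈ 𝒦, ∀ v ∈ R, ψ v < L → ∀ A : Finset Site, (↑A : Set Site) = subComp ψ v → A ⊆ R →
      lam * A.card ≤ edgeBdryCard A / 2 ∧ shiftOn A 1 ψ ∈ 𝒦)
    (f : Site → ℤ) (n : ℕ) (hn : 1 ≤ n) (hf : ∀ v ∈ R, f v + n ≤ L)
    (hfl : ∀ ψ ∈ 𝒦, ∀ v ∈ R, f v ≤ ψ v) :
    Mw β lam V 𝒦 ≤ ENNReal.ofReal (Real.exp ((10 / 9) * qq β lam ^ n * R.card)) *
      Mw β lam V (𝒦 ∩ {ψ | ∀ v ∈ R, f v + 1 ≤ ψ v}) := by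
  have hq := qq_pos β lam
  have hq1 := qq_lt_one hβ hl1
  suffices H : ∀ T : Finset Site, T ⊆ R →
      Mw β lam V 𝒦 ≤ ENNReal.ofReal (Real.exp ((10 / 9) * qq β lam ^ n * T.card)) *
        Mw β lam V (𝒦 ∩ {ψ | ∀ v ∈ T, f v + 1 ≤ ψ v}) from H R subset_rfl
  intro T
  induction T using Finset.induction_on with
  | empty => intro _; simp
  | insert v T hvT ih =>
    intro hT
    have hvR : v ∈ R := hT (by simp)
    have hTR : T ⊆ R := fun x hx => hT (by simp [hx])
    refine (ih hTR).trans ?_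
    set 𝒦T := 𝒦 ∩ {ψ : Site → ℤ | ∀ v ∈ T, f v + 1 ≤ ψ v} with h𝒦T
    set 𝒦T' := 𝒦 ∩ {ψ : Site → ℤ | ∀ u ∈ insert v T, f u + 1 ≤ ψ u} with h𝒦T'
    have hstep : Mw β lam V 𝒦T ≤ ENNReal.ofReal (1 + (10/9) * qq β lam ^ n) * Mw β lam V 𝒦T' := by
      have hfs := floor_site hβ hl0 hl1 hRV hRc L (𝒦 := 𝒦T) hvR (fun ψ hψ => hbd ψ hψ.1)
        (fun ψ hψ hlt A hA hAR => by
          obtain ⟨h1, h2⟩ := hraise ψ hψ.1 v hvR hlt A hA hAR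
          refine ⟨h1, h2, ?_⟩
          intro u hu
          have := hψ.2 u hu
          by_cases huA : u ∈ A
          · rw [shiftOn_in huA]; omega
          · rw [shiftOn_out huA]; exact this) (L - f v).toNat
      have hLf := hf v hvR
      have hcast : (((L - f v).toNat : ℕ) : ℤ) = L - f v := Int.toNat_of_nonneg (by omega)
      rw [hcast] at hfs
      have hni : n ≤ (L - f v).toNat := by omega
      have h1 : Mw β lam V (𝒦T ∩ {ψ | ψ v = L}) ≤ Mw β lam V 𝒦T' := by
        apply mass_mono
        rintro ψ ⟨⟨hψ, hψT⟩, hψv⟩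
        refine ⟨hψ, ?_⟩
        intro u hu
        rcases Finset.mem_insert.1 hu with rfl | hu
        · have : ψ u = L := hψv
          omega
        · exact hψT u hu
      have h2 : Mw β lam V 𝒦T ≤ Mw β lam V 𝒦T' +
          Mw β lam V (𝒦T ∩ {ψ | ψ v = L - (L - f v)}) := by
        apply mass_cover
        rintro ψ ⟨hψ, hψT⟩
        have := hfl ψ hψ v hvR
        by_cases h : ψ v = f v
        · right
          refine ⟨⟨hψ, hψT⟩, ?_⟩
          change ψ v = L - (L - f v); omega
        · left
          refine ⟨hψ, ?_⟩
          intro u hu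
          rcases Finset.mem_insert.1 hu with rfl | hu
          · omega
          · exact hψT u hu
      refine h2.trans ?_
      rw [ENNReal.ofReal_add (by norm_num) (by positivity), add_mul, ENNReal.ofReal_one, one_mul]
      gcongr
      refine hfs.trans (mul_le_mul' ?_ h1)
      refine ENNReal.ofReal_le_ofReal ?_
      have := pow_le_pow_of_le_one hq.le hq1 hni
      linarith
    refine (mul_le_mul_right hstep _).trans ?_
    rw [← mul_assoc, ← ENNReal.ofReal_mul (Real.exp_pos _).le]
    gcongr
    rw [Finset.card_insert_of_notMem hvT]
    have h3 : 1 + (10/9) * qq β lam ^ n ≤ Real.exp ((10/9) * qq β lam ^ n) := by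
      have := Real.add_one_le_exp ((10/9) * qq β lam ^ n); linarith
    calc _ ≤ Real.exp ((10 / 9) * qq β lam ^ n * T.card) * Real.exp ((10/9) * qq β lam ^ n) := by gcongr
      _ = _ := by rw [← Real.exp_add]; congr 1; push_cast; ring

end

noncomputable section
open Filter
open scoped BigOperators ENNReal
attribute [local instance] Classical.propDecidable

/-! ### The cluster estimate -/

lemma comp_data {A0 : Finset Site} (hc : connectedIn ((↑A0 : Set Site)ᶜ)) {P : Set Site} {b : Site}
    (hb : b ∈ P) (hP : P ⊆ ↑A0) :
    ∃ A : Finset Site, A ⊆ A0 ∧ b ∈ A ∧ stc ↑A ∧ connectedIn ((↑A : Set Site)ᶜ) ∧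
      ∀ x ∈ A, ∀ d ∈ dirs, x + d ∉ A → x ∈ P ∧ x + d ∉ P := by
  have hs : comp4 P b ⊆ ↑A0 := (comp4_sub hb).trans hP
  obtain ⟨A, hA, hAA⟩ := exists_subComp (fill_sub hc hs)
  refine ⟨A, hAA, ?_, ?_, ?_, ?_⟩
  · have : b ∈ (↑A : Set Site) := by rw [hA]; exact subset_fill _ (self_mem_comp4 _ _)
    simpa using this
  · rw [hA]; exact stc_fill stc_comp4
  · rw [hA]; exact fill_compl_conn hc hs
  · intro x hx d hd hxd
    have h1 : x ∈ fill (comp4 P b) := by rw [← hA]; simpa using hx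
    have h2 : x + d ∉ fill (comp4 P b) := by rw [← hA]; simpa using hxd
    exact (fill_comp4_bdry hb h1 h2 (adjS_add hd)).2

/-- Number of boundary edges of `A0` at sites of `S`. -/
def ebS (A0 S : Finset Site) : ℕ := ∑ v ∈ S, (dirs.filter fun d => v + d ∉ A0).card

lemma peel {β : ℝ} (hβ : 1000 ≤ β) {A0 : Finset Site} (K : Finset Site → ℝ≥0∞)
    (hstep : ∀ S, S ⊆ innerBdry A0 → ∀ b ∈ S, ∃ 𝓕 : Finset (Finset Site),
      (∀ A ∈ 𝓕, A ⊆ A0 ∧ b ∈ A ∧ stc ↑A ∧ connectedIn ((↑A : Set Site)ᶜ)) ∧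
      K S ≤ ∑ A ∈ 𝓕, ENNReal.ofReal (Real.exp (-(β - 1) * edgeBdryCard A)) * K (S \ A)) :
    ∀ N : ℕ, ∀ S, S ⊆ innerBdry A0 → S.card ≤ N →
      K S ≤ ENNReal.ofReal (Real.exp (-(β / 2) * ebS A0 S)) * K ∅ := by
  intro N
  induction N with
  | zero =>
    intro S hS hN
    have : S = ∅ := by simpa using hN
    subst this
    simp [ebS]
  | succ N ih =>
    intro S hS hN
    rcases S.eq_empty_or_nonempty with rfl | ⟨b, hb⟩
    · simp [ebS]
    obtain ⟨𝓕, h𝓕, hK⟩ := hstep S hS b hb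
    refine hK.trans ?_
    have h1 : ∀ A ∈ 𝓕, ENNReal.ofReal (Real.exp (-(β - 1) * edgeBdryCard A)) * K (S \ A) ≤
        ENNReal.ofReal (Real.exp (-(β / 2 - 1) * edgeBdryCard A)) *
          (ENNReal.ofReal (Real.exp (-(β / 2) * ebS A0 S)) * K ∅) := by
      intro A hA
      obtain ⟨hA0, hbA, -, -⟩ := h𝓕 A hA
      have hlt : (S \ A).card < S.card := by
        apply Finset.card_lt_card
        refine ⟨Finset.sdiff_subset, fun h => ?_⟩
        have := h hb
        simp [hbA] at this
      have h2 := ih (S \ A) (Finset.sdiff_subset.trans hS) (by omega)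
      refine (mul_le_mul_right h2 _).trans ?_
      rw [← mul_assoc, ← mul_assoc, ← ENNReal.ofReal_mul (Real.exp_pos _).le,
        ← ENNReal.ofReal_mul (Real.exp_pos _).le, ← Real.exp_add, ← Real.exp_add]
      refine mul_le_mul_left (ENNReal.ofReal_le_ofReal (Real.exp_le_exp.2 ?_)) _
      have h3 : ebS A0 S ≤ ebS A0 (S \ A) + edgeBdryCard A := by
        have : ebS A0 S = ebS A0 (S \ A) + ebS A0 (S ∩ A) := by
          unfold ebS
          rw [add_comm, ← Finset.sum_union]
          · congr 1; ext x; simp; tauto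
          · rw [Finset.disjoint_left]; intro x; simp; tauto
        rw [this]
        refine add_le_add_right ?_ _
        unfold ebS edgeBdryCard
        refine (Finset.sum_le_sum_of_subset Finset.inter_subset_right).trans ?_
        refine Finset.sum_le_sum fun v _ => Finset.card_le_card ?_
        intro d
        simp only [Finset.mem_filter]
        exact fun h => ⟨h.1, fun h' => h.2 (hA0 h')⟩
      have h3' : (ebS A0 S : ℝ) ≤ ebS A0 (S \ A) + edgeBdryCard A := by exact_mod_cast h3
      nlinarith
    refine (Finset.sum_le_sum h1).trans ?_
    rw [sum_ofReal_mul _ _ (fun _ _ => (Real.exp_pos _).le)]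
    refine (mul_le_mul_left (b := ENNReal.ofReal _) (c := 1) ?_ _).trans (by rw [one_mul])
    rw [← ENNReal.ofReal_one]
    refine ENNReal.ofReal_le_ofReal ?_
    refine (count_sum 𝓕 b 1 le_rfl (β / 2 - 1) (by linarith) ?_).trans ?_
    · intro A hA
      obtain ⟨_, hbA, h4, h5⟩ := h𝓕 A hA
      refine ⟨hbA, h4, h5, ?_⟩
      have := eb_ge_four ⟨b, hbA⟩; omega
    · rw [Real.exp_le_one_iff]; push_cast; linarith

lemma innerBdry_exit {A0 : Finset Site} {v : Site} (h : v ∈ innerBdry A0) : ∃ d ∈ dirs, v + d ∉ A0 :=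
  (Finset.mem_filter.1 h).2

lemma cluster_down {β lam : ℝ} (hβ : 1000 ≤ β) (hl0 : 0 < lam)
    {A0 : Finset Site} (hc : connectedIn ((↑A0 : Set Site)ᶜ)) {D0 : ℝ} (hs : small D0 ↑A0)
    (hD : lam * D0 ≤ 1) (η : Site → BSign) (H : ℤ) (f : Site → ℤ)
    {S : Finset Site} (hS : S ⊆ innerBdry A0) :
    Mw β lam A0 (cfg A0 η H f ∩ {ψ | ∀ b ∈ S, ψ b < H}) ≤
      ENNReal.ofReal (Real.exp (-(β / 2) * ebS A0 S)) * Mw β lam A0 (cfg A0 η H f) := by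
  have := peel hβ (A0 := A0) (fun S => Mw β lam A0 (cfg A0 η H f ∩ {ψ | ∀ b ∈ S, ψ b < H})) ?_
    S.card S hS le_rfl
  · simpa using this
  intro S hS b hb
  refine ⟨A0.powerset.filter fun A => b ∈ A ∧ stc ↑A ∧ connectedIn ((↑A : Set Site)ᶜ), ?_, ?_⟩
  · intro A hA
    rw [Finset.mem_filter, Finset.mem_powerset] at hA; exact hA
  refine (mass_biUnion_le _ _ (fun A => {ψ | ψ ∈ cfg A0 η H f ∧ (∀ b ∈ S, ψ b < H) ∧
      ∀ x ∈ A, ∀ d ∈ dirs, x + d ∉ A → ψ x < H ∧ H ≤ ψ (x + d)}) ?_).trans (Finset.sum_le_sum ?_)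
  · rintro ψ ⟨hψ, hψS⟩
    obtain ⟨A, h1, h2, h3, h4, h5⟩ := comp_data hc (P := {u | ψ u < H}) (b := b) (hψS b hb) (by
      intro x hx
      by_contra hxA
      have := hψ.1 x (by simpa using hxA)
      change ψ x < H at hx
      omega)
    refine ⟨A, Finset.mem_filter.2 ⟨Finset.mem_powerset.2 h1, h2, h3, h4⟩, hψ, hψS, ?_⟩
    intro x hx d hd hxd
    have := h5 x hx d hd hxd
    simpa using this
  · intro A hA
    rw [Finset.mem_filter, Finset.mem_powerset] at hA
    obtain ⟨hA0, hbA, h3, h4⟩ := hA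
    refine Mw_transport (shiftOn A 1) (shiftOn_inj A 1).injOn ?_ _ (Real.exp_pos _).le ?_
    · rintro ψ ⟨hψ, hψS, hψA⟩
      refine ⟨⟨?_, ?_, ?_⟩, ?_⟩
      · intro x hx
        rw [shiftOn_out (fun h => hx (hA0 h))]; exact hψ.1 x hx
      · intro v hv
        have := hψ.2.1 v hv
        by_cases hvA : v ∈ A
        · rw [shiftOn_in hvA]; omega
        · rw [shiftOn_out hvA]; exact this
      · intro v hv
        have := hψ.2.2 v hv
        by_cases hvA : v ∈ A
        · rw [shiftOn_in hvA]
          obtain ⟨d, hd, hvd⟩ := innerBdry_exit hv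
          have h6 := (hψA v hvA d hd (fun h => hvd (hA0 h))).1
          cases hη : η v <;> rw [hη] at this <;> simp only [BSign.ok] at this ⊢ <;> omega
        · rw [shiftOn_out hvA]; exact this
      · intro v hv
        rw [Finset.mem_sdiff] at hv
        rw [shiftOn_out hv.2]; exact hψS v hv.1
    · rintro ψ ⟨hψ, hψS, hψA⟩
      rw [wt_raise β lam hA0 (ψ := ψ) (fun x hx d hd hxd => by
          have := hψA x hx d hd hxd; omega)]
      refine mul_le_mul_of_nonneg_right (Real.exp_le_exp.2 ?_) (wt_pos _ _ _ _).le
      have := small_card (small_mono le_rfl (by exact_mod_cast hA0) hs : small D0 ↑A)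
      have he : (0:ℝ) ≤ edgeBdryCard A := by positivity
      nlinarith

lemma cluster_up {β lam : ℝ} (hβ : 1000 ≤ β) (hl0 : 0 < lam) (hl1 : lam ≤ 1)
    {A0 : Finset Site} (hc : connectedIn ((↑A0 : Set Site)ᶜ)) {D0 : ℝ} (hs : small D0 ↑A0)
    (hD : lam * D0 ≤ 1) (η : Site → BSign) (H : ℤ) (f : Site → ℤ)
    (n : ℕ) (hn : 1 ≤ n) (hf : ∀ v ∈ A0, f v + n ≤ H + 1) (hDn : D0 * qq β lam ^ n ≤ 1)
    {S : Finset Site} (hS : S ⊆ innerBdry A0) :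
    Mw β lam A0 (cfg A0 η H f ∩ {ψ | ∀ b ∈ S, H < ψ b}) ≤
      ENNReal.ofReal (Real.exp (-(β / 2) * ebS A0 S)) * Mw β lam A0 (cfg A0 η H f) := by
  have := peel hβ (A0 := A0) (fun S => Mw β lam A0 (cfg A0 η H f ∩ {ψ | ∀ b ∈ S, H < ψ b})) ?_
    S.card S hS le_rfl
  · simpa using this
  intro S hS b hb
  refine ⟨A0.powerset.filter fun A => b ∈ A ∧ stc ↑A ∧ connectedIn ((↑A : Set Site)ᶜ), ?_, ?_⟩
  · intro A hA
    rw [Finset.mem_filter, Finset.mem_powerset] at hA; exact hA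
  refine (mass_biUnion_le _ _ (fun A => {ψ | ψ ∈ cfg A0 η H f ∧ (∀ b ∈ S \ A, H < ψ b) ∧
      ∀ x ∈ A, ∀ d ∈ dirs, x + d ∉ A → H < ψ x ∧ ψ (x + d) ≤ H}) ?_).trans (Finset.sum_le_sum ?_)
  · rintro ψ ⟨hψ, hψS⟩
    obtain ⟨A, h1, h2, h3, h4, h5⟩ := comp_data hc (P := {u | H < ψ u}) (b := b) (hψS b hb) (by
      intro x hx
      by_contra hxA
      have := hψ.1 x (by simpa using hxA)
      change H < ψ x at hx
      omega)
    refine ⟨A, Finset.mem_filter.2 ⟨Finset.mem_powerset.2 h1, h2, h3, h4⟩, hψ,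
      fun b hb => hψS b (Finset.mem_sdiff.1 hb).1, ?_⟩
    intro x hx d hd hxd
    have := h5 x hx d hd hxd
    simpa using this
  · intro A hA
    rw [Finset.mem_filter, Finset.mem_powerset] at hA
    obtain ⟨hA0, hbA, h3, h4⟩ := hA
    have hsc : ∀ A' ⊆ A0, (A'.card : ℝ) ≤ D0 * edgeBdryCard A' / 2 := fun A' h =>
      small_card (small_mono le_rfl (by exact_mod_cast h) hs : small D0 ↑A')
    refine (floorP hβ hl0 hl1 hA0 h4 (H + 1) ?_ ?_ f n hn (fun v hv => hf v (hA0 hv)) ?_).trans ?_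
    · rintro ψ ⟨hψ, hψS, hψA⟩ x hx d hd hxd
      left; have := hψA x hx d hd hxd; omega
    · rintro ψ ⟨hψ, hψS, hψA⟩ v hv hvL A' hA' hA'A
      have hA'0 := hA'A.trans hA0
      have hb' := subComp_bdry hA'
      refine ⟨?_, ⟨?_, ?_, ?_⟩, ?_, ?_⟩
      · have := hsc A' hA'0
        have he : (0:ℝ) ≤ edgeBdryCard A' := by positivity
        nlinarith
      · intro x hx
        rw [shiftOn_out (fun h => hx (hA'0 h))]; exact hψ.1 x hx
      · intro v hv
        have := hψ.2.1 v hv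
        by_cases hvA : v ∈ A'
        · rw [shiftOn_in hvA]; omega
        · rw [shiftOn_out hvA]; exact this
      · intro u hu
        have := hψ.2.2 u hu
        by_cases huA : u ∈ A'
        · exfalso
          obtain ⟨d, hd, hud⟩ := innerBdry_exit hu
          have h6 := (hψA u (hA'A huA) d hd (fun h => hud (hA0 h))).1
          have h7 := (hb' u huA d hd (fun h => hud (hA'0 h))).1
          omega
        · rw [shiftOn_out huA]; exact this
      · intro u hu
        have hu' := Finset.mem_sdiff.1 hu
        rw [shiftOn_out (fun h => hu'.2 (hA'A h))]; exact hψS u hu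
      · intro x hx d hd hxd
        have := hψA x hx d hd hxd
        rw [shiftOn_out (A := A') (x := x + d) (fun h => hxd (hA'A h))]
        refine ⟨?_, this.2⟩
        by_cases hxA : x ∈ A'
        · rw [shiftOn_in hxA]; omega
        · rw [shiftOn_out hxA]; exact this.1
    · rintro ψ ⟨hψ, -, -⟩ v hv
      exact hψ.2.1 v (hA0 hv)
    have hlow : Mw β lam A0 ({ψ | ψ ∈ cfg A0 η H f ∧ (∀ b ∈ S \ A, H < ψ b) ∧
        ∀ x ∈ A, ∀ d ∈ dirs, x + d ∉ A → H < ψ x ∧ ψ (x + d) ≤ H} ∩ {ψ | ∀ v ∈ A, f v + 1 ≤ ψ v}) ≤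
        ENNReal.ofReal (Real.exp (-β * edgeBdryCard A)) *
          Mw β lam A0 (cfg A0 η H f ∩ {ψ | ∀ b ∈ S \ A, H < ψ b}) := by
      refine Mw_transport (shiftOn A (-1)) (shiftOn_inj A (-1)).injOn ?_ _ (Real.exp_pos _).le ?_
      · rintro ψ ⟨⟨hψ, hψS, hψA⟩, hψf⟩
        refine ⟨⟨?_, ?_, ?_⟩, ?_⟩
        · intro x hx
          rw [shiftOn_out (fun h => hx (hA0 h))]; exact hψ.1 x hx
        · intro v hv
          have := hψ.2.1 v hv
          by_cases hvA : v ∈ A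
          · have := hψf v hvA
            rw [shiftOn_in hvA]; omega
          · rw [shiftOn_out hvA]; exact this
        · intro v hv
          have := hψ.2.2 v hv
          by_cases hvA : v ∈ A
          · rw [shiftOn_in hvA]
            obtain ⟨d, hd, hvd⟩ := innerBdry_exit hv
            have h6 := (hψA v hvA d hd (fun h => hvd (hA0 h))).1
            cases hη : η v <;> rw [hη] at this <;> simp only [BSign.ok] at this ⊢ <;> omega
          · rw [shiftOn_out hvA]; exact this
        · intro v hv
          rw [shiftOn_out (Finset.mem_sdiff.1 hv).2]; exact hψS v hv
      · rintro ψ ⟨⟨hψ, hψS, hψA⟩, hψf⟩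
        rw [wt_lower β lam hA0 (ψ := ψ) (fun x hx d hd hxd => by
            have := hψA x hx d hd hxd; omega)]
        refine mul_le_mul_of_nonneg_right (Real.exp_le_exp.2 ?_) (wt_pos _ _ _ _).le
        have : (0:ℝ) ≤ lam * A.card := by positivity
        linarith
    refine (mul_le_mul_right hlow _).trans ?_
    rw [← mul_assoc, ← ENNReal.ofReal_mul (Real.exp_pos _).le, ← Real.exp_add]
    refine mul_le_mul_left (ENNReal.ofReal_le_ofReal (Real.exp_le_exp.2 ?_)) _
    have h6 := hsc A hA0
    have he : (0:ℝ) ≤ edgeBdryCard A := by positivity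
    have hqn := pow_pos (qq_pos β lam) n
    have h7 : qq β lam ^ n * A.card ≤ edgeBdryCard A / 2 := by
      calc _ ≤ qq β lam ^ n * (D0 * edgeBdryCard A / 2) := by gcongr
        _ = (D0 * qq β lam ^ n) * (edgeBdryCard A / 2) := by ring
        _ ≤ 1 * (edgeBdryCard A / 2) := by gcongr
        _ = _ := one_mul _
    nlinarith

/-- A cluster with all boundary sites off level is unlikely. -/
lemma cluster {β lam : ℝ} (hβ : 1000 ≤ β) (hl0 : 0 < lam) (hl1 : lam ≤ 1)
    {A0 : Finset Site} (hc : connectedIn ((↑A0 : Set Site)ᶜ)) {D0 : ℝ} (hs : small D0 ↑A0)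
    (hD : lam * D0 ≤ 1) (η : Site → BSign) (H : ℤ) (f : Site → ℤ)
    (n : ℕ) (hn : 1 ≤ n) (hf : ∀ v ∈ A0, f v + n ≤ H + 1) (hDn : D0 * qq β lam ^ n ≤ 1) :
    Mw β lam A0 (cfg A0 η H f ∩ {ψ | ∀ b ∈ innerBdry A0, ψ b ≠ H}) ≤
      ENNReal.ofReal (Real.exp (-(β / 4 - 1) * edgeBdryCard A0)) * Mw β lam A0 (cfg A0 η H f) := by
  set B := innerBdry A0 with hB
  have heB : ebS A0 B = edgeBdryCard A0 := by
    unfold ebS edgeBdryCard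
    refine Finset.sum_subset (Finset.filter_subset _ _) ?_
    intro v hv hvB
    rw [Finset.card_eq_zero, Finset.filter_eq_empty_iff]
    intro d hd hvd
    exact hvB (Finset.mem_filter.2 ⟨hv, d, hd, hvd⟩)
  have hBc : B.card ≤ edgeBdryCard A0 := by
    rw [← heB, Finset.card_eq_sum_ones]
    refine Finset.sum_le_sum fun v hv => ?_
    obtain ⟨d, hd, hvd⟩ := innerBdry_exit hv
    exact Finset.card_pos.2 ⟨d, Finset.mem_filter.2 ⟨hd, hvd⟩⟩
  refine (mass_biUnion_le _ B.powerset (fun S => cfg A0 η H f ∩ {ψ | (∀ b ∈ S, H < ψ b) ∧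
    ∀ b ∈ B \ S, ψ b < H}) ?_).trans ?_
  · rintro ψ ⟨hψ, hψB⟩
    refine ⟨B.filter (fun b => H < ψ b), Finset.mem_powerset.2 (Finset.filter_subset _ _), hψ, ?_, ?_⟩
    · intro b hb; exact (Finset.mem_filter.1 hb).2
    · intro b hb
      have h1 := Finset.mem_sdiff.1 hb
      have h2 := hψB b h1.1
      have h3 : ¬ H < ψ b := fun h => h1.2 (Finset.mem_filter.2 ⟨h1.1, h⟩)
      omega
  have h1 : ∀ S ∈ B.powerset, Mw β lam A0 (cfg A0 η H f ∩ {ψ | (∀ b ∈ S, H < ψ b) ∧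
      ∀ b ∈ B \ S, ψ b < H}) ≤ ENNReal.ofReal (Real.exp (-(β / 4) * edgeBdryCard A0)) *
        Mw β lam A0 (cfg A0 η H f) := by
    intro S hS
    rw [Finset.mem_powerset] at hS
    have hsum : ebS A0 S + ebS A0 (B \ S) = edgeBdryCard A0 := by
      rw [← heB]; unfold ebS
      rw [add_comm]; exact Finset.sum_sdiff hS
    have hsum' : (ebS A0 S : ℝ) + ebS A0 (B \ S) = edgeBdryCard A0 := by exact_mod_cast hsum
    by_cases hle : (ebS A0 S : ℝ) ≤ ebS A0 (B \ S)
    · refine (mass_mono _ ?_).trans ((cluster_down hβ hl0 hc hs hD η H f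
        (S := B \ S) Finset.sdiff_subset).trans ?_)
      · rintro ψ ⟨h1, h2⟩; exact ⟨h1, h2.2⟩
      · refine mul_le_mul_left (ENNReal.ofReal_le_ofReal (Real.exp_le_exp.2 ?_)) _
        nlinarith
    · refine (mass_mono _ ?_).trans ((cluster_up hβ hl0 hl1 hc hs hD η H f n hn hf hDn
        (S := S) hS).trans ?_)
      · rintro ψ ⟨h1, h2⟩; exact ⟨h1, h2.1⟩
      · refine mul_le_mul_left (ENNReal.ofReal_le_ofReal (Real.exp_le_exp.2 ?_)) _
        nlinarith
  refine (Finset.sum_le_sum h1).trans ?_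
  rw [sum_ofReal_mul _ _ (fun _ _ => (Real.exp_pos _).le)]
  refine mul_le_mul_left (ENNReal.ofReal_le_ofReal ?_) _
  rw [Finset.sum_const, Finset.card_powerset, nsmul_eq_mul]
  have h2 : ((2 ^ B.card : ℕ) : ℝ) ≤ Real.exp (edgeBdryCard A0) := by
    have h3 : (2 : ℝ) ≤ Real.exp 1 := by have := Real.add_one_le_exp (1 : ℝ); linarith
    push_cast
    calc (2:ℝ) ^ B.card ≤ 2 ^ edgeBdryCard A0 := pow_le_pow_right₀ (by norm_num) hBc
      _ ≤ (Real.exp 1) ^ edgeBdryCard A0 := by gcongr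
      _ = _ := by rw [← Real.exp_nat_mul, mul_one]
  calc _ ≤ Real.exp (edgeBdryCard A0) * Real.exp (-(β / 4) * edgeBdryCard A0) := by gcongr
    _ = _ := by rw [← Real.exp_add]; congr 1; ring

end

noncomputable section
open Filter
open scoped BigOperators ENNReal
attribute [local instance] Classical.propDecidable

/-! ### Classes of configurations with restricted outer clusters -/

/-- Sites of `V` off level `H`. -/
def dev (V : Finset Site) (H : ℤ) (ψ : Site → ℤ) : Set Site := {u : Site | u ∈ V ∧ ψ u ≠ H}

/-- Filled outer cluster of a site. -/
def fcl (V : Finset Site) (H : ℤ) (ψ : Site → ℤ) (u : Site) : Set Site := fill (compStar (dev V H ψ) u)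

/-- Every outer cluster satisfies `P`. -/
def goodP (V : Finset Site) (H : ℤ) (P : Set Site → Prop) : Set (Site → ℤ) :=
  {ψ | ∀ u ∈ V, ψ u ≠ H → P (fcl V H ψ u)}

/-- A hereditary property. -/
def her (P : Set Site → Prop) : Prop := ∀ F F', F' ⊆ F → P F → P F'

lemma her_small (D : ℝ) : her (small D) := fun _ _ h h' => small_mono le_rfl h h'

lemma fcl_sub {V : Finset Site} (hV : connectedIn ((↑V : Set Site)ᶜ)) {H : ℤ} {ψ : Site → ℤ} {u : Site}
    (hu : u ∈ dev V H ψ) : fcl V H ψ u ⊆ ↑V :=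
  fill_sub hV ((compStar_sub hu).trans fun _ hx => hx.1)

lemma self_mem_fcl (V : Finset Site) (H : ℤ) (ψ : Site → ℤ) (u : Site) : u ∈ fcl V H ψ u :=
  subset_fill _ (self_mem_compStar _ _)

lemma her_stay {V : Finset Site} {H : ℤ} {ψ' : Site → ℤ}
    {F : Set Site} {x : Site} (hx : x ∈ F)
    (h : ∀ y ∈ F, ∀ z, z ∉ F → starAdj y z → z ∈ dev V H ψ' → False) :
    compStar (dev V H ψ') x ⊆ F := by
  intro y hy
  change Relation.ReflTransGen _ x y at hy
  induction hy with
  | refl => exact hx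
  | @tail b c _ h2 ih =>
    by_contra hc
    exact h b ih c hc h2.1 h2.2.2

/-- Closure: if the new deviations lie in old filled clusters, then so do the new filled clusters. -/
lemma closure_good {V : Finset Site} (hV : connectedIn ((↑V : Set Site)ᶜ)) {H : ℤ}
    {P : Set Site → Prop} (hP : her P) {ψ ψ' : Site → ℤ} (hψ : ψ ∈ goodP V H P)
    (h : ∀ x ∈ dev V H ψ', ∃ u ∈ dev V H ψ, x ∈ fcl V H ψ u) : ψ' ∈ goodP V H P := by
  intro x hxV hxH
  have hx : x ∈ dev V H ψ' := ⟨hxV, hxH⟩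
  -- choose a maximal old filled cluster containing x
  have hne : (V.filter fun u => u ∈ dev V H ψ ∧ x ∈ fcl V H ψ u).Nonempty := by
    obtain ⟨u, hu, hxu⟩ := h x hx
    exact ⟨u, Finset.mem_filter.2 ⟨hu.1, hu, hxu⟩⟩
  obtain ⟨u, hu, hmax⟩ := Finset.exists_max_image _
    (fun u => (V.filter fun y => y ∈ fcl V H ψ u).card) hne
  obtain ⟨huV, hud, hxu⟩ := Finset.mem_filter.1 hu
  refine hP _ _ ?_ (hψ u hud.1 hud.2)
  change fill _ ⊆ fill _
  apply fill_subset_fill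
  change _ ⊆ fcl V H ψ u
  apply her_stay hxu
  intro y hy z hz hyz hzd
  obtain ⟨w, hw, hzw⟩ := h z hzd
  have hneq : ∀ c ∈ compStar (dev V H ψ) u, c ∈ compStar (dev V H ψ) w → False := by
    intro c hc hcw
    have : compStar (dev V H ψ) u = compStar (dev V H ψ) w := by
      rw [← compStar_eq hc, compStar_eq hcw]
    apply hz
    unfold fcl at hzw ⊢
    rwa [this]
  have hadj : ∀ c ∈ compStar (dev V H ψ) u, ∀ c' ∈ compStar (dev V H ψ) w, starAdj c' c → False := by
    intro c hc c' hc' ha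
    exact hneq c hc (compStar_step hc' (compStar_sub hw hc') (compStar_sub hud hc) ha)
  obtain ⟨c, hc, hcz⟩ := fill_star_bdry hy hz hyz
  have hcw : c ∈ fcl V H ψ w := by
    by_contra hcw
    obtain ⟨c', hc', hcc⟩ := fill_star_bdry hzw hcw (starAdj_symm hcz)
    exact hadj c hc c' hc' hcc
  have hsub : compStar (dev V H ψ) u ⊆ fcl V H ψ w := by
    rw [← compStar_eq hc]
    apply her_stay hcw
    intro y' hy' z' hz' hyz' hzd'
    -- z' need not be in the cluster of u a priori
    obtain ⟨c', hc', hcc⟩ := fill_star_bdry hy' hz' hyz'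
    exact hz' (subset_fill _ (compStar_step hc' (compStar_sub hw hc') hzd' hcc))
  have hsub2 : fcl V H ψ u ⊆ fcl V H ψ w := fill_subset_fill hsub
  have hle := hmax w (Finset.mem_filter.2 ⟨hw.1, hw, hsub2 hxu⟩)
  have hlt : (V.filter fun y => y ∈ fcl V H ψ u).card < (V.filter fun y => y ∈ fcl V H ψ w).card := by
    apply Finset.card_lt_card
    refine ⟨fun y hy => ?_, fun hcon => ?_⟩
    · rw [Finset.mem_filter] at hy ⊢; exact ⟨hy.1, hsub2 hy.2⟩
    · have := hcon (Finset.mem_filter.2 ⟨hzd.1, hzw⟩)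
      exact hz (Finset.mem_filter.1 this).2
  omega

/-- The class of configurations. -/
def Kc (V : Finset Site) (η : Site → BSign) (H : ℤ) (f : Site → ℤ) (P : Set Site → Prop) :
    Set (Site → ℤ) := cfg V η H f ∩ goodP V H P

lemma ok_self (s : BSign) (H : ℤ) : BSign.ok s H H := by cases s <;> simp [BSign.ok]

/-- A given outer cluster is unlikely. -/
lemma cluster_prob {β lam : ℝ} (hβ : 1000 ≤ β) (hl0 : 0 < lam) (hl1 : lam ≤ 1)
    {V : Finset Site} (hV : connectedIn ((↑V : Set Site)ᶜ)) (η : Site → BSign) (H : ℤ)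
    (f : Site → ℤ) {P : Set Site → Prop} (hP : her P) {A0 : Finset Site} {D0 : ℝ}
    (hs : P ↑A0 → small D0 ↑A0) (hD : lam * D0 ≤ 1)
    (n : ℕ) (hn : 1 ≤ n) (hf : ∀ v ∈ V, f v + n ≤ H + 1) (hDn : D0 * qq β lam ^ n ≤ 1) :
    Mw β lam V (Kc V η H f P ∩ {ψ | ∃ u ∈ dev V H ψ, fcl V H ψ u = ↑A0}) ≤
      ENNReal.ofReal (Real.exp (-(β / 4 - 1) * edgeBdryCard A0)) * Mw β lam V (Kc V η H f P) := by
  rcases Set.eq_empty_or_nonempty (Kc V η H f P ∩ {ψ | ∃ u ∈ dev V H ψ, fcl V H ψ u = ↑A0})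
    with he | ⟨ψ0, hψ0, u0, hu0, hA0⟩
  · rw [he]; simp [Mw, mass]
  have hPA : P ↑A0 := by rw [← hA0]; exact hψ0.2 u0 hu0.1 hu0.2
  have hAV : A0 ⊆ V := by
    have := fcl_sub hV hu0
    rw [hA0] at this; exact_mod_cast this
  have hAc : connectedIn ((↑A0 : Set Site)ᶜ) := by
    rw [← hA0]; exact fill_compl_conn hV ((compStar_sub hu0).trans fun _ hx => hx.1)
  have hfH : ∀ v ∈ V, f v ≤ H := fun v hv => by have := hf v hv; omega
  clear hψ0 hA0 hu0 u0 ψ0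
  set η' : Site → BSign := fun v => if v ∈ innerBdry V then η v else BSign.free with hη'
  set O : Set (Site → ℤ) := {o | o ∈ Kc V η H f P ∧ (∀ x ∈ A0, o x = H) ∧
    ∀ x ∈ A0, ∀ y, y ∉ A0 → starAdj x y → o y = H} with hO
  set I := cfg A0 η' H f with hI
  have hcl := cluster hβ hl0 hl1 hAc (hs hPA) hD η' H f n hn (fun v hv => hf v (hAV hv)) hDn
  -- decomposition
  have h1 : Mw β lam V (Kc V η H f P ∩ {ψ | ∃ u ∈ dev V H ψ, fcl V H ψ u = ↑A0}) ≤
      ENNReal.ofReal (Real.exp (lam * H * A0.card)) *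
        (Mw β lam V O * Mw β lam A0 (I ∩ {ψ | ∀ b ∈ innerBdry A0, ψ b ≠ H})) := by
    have hprod := mass_prod (wE β lam V) (wE β lam A0) O (I ∩ {ψ | ∀ b ∈ innerBdry A0, ψ b ≠ H})
    unfold Mw
    rw [← hprod]
    have hrec : ∀ ψ : Site → ℤ, glue A0 (glue A0 ψ fun _ => H) (glue A0 (fun _ => H) ψ) = ψ := by
      intro ψ; ext x
      by_cases hx : x ∈ A0
      · rw [glue_in hx, glue_in hx]
      · rw [glue_out hx, glue_out hx]
    have hstar : ∀ ψ, (∃ u ∈ dev V H ψ, fcl V H ψ u = ↑A0) → (∀ x, x ∉ V → ψ x = H) →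
        ∀ x ∈ A0, ∀ y, y ∉ A0 → starAdj x y → ψ y = H := by
      rintro ψ ⟨u, hu, hA0⟩ hψV x hx y hy hxy
      by_contra hyH
      have hyV : y ∈ V := by
        by_contra hyV; exact hyH (hψV y hyV)
      have hx' : x ∈ fcl V H ψ u := by rw [hA0]; simpa using hx
      have hy' : y ∉ fcl V H ψ u := by rw [hA0]; simpa using hy
      obtain ⟨c, hc, hcy⟩ := fill_star_bdry hx' hy' hxy
      exact hy' (subset_fill _ (compStar_step hc (compStar_sub hu hc) ⟨hyV, hyH⟩ hcy))
    refine mass_transport _ _ (fun ψ => (glue A0 (fun _ => H) ψ, glue A0 ψ fun _ => H)) ?_ ?_ _ ?_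
    · intro ψ _ ψ' _ he
      simp only [Prod.mk.injEq] at he
      rw [← hrec ψ, ← hrec ψ', he.1, he.2]
    · rintro ψ ⟨⟨hψ, hψP⟩, hex⟩
      have hst := hstar ψ hex hψ.1
      refine ⟨⟨⟨⟨?_, ?_, ?_⟩, ?_⟩, ?_, ?_⟩, ⟨?_, ?_, ?_⟩, ?_⟩
      · intro x hx
        change glue A0 (fun _ => H) ψ x = H
        rw [glue_out (fun h => hx (hAV h))]; exact hψ.1 x hx
      · intro v hv
        change f v ≤ glue A0 (fun _ => H) ψ v
        by_cases hvA : v ∈ A0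
        · rw [glue_in hvA]; exact hfH v hv
        · rw [glue_out hvA]; exact hψ.2.1 v hv
      · intro v hv
        change BSign.ok (η v) H (glue A0 (fun _ => H) ψ v)
        by_cases hvA : v ∈ A0
        · rw [glue_in hvA]; exact ok_self _ _
        · rw [glue_out hvA]; exact hψ.2.2 v hv
      · refine closure_good hV hP hψP ?_
        rintro x ⟨hxV, hxH⟩
        refine ⟨x, ⟨hxV, ?_⟩, self_mem_fcl _ _ _ _⟩
        by_cases hxA : x ∈ A0
        · exact absurd (glue_in hxA (fun _ => H) ψ) hxH
        · dsimp only at hxH; rwa [glue_out hxA] at hxH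
      · intro x hx; exact glue_in hx (fun _ => H) ψ
      · intro x hx y hy hxy
        change glue A0 (fun _ => H) ψ y = H
        rw [glue_out hy]; exact hst x hx y hy hxy
      · intro x hx; exact glue_out hx ψ (fun _ => H)
      · intro v hv
        change f v ≤ glue A0 ψ (fun _ => H) v
        rw [glue_in hv]; exact hψ.2.1 v (hAV hv)
      · intro v hv
        change BSign.ok (η' v) H (glue A0 ψ (fun _ => H) v)
        have hvA : v ∈ A0 := (Finset.mem_filter.1 hv).1
        rw [glue_in hvA, hη']
        dsimp only
        split_ifs with hvV
        · exact hψ.2.2 v hvV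
        · trivial
      · intro b hb
        change glue A0 ψ (fun _ => H) b ≠ H
        have hbA : b ∈ A0 := (Finset.mem_filter.1 hb).1
        rw [glue_in hbA]
        obtain ⟨d, hd, hbd⟩ := innerBdry_exit hb
        obtain ⟨u, hu, hA0⟩ := hex
        have hx' : b ∈ fcl V H ψ u := by rw [hA0]; simpa using hbA
        have hy' : b + d ∉ fcl V H ψ u := by rw [hA0]; simpa using hbd
        exact (compStar_sub hu (fill_bdry hx' hy' (adjS_add hd))).2
    · rintro ψ ⟨⟨hψ, hψP⟩, hex⟩
      have hst := hstar ψ hex hψ.1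
      have hw := wt_glue β lam hAV (o := glue A0 (fun _ => H) ψ) (i := glue A0 ψ fun _ => H) (H := H)
        (fun x hx => glue_in hx _ _)
        (fun v hv d hd hvd => by
          rw [glue_out hvd]; exact hst v hv _ hvd (starAdj_of_adjS (adjS_add hd)))
        (fun x hx => glue_out hx _ _)
      rw [hrec ψ] at hw
      unfold wE
      dsimp only
      rw [hw, ENNReal.ofReal_mul (Real.exp_pos _).le, ENNReal.ofReal_mul (wt_pos _ _ _ _).le]
  -- recombination
  have h2 : Mw β lam V O * Mw β lam A0 I ≤
      ENNReal.ofReal (Real.exp (-(lam * H * A0.card))) * Mw β lam V (Kc V η H f P) := by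
    have hprod := mass_prod (wE β lam V) (wE β lam A0) O I
    unfold Mw
    rw [← hprod]
    refine mass_transport _ _ (fun p : (Site → ℤ) × (Site → ℤ) => glue A0 p.2 p.1) ?_ ?_ _ ?_
    · rintro ⟨o, i⟩ ⟨ho, hi⟩ ⟨o', i'⟩ ⟨ho', hi'⟩ he
      simp only at he ho hi ho' hi'
      have h3 : ∀ x, o x = o' x ∧ i x = i' x := by
        intro x
        have hx := congrFun he x
        by_cases hxA : x ∈ A0
        · rw [glue_in hxA, glue_in hxA] at hx
          exact ⟨by rw [ho.2.1 x hxA, ho'.2.1 x hxA], hx⟩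
        · rw [glue_out hxA, glue_out hxA] at hx
          exact ⟨hx, by rw [hi.1 x hxA, hi'.1 x hxA]⟩
      exact Prod.ext (funext fun x => (h3 x).1) (funext fun x => (h3 x).2)
    · rintro ⟨o, i⟩ ⟨ho, hi⟩
      simp only at ho hi ⊢
      obtain ⟨⟨hoc, hoP⟩, hoA, hoS⟩ := ho
      refine ⟨⟨?_, ?_, ?_⟩, ?_⟩
      · intro x hx
        rw [glue_out (fun h => hx (hAV h))]; exact hoc.1 x hx
      · intro v hv
        by_cases hvA : v ∈ A0
        · rw [glue_in hvA]; exact hi.2.1 v hvA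
        · rw [glue_out hvA]; exact hoc.2.1 v hv
      · intro v hv
        by_cases hvA : v ∈ A0
        · rw [glue_in hvA]
          have hvB : v ∈ innerBdry A0 := by
            obtain ⟨d, hd, hvd⟩ := innerBdry_exit hv
            exact Finset.mem_filter.2 ⟨hvA, d, hd, fun h => hvd (hAV h)⟩
          have := hi.2.2 v hvB
          rw [hη'] at this
          simpa [hv] using this
        · rw [glue_out hvA]; exact hoc.2.2 v hv
      · intro x hxV hxH
        have hout : ∀ z, z ∉ A0 → z ∈ dev V H (glue A0 i o) → z ∈ dev V H o := by
          rintro z hz ⟨hzV, hzH⟩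
          rw [glue_out hz] at hzH; exact ⟨hzV, hzH⟩
        by_cases hxA : x ∈ A0
        · refine hP _ _ ?_ hPA
          refine fill_sub hAc (her_stay (by simpa using hxA) ?_)
          intro y hy z hz hyz hzd
          exact (hout z (by simpa using hz) hzd).2
            (hoS y (by simpa using hy) z (by simpa using hz) hyz)
        · have hxo := hout x hxA ⟨hxV, hxH⟩
          refine hP _ _ ?_ (hoP x hxV hxo.2)
          apply fill_mono
          intro y hy
          change Relation.ReflTransGen _ x y at hy
          have key : y ∉ A0 ∧ y ∈ compStar (dev V H o) x := by
            induction hy with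
            | refl => exact ⟨hxA, self_mem_compStar _ _⟩
            | @tail b c _ hbc ih =>
              have hbo := hout b ih.1 hbc.2.1
              have hcA : c ∉ A0 := fun hcA =>
                hbo.2 (hoS c hcA b ih.1 (starAdj_symm hbc.1))
              exact ⟨hcA, compStar_step ih.2 hbo (hout c hcA hbc.2.2) hbc.1⟩
          exact key.2
    · rintro ⟨o, i⟩ ⟨ho, hi⟩
      simp only at ho hi ⊢
      have hw := wt_glue β lam hAV (o := o) (i := i) (H := H) ho.2.1
        (fun v hv d hd hvd => ho.2.2 v hv _ hvd (starAdj_of_adjS (adjS_add hd))) hi.1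
      unfold wE
      rw [hw, ← ENNReal.ofReal_mul (wt_pos _ _ _ _).le, ← ENNReal.ofReal_mul (Real.exp_pos _).le,
        ← mul_assoc, ← Real.exp_add]
      simp
  calc _ ≤ _ := h1
    _ ≤ ENNReal.ofReal (Real.exp (lam * H * A0.card)) *
        (Mw β lam V O * (ENNReal.ofReal (Real.exp (-(β / 4 - 1) * edgeBdryCard A0)) *
          Mw β lam A0 I)) := by gcongr
    _ = ENNReal.ofReal (Real.exp (-(β / 4 - 1) * edgeBdryCard A0)) *
        (ENNReal.ofReal (Real.exp (lam * H * A0.card)) * (Mw β lam V O * Mw β lam A0 I)) := by ring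
    _ ≤ ENNReal.ofReal (Real.exp (-(β / 4 - 1) * edgeBdryCard A0)) *
        (ENNReal.ofReal (Real.exp (lam * H * A0.card)) *
          (ENNReal.ofReal (Real.exp (-(lam * H * A0.card))) * Mw β lam V (Kc V η H f P))) := by gcongr
    _ = _ := by
      rw [← mul_assoc (ENNReal.ofReal (Real.exp (lam * H * A0.card))),
        ← ENNReal.ofReal_mul (Real.exp_pos _).le, ← Real.exp_add]
      simp

end

noncomputable section
open Filter
open scoped BigOperators ENNReal
attribute [local instance] Classical.propDecidable

/-! ### Elementary bounds and shifts -/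

lemma one_le_elem {β lam : ℝ} (hβ : 1000 ≤ β) (hl0 : 0 < lam) (hl1 : lam ≤ 1) {h : ℤ} (hh : 0 ≤ h) :
    1 ≤ elemBound β lam h := by
  have hh' : (0:ℝ) ≤ h := by exact_mod_cast hh
  refine le_min ?_ ?_
  · rw [le_div_iff₀ hl0]; linarith
  · refine Real.one_le_exp ?_; positivity

lemma lam_elem {β lam : ℝ} (hl0 : 0 < lam) (h : ℤ) : lam * elemBound β lam h ≤ 1 := by
  have : elemBound β lam h ≤ 1 / lam := min_le_left _ _
  rw [le_div_iff₀ hl0] at this; linarith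

lemma elem_mono {β lam : ℝ} (hβ : 1000 ≤ β) {h h' : ℤ} (hh : h ≤ h') :
    elemBound β lam h ≤ elemBound β lam h' := by
  have hh' : (h:ℝ) ≤ h' := by exact_mod_cast hh
  refine min_le_min le_rfl (Real.exp_le_exp.2 ?_)
  gcongr

lemma qq_pow {β lam : ℝ} {H : ℤ} (hH : 0 ≤ H) : qq β lam ^ H.toNat = Real.exp (-(4 * β - lam) * H) := by
  unfold qq
  rw [← Real.exp_nat_mul]
  have : ((H.toNat : ℕ) : ℝ) = (H : ℝ) := by exact_mod_cast Int.toNat_of_nonneg hH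
  rw [this]; congr 1; ring

lemma elem_qq {β lam : ℝ} (hβ : 1000 ≤ β) (hl1 : lam ≤ 1) {h : ℤ} (hh : 0 ≤ h) :
    elemBound β lam h * qq β lam ^ (h + 1).toNat ≤ 1 := by
  rw [qq_pow (by omega)]
  have hh' : (0:ℝ) ≤ h := by exact_mod_cast hh
  have h1 : elemBound β lam h ≤ Real.exp (3 * β * ((h:ℝ) + 1)) := min_le_right _ _
  calc _ ≤ Real.exp (3 * β * ((h:ℝ) + 1)) * Real.exp (-(4 * β - lam) * ((h + 1 : ℤ) : ℝ)) := by gcongr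
    _ ≤ 1 := by
      rw [← Real.exp_add, Real.exp_le_one_iff]
      push_cast
      nlinarith

lemma toReal_le {a b : ℝ≥0∞} {c : ℝ} (h : a ≤ ENNReal.ofReal c * b) (hb : b ≠ ⊤) (hc : 0 ≤ c) :
    a.toReal ≤ c * b.toReal := by
  have := ENNReal.toReal_mono (ENNReal.mul_ne_top ENNReal.ofReal_ne_top hb) h
  rwa [ENNReal.toReal_mul, ENNReal.toReal_ofReal hc] at this

lemma shift_mass {β lam : ℝ} {V : Finset Site} {S S' : Set (Site → ℤ)} (s : ℤ)
    (h : ∀ ψ ∈ S, (fun x => ψ x + s) ∈ S') :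
    Mw β lam V S ≤ ENNReal.ofReal (Real.exp (lam * s * V.card)) * Mw β lam V S' := by
  refine Mw_transport (fun ψ x => ψ x + s) ?_ h _ (Real.exp_pos _).le ?_
  · intro ψ _ ψ' _ he
    ext x
    have := congrFun he x
    simp only at this; omega
  · intro ψ _
    rw [wt_global, ← mul_assoc, ← Real.exp_add]
    refine le_of_eq ?_
    have : lam * s * V.card + -lam * s * V.card = 0 := by ring
    rw [this]; simp

lemma ok_shift {t : BSign} {H x : ℤ} (s : ℤ) (h : BSign.ok t H x) : BSign.ok t (H + s) (x + s) := by
  cases t <;> simp only [BSign.ok] at h ⊢ <;> omega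

lemma cfg_shift {V : Finset Site} {η : Site → BSign} {H s : ℤ} {f f' : Site → ℤ} {ψ : Site → ℤ}
    (h : ψ ∈ cfg V η H f) (hf : ∀ v ∈ V, f' v ≤ ψ v + s) :
    (fun x => ψ x + s) ∈ cfg V η (H + s) f' := by
  refine ⟨fun x hx => by dsimp only; rw [h.1 x hx], hf, fun v hv => ok_shift s (h.2.2 v hv)⟩

lemma dev_shift (V : Finset Site) (H s : ℤ) (ψ : Site → ℤ) :
    dev V (H + s) (fun x => ψ x + s) = dev V H ψ := by
  ext x; simp [dev]

lemma good_shift {V : Finset Site} {H s : ℤ} {P : Set Site → Prop} {ψ : Site → ℤ}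
    (h : ψ ∈ goodP V H P) : (fun x => ψ x + s) ∈ goodP V (H + s) P := by
  intro u hu huH
  unfold fcl
  rw [dev_shift]
  exact h u hu (fun hc => huH (by simp [hc]))

lemma cfg_raise {V : Finset Site} {η : Site → BSign} {H : ℤ} {f : Site → ℤ} {ψ : Site → ℤ} {v : Site}
    {A : Finset Site} (h : ψ ∈ cfg V η H f) (hv : ψ v < H) (hA : (↑A : Set Site) = subComp ψ v)
    (hAV : A ⊆ V) : shiftOn A 1 ψ ∈ cfg V η H f := by
  refine ⟨?_, ?_, ?_⟩
  · intro x hx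
    rw [shiftOn_out (fun h => hx (hAV h))]; exact h.1 x hx
  · intro u hu
    have := h.2.1 u hu
    by_cases huA : u ∈ A
    · rw [shiftOn_in huA]; omega
    · rw [shiftOn_out huA]; exact this
  · intro u hu
    have := h.2.2 u hu
    by_cases huA : u ∈ A
    · rw [shiftOn_in huA]
      obtain ⟨d, hd, hud⟩ := innerBdry_exit hu
      have h7 := (subComp_bdry hA u huA d hd (fun h => hud (hAV h))).1
      cases hη : η u <;> rw [hη] at this <;> simp only [BSign.ok] at this ⊢ <;> omega
    · rw [shiftOn_out huA]; exact this

/-! ### Renormalized weights -/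

lemma up_ratio {β lam : ℝ} (hβ : 1000 ≤ β) (hl0 : 0 < lam) (hl1 : lam ≤ 1) {A : Finset Site}
    (hc : connectedIn ((↑A : Set Site)ᶜ)) {h : ℤ} (hh : 0 ≤ h) (hs : small (elemBound β lam h) ↑A)
    (η : Site → BSign) :
    Mw β lam A (signedConfigs A η (h + 1)) ≤
      ENNReal.ofReal (Real.exp (edgeBdryCard A)) * Mw β lam A (signedConfigs A η h) := by
  have hsc : ∀ A' ⊆ A, (A'.card : ℝ) ≤ elemBound β lam h * edgeBdryCard A' / 2 := fun A' h =>
    small_card (small_mono le_rfl (by exact_mod_cast h) hs)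
  have h1 := floorP hβ hl0 hl1 (V := A) (R := A) subset_rfl hc (h + 1)
    (𝒦 := cfg A η (h + 1) (fun _ => 0))
    (fun ψ hψ x hx d hd hxd => Or.inr (hψ.1 _ hxd).ge)
    (fun ψ hψ v hv hvL A' hA' hA'A => by
      refine ⟨?_, cfg_raise hψ hvL hA' hA'A⟩
      have h2 := hsc A' hA'A
      have h3 := lam_elem (β := β) hl0 h
      have he : (0:ℝ) ≤ edgeBdryCard A' := by positivity
      nlinarith)
    (fun _ => 0) (h + 1).toNat (by omega) (fun v hv => by omega) (fun ψ hψ v hv => hψ.2.1 v hv)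
  have h2 := shift_mass (β := β) (lam := lam) (V := A)
    (S := cfg A η (h + 1) (fun _ => 0) ∩ {ψ | ∀ v ∈ A, 0 + 1 ≤ ψ v})
    (S' := cfg A η h (fun _ => 0)) (-1) (by
      rintro ψ ⟨hψ, hψ1⟩
      have := cfg_shift (s := -1) (f' := fun _ => 0) hψ (fun v hv => by have := hψ1 v hv; omega)
      rwa [show h + 1 + -1 = h by ring] at this)
  rw [← cfg_zero, ← cfg_zero]
  refine h1.trans ((mul_le_mul_right h2 _).trans ?_)
  rw [← mul_assoc, ← ENNReal.ofReal_mul (Real.exp_pos _).le, ← Real.exp_add]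
  refine mul_le_mul_left (ENNReal.ofReal_le_ofReal (Real.exp_le_exp.2 ?_)) _
  have h3 := hsc A subset_rfl
  have h4 := elem_qq hβ hl1 hh
  have he : (0:ℝ) ≤ edgeBdryCard A := by positivity
  have hqn := pow_pos (qq_pos β lam) (h + 1).toNat
  have h5 : qq β lam ^ (h + 1).toNat * A.card ≤ edgeBdryCard A / 2 := by
    calc _ ≤ qq β lam ^ (h + 1).toNat * (elemBound β lam h * edgeBdryCard A / 2) := by gcongr
      _ = (elemBound β lam h * qq β lam ^ (h + 1).toNat) * (edgeBdryCard A / 2) := by ring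
      _ ≤ 1 * (edgeBdryCard A / 2) := by gcongr
      _ = _ := one_mul _
  have h6 : 0 ≤ lam * A.card := by positivity
  push_cast
  nlinarith

lemma down_ratio {β lam : ℝ} (hl0 : 0 < lam) {A : Finset Site}
    {h : ℤ} (hs : small (elemBound β lam h) ↑A) :
    Mw β lam A (signedConfigs A (constSign .minus) (h - 1)) ≤
      ENNReal.ofReal (Real.exp (edgeBdryCard A)) * Mw β lam A (signedConfigs A (constSign .minus) h) := by
  have h2 := shift_mass (β := β) (lam := lam) (V := A)
    (S := cfg A (constSign .minus) (h - 1) (fun _ => 0))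
    (S' := cfg A (constSign .minus) h (fun _ => 0)) 1 (by
      intro ψ hψ
      have := cfg_shift (s := 1) (f' := fun _ => 0) hψ (fun v hv => by have : 0 ≤ ψ v := hψ.2.1 v hv
                                                                       omega)
      rwa [show h - 1 + 1 = h by ring] at this)
  rw [← cfg_zero, ← cfg_zero]
  refine h2.trans ?_
  refine mul_le_mul_left (ENNReal.ofReal_le_ofReal (Real.exp_le_exp.2 ?_)) _
  have h2 := small_card hs
  have h3 := lam_elem (β := β) hl0 h
  have he : (0:ℝ) ≤ edgeBdryCard A := by positivity
  push_cast
  nlinarith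

lemma part_two {β lam : ℝ} (hβ : 1000 ≤ β) (hl0 : 0 < lam) (hl1 : lam ≤ 1) {h : ℤ} (hh : 0 ≤ h)
    {γ : Contour} (hv : Contour.valid γ) (he : IsElem β lam h γ) :
    Wrn β lam h γ ≤ Real.exp (-(β - 2) * (γ.len : ℝ)) := by
  obtain ⟨-, -, hc⟩ := hv
  have hs : small (elemBound β lam h) ↑γ.int := he
  have hfin : ∀ η, Mw β lam γ.int (signedConfigs γ.int η h) ≠ ⊤ := fun η =>
    Mw_ne_top (by linarith) hl0 (f := fun _ => 0) (fun _ => le_rfl) (η := η) (h := h) subset_rfl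
  have key : ∀ r : ℝ, r ≤ Real.exp (edgeBdryCard γ.int) →
      Real.exp (-β * (γ.len : ℝ)) * r ≤ Real.exp (-(β - 2) * (γ.len : ℝ)) := by
    intro r hr
    calc _ ≤ Real.exp (-β * (γ.len : ℝ)) * Real.exp (edgeBdryCard γ.int) := by gcongr
      _ ≤ _ := by
        rw [← Real.exp_add]
        refine Real.exp_le_exp.2 ?_
        have : (0:ℝ) ≤ edgeBdryCard γ.int := by positivity
        unfold Contour.len
        nlinarith
  unfold Wrn
  split_ifs
  · apply key
    rw [Zsos_eq, Zsos_eq]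
    exact div_le_of_le_mul₀ ENNReal.toReal_nonneg (Real.exp_pos _).le
      (toReal_le (up_ratio hβ hl0 hl1 hc hh hs _) (hfin _) (Real.exp_pos _).le)
  · apply key
    rw [Zsos_eq, Zsos_eq]
    exact div_le_of_le_mul₀ ENNReal.toReal_nonneg (Real.exp_pos _).le
      (toReal_le (down_ratio hl0 hs) (hfin _) (Real.exp_pos _).le)

end

noncomputable section
open Filter
open scoped BigOperators ENNReal
attribute [local instance] Classical.propDecidable

/-! ### Probability that a site lies in a large outer cluster -/

lemma site_prob {β lam : ℝ} (hβ : 1000 ≤ β) (hl0 : 0 < lam) (hl1 : lam ≤ 1)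
    {V : Finset Site} (hV : connectedIn ((↑V : Set Site)ᶜ)) (η : Site → BSign) (H : ℤ)
    (f : Site → ℤ) {P : Set Site → Prop} (hP : her P) {D0 : ℝ}
    (hs : ∀ F, P F → small D0 F) (hD : lam * D0 ≤ 1)
    (n : ℕ) (hn : 1 ≤ n) (hf : ∀ v ∈ V, f v + n ≤ H + 1) (hDn : D0 * qq β lam ^ n ≤ 1)
    (v : Site) (Q : Set Site → Prop) (N : ℕ) (hN : 1 ≤ N)
    (hQ : ∀ A : Finset Site, v ∈ A → stc ↑A → Q ↑A → N ≤ edgeBdryCard A) :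
    Mw β lam V (Kc V η H f P ∩ {ψ | ∃ u ∈ dev V H ψ, v ∈ fcl V H ψ u ∧ Q (fcl V H ψ u)}) ≤
      ENNReal.ofReal (Real.exp (-(β / 4 - 9) * N)) * Mw β lam V (Kc V η H f P) := by
  set 𝓕 : Finset (Finset Site) := V.powerset.filter fun A =>
      v ∈ A ∧ stc ↑A ∧ connectedIn ((↑A : Set Site)ᶜ) ∧ N ≤ edgeBdryCard A with h𝓕
  refine (mass_biUnion_le _ 𝓕 (fun A => Kc V η H f P ∩ {ψ | ∃ u ∈ dev V H ψ, fcl V H ψ u = ↑A}) ?_).trans ?_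
  · rintro ψ ⟨hψ, u, hu, hvu, hQu⟩
    obtain ⟨A, hA, hAV⟩ := exists_subComp (fcl_sub hV hu)
    have hvA : v ∈ A := by
      have : v ∈ (↑A : Set Site) := by rw [hA]; exact hvu
      simpa using this
    have hst : stc (↑A : Set Site) := by rw [hA]; exact stc_fill (stc_compStar hu)
    refine ⟨A, Finset.mem_filter.2 ⟨Finset.mem_powerset.2 hAV, hvA, hst, ?_, ?_⟩, hψ, u, hu, hA.symm⟩
    · rw [hA]; exact fill_compl_conn hV ((compStar_sub hu).trans fun _ hx => hx.1)
    · exact hQ A hvA hst (by rw [hA]; exact hQu)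
  · refine (Finset.sum_le_sum fun A hA =>
      cluster_prob hβ hl0 hl1 hV η H f hP (A0 := A) (hs _) hD n hn hf hDn).trans ?_
    rw [sum_ofReal_mul _ _ (fun _ _ => (Real.exp_pos _).le)]
    refine mul_le_mul_left (ENNReal.ofReal_le_ofReal ?_) _
    refine (count_sum 𝓕 v N hN (β / 4 - 1) (by linarith) (fun A hA => (Finset.mem_filter.1 hA).2)).trans ?_
    exact le_of_eq (by congr 1; ring)

/-! ### Elementary partition functions -/

/-- Elementary partition function as an extended nonnegative number. -/
def ZE (β lam : ℝ) (η : Site → BSign) (V : Finset Site) (k : ℤ) : ℝ≥0∞ :=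
  Mw β lam V (Kc V η k (fun _ => 0) (small (elemBound β lam k)))

lemma Zel_ZE (β lam : ℝ) (η : Site → BSign) (V : Finset Site) (k : ℤ) :
    Zel β lam η k V = (ZE β lam η V k).toReal := Zel_eq β lam η k V

lemma Kc_ne_top {β lam : ℝ} (hβ : 1000 ≤ β) (hl0 : 0 < lam) (V : Finset Site) (η : Site → BSign)
    (H : ℤ) {f : Site → ℤ} (hf : ∀ v, 0 ≤ f v) (P : Set Site → Prop) :
    Mw β lam V (Kc V η H f P) ≠ ⊤ :=
  Mw_ne_top (by linarith) hl0 hf Set.inter_subset_left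

lemma ZE_pos (β lam : ℝ) (η : Site → BSign) (V : Finset Site) {k : ℤ} (hk : 0 ≤ k) :
    0 < ZE β lam η V k := by
  refine Mw_pos (ψ := fun _ => k) ⟨⟨fun _ _ => rfl, fun _ _ => hk, fun v _ => ok_self _ _⟩, ?_⟩
  intro u _ hu
  exact absurd rfl hu

lemma Kc_mono {V : Finset Site} {η : Site → BSign} {H : ℤ} {f f' : Site → ℤ} {P P' : Set Site → Prop}
    (hf : ∀ v, f' v ≤ f v) (hP : ∀ F, P F → P' F) : Kc V η H f P ⊆ Kc V η H f' P' :=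
  fun _ h => ⟨⟨h.1.1, fun v hv => (hf v).trans (h.1.2.1 v hv), h.1.2.2⟩,
    fun u hu huH => hP _ (h.2 u hu huH)⟩

lemma ZE_shift {β lam : ℝ} (hβ : 1000 ≤ β) (η : Site → BSign) (V : Finset Site) (k : ℤ) {s : ℤ}
    (hs : 0 ≤ s) :
    ZE β lam η V k ≤ ENNReal.ofReal (Real.exp (lam * s * V.card)) * ZE β lam η V (k + s) := by
  refine shift_mass s ?_
  rintro ψ ⟨hψ, hψP⟩
  refine ⟨cfg_shift hψ (fun v hv => ?_), ?_⟩
  · have : 0 ≤ ψ v := hψ.2.1 v hv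
    omega
  · intro u hu huH
    exact small_mono (elem_mono hβ (by omega)) subset_rfl (good_shift hψP u hu huH)

/-! ### Lower bound -/

lemma theta_bound {β lam D : ℝ} {H : ℤ} (hβ : 1000 ≤ β) (hl0 : 0 < lam) (hH : 1 ≤ H)
    (hD : Real.exp (3 * β * H) ≤ D) :
    Real.exp (-(β / 4 - 9) * D) ≤ qq β lam ^ H.toNat / 100 := by
  rw [qq_pow (by omega)]
  have hH' : (1:ℝ) ≤ H := by exact_mod_cast hH
  have h100 : (100:ℝ) ≤ Real.exp 100 := by have := Real.add_one_le_exp (100:ℝ); linarith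
  have h1 : Real.exp (-(β / 4 - 9) * D) * Real.exp 100 ≤ Real.exp (-(4 * β - lam) * H) := by
    rw [← Real.exp_add]
    refine Real.exp_le_exp.2 ?_
    have h2 := Real.add_one_le_exp (3 * β * H)
    have h3 : 3 * β * H + 1 ≤ D := h2.trans hD
    have hbH : 1000 ≤ β * H := by nlinarith
    nlinarith
  rw [le_div_iff₀ (by norm_num)]
  have := Real.exp_pos (-(β / 4 - 9) * D)
  nlinarith

lemma cut_large {β lam : ℝ} (hβ : 1000 ≤ β) (hl0 : 0 < lam) (hl1 : lam ≤ 1)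
    {V : Finset Site} (hV : connectedIn ((↑V : Set Site)ᶜ)) (η : Site → BSign) {k : ℤ} (hk : 0 ≤ k) :
    ZE β lam η V (k + 1) ≤ ENNReal.ofReal (Real.exp ((1/50) * qq β lam ^ (k + 1).toNat * V.card)) *
      Mw β lam V (Kc V η (k + 1) (fun _ => 0) (small (elemBound β lam k))) := by
  set D := elemBound β lam k with hDdef
  set D' := elemBound β lam (k + 1) with hD'def
  have hq := pow_pos (qq_pos β lam) (k + 1).toNat
  rcases le_or_gt D' D with hle | hlt
  · have h1 : ZE β lam η V (k + 1) ≤ Mw β lam V (Kc V η (k + 1) (fun _ => 0) (small D)) :=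
      mass_mono _ (Kc_mono (fun _ => le_rfl) (fun F hF => small_mono hle subset_rfl hF))
    refine h1.trans ?_
    refine le_mul_of_one_le_left' ?_
    rw [← ENNReal.ofReal_one]
    refine ENNReal.ofReal_le_ofReal (Real.one_le_exp ?_)
    positivity
  have hDe : D = Real.exp (3 * β * ((k + 1 : ℤ) : ℝ)) := by
    rcases min_choice (1 / lam) (Real.exp (3 * β * ((k : ℝ) + 1))) with h | h
    · exfalso
      have h1 : D = 1 / lam := h
      have h2 : D' ≤ 1 / lam := min_le_left _ _
      linarith
    · rw [hDdef]; unfold elemBound; rw [h]; push_cast; rfl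
  have hD1 : 1 ≤ D := one_le_elem hβ hl0 hl1 hk
  set N := ⌈D⌉₊ with hN
  have hND : D ≤ N := Nat.le_ceil D
  have hN1 : 1 ≤ N := by
    have : (1:ℝ) ≤ N := hD1.trans hND
    exact_mod_cast this
  set θ := Real.exp (-(β / 4 - 9) * N) with hθ
  have hθ0 : 0 < θ := Real.exp_pos _
  have hθ1 : θ ≤ qq β lam ^ (k + 1).toNat / 100 := theta_bound hβ hl0 (by omega) (by rw [← hDe]; exact hND)
  have hq1 : qq β lam ^ (k + 1).toNat ≤ 1 := pow_le_one₀ (qq_pos β lam).le (qq_lt_one hβ hl1)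
  let PT : Finset Site → Set Site → Prop := fun T F => small D' F ∧ ((∃ t ∈ T, t ∈ F) → small D F)
  have hher : ∀ T, her (PT T) := by
    intro T F F' hFF h
    exact ⟨small_mono le_rfl hFF h.1, fun ⟨t, ht, htF⟩ => small_mono le_rfl hFF (h.2 ⟨t, ht, hFF htF⟩)⟩
  have key : ∀ T : Finset Site, ZE β lam η V (k + 1) ≤
      ENNReal.ofReal (Real.exp ((1/50) * qq β lam ^ (k + 1).toNat * T.card)) *
        Mw β lam V (Kc V η (k + 1) (fun _ => 0) (PT T)) := by
    intro T
    induction T using Finset.induction_on with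
    | empty =>
      simp only [Finset.card_empty, Nat.cast_zero, mul_zero, Real.exp_zero, ENNReal.ofReal_one, one_mul]
      refine mass_mono _ (Kc_mono (fun _ => le_rfl) ?_)
      intro F hF
      exact ⟨hF, fun ⟨t, ht, _⟩ => absurd ht (by simp)⟩
    | insert v T hvT ih =>
      refine ih.trans ?_
      set X := Mw β lam V (Kc V η (k + 1) (fun _ => 0) (PT T)) with hX
      set Y := Mw β lam V (Kc V η (k + 1) (fun _ => 0) (PT (insert v T))) with hY
      have hXt : X ≠ ⊤ := Kc_ne_top hβ hl0 V η _ (fun _ => le_rfl) _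
      have hYt : Y ≠ ⊤ := Kc_ne_top hβ hl0 V η _ (fun _ => le_rfl) _
      have h1 : X ≤ Y + ENNReal.ofReal θ * X := by
        refine (mass_cover _ (T := Kc V η (k + 1) (fun _ => 0) (PT (insert v T)))
          (U := Kc V η (k + 1) (fun _ => 0) (PT T) ∩ {ψ | ∃ u ∈ dev V (k + 1) ψ,
            v ∈ fcl V (k + 1) ψ u ∧ ¬ small D (fcl V (k + 1) ψ u)}) ?_).trans ?_
        · rintro ψ ⟨hψ, hψP⟩
          by_cases h : ∃ u ∈ dev V (k + 1) ψ, v ∈ fcl V (k + 1) ψ u ∧ ¬ small D (fcl V (k + 1) ψ u)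
          · exact Or.inr ⟨⟨hψ, hψP⟩, h⟩
          · left
            refine ⟨hψ, fun u hu huH => ⟨(hψP u hu huH).1, ?_⟩⟩
            rintro ⟨t, ht, htF⟩
            rcases Finset.mem_insert.1 ht with rfl | ht
            · by_contra hc
              exact h ⟨u, ⟨hu, huH⟩, htF, hc⟩
            · exact (hψP u hu huH).2 ⟨t, ht, htF⟩
        · refine add_le_add_right ?_ _
          refine site_prob hβ hl0 hl1 hV η (k + 1) _ (hher T) (D0 := D') (fun F hF => hF.1)
            (lam_elem hl0 _) (k + 1 + 1).toNat (by omega) (fun v hv => by omega)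
            (elem_qq hβ hl1 (by omega)) v (fun F => ¬ small D F) N hN1 ?_
          intro A _ hst hns
          exact Nat.ceil_le.2 (not_small_eb hst hns)
      have h2 : X ≤ ENNReal.ofReal (Real.exp ((1/50) * qq β lam ^ (k + 1).toNat)) * Y := by
        have h3 := ENNReal.toReal_mono
          (ENNReal.add_ne_top.2 ⟨hYt, ENNReal.mul_ne_top ENNReal.ofReal_ne_top hXt⟩) h1
        rw [ENNReal.toReal_add hYt (ENNReal.mul_ne_top ENNReal.ofReal_ne_top hXt), ENNReal.toReal_mul,
          ENNReal.toReal_ofReal hθ0.le] at h3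
        rw [← ENNReal.ofReal_toReal hXt, ← ENNReal.ofReal_toReal hYt,
          ← ENNReal.ofReal_mul (Real.exp_pos _).le]
        refine ENNReal.ofReal_le_ofReal ?_
        have hx0 : 0 ≤ X.toReal := ENNReal.toReal_nonneg
        have hy0 : 0 ≤ Y.toReal := ENNReal.toReal_nonneg
        have h4 : 1 + 2 * θ ≤ Real.exp ((1/50) * qq β lam ^ (k + 1).toNat) := by
          have := Real.add_one_le_exp ((1/50) * qq β lam ^ (k + 1).toNat)
          linarith
        have h5 : X.toReal ≤ (1 + 2 * θ) * Y.toReal := by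
          have h6 : (1 - θ) * X.toReal ≤ Y.toReal := by linarith
          have h7 : 1 ≤ (1 + 2 * θ) * (1 - θ) := by nlinarith
          calc X.toReal ≤ ((1 + 2 * θ) * (1 - θ)) * X.toReal := le_mul_of_one_le_left hx0 h7
            _ = (1 + 2 * θ) * ((1 - θ) * X.toReal) := by ring
            _ ≤ _ := by gcongr
        exact h5.trans (by gcongr)
      refine (mul_le_mul_right h2 _).trans ?_
      rw [← mul_assoc, ← ENNReal.ofReal_mul (Real.exp_pos _).le, ← Real.exp_add]
      refine mul_le_mul_left (ENNReal.ofReal_le_ofReal (Real.exp_le_exp.2 (le_of_eq ?_))) _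
      rw [Finset.card_insert_of_notMem hvT]; push_cast; ring
  refine (key V).trans (mul_le_mul_right (mass_mono _ ?_) _)
  rintro ψ ⟨hψ, hψP⟩
  exact ⟨hψ, fun u hu huH => (hψP u hu huH).2 ⟨u, hu, self_mem_fcl _ _ _ _⟩⟩

lemma lower_step {β lam : ℝ} (hβ : 1000 ≤ β) (hl0 : 0 < lam) (hl1 : lam ≤ 1)
    {V : Finset Site} (hV : connectedIn ((↑V : Set Site)ᶜ)) (η : Site → BSign) {k : ℤ} (hk : 0 ≤ k) :
    ZE β lam η V (k + 1) ≤ ENNReal.ofReal (Real.exp ((6/5) * qq β lam ^ (k + 1).toNat * V.card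
      - lam * V.card)) * ZE β lam η V k := by
  have h0 := cut_large hβ hl0 hl1 hV η hk
  have h1 := floorP hβ hl0 hl1 (V := V) (R := V) subset_rfl hV (k + 1)
    (𝒦 := Kc V η (k + 1) (fun _ => 0) (small (elemBound β lam k)))
    (fun ψ hψ x hx d hd hxd => Or.inr (hψ.1.1 _ hxd).ge)
    (fun ψ hψ v hv hvL A hA hAV => by
      have hvd : v ∈ dev V (k + 1) ψ := ⟨hv, by omega⟩
      have hsub : (↑A : Set Site) ⊆ fcl V (k + 1) ψ v := by
        rw [hA]
        apply fill_mono
        apply comp4_sub_compStar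
        intro u hu
        change ψ u ≤ ψ v at hu
        refine ⟨?_, by omega⟩
        by_contra huV
        have := hψ.1.1 u huV; omega
      refine ⟨?_, cfg_raise hψ.1 hvL hA hAV, closure_good hV (her_small _) hψ.2 ?_⟩
      · have h2 := small_card (small_mono le_rfl hsub (hψ.2 v hvd.1 hvd.2))
        have h3 := lam_elem (β := β) hl0 k
        have he : (0:ℝ) ≤ edgeBdryCard A := by positivity
        nlinarith
      · rintro x ⟨hxV, hxH⟩
        by_cases hxA : x ∈ A
        · exact ⟨v, hvd, hsub (by simpa using hxA)⟩
        · rw [shiftOn_out hxA] at hxH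
          exact ⟨x, ⟨hxV, hxH⟩, self_mem_fcl _ _ _ _⟩)
    (fun _ => 0) (k + 1).toNat (by omega) (fun v hv => by omega) (fun ψ hψ v hv => hψ.1.2.1 v hv)
  have h2 := shift_mass (β := β) (lam := lam) (V := V)
    (S := Kc V η (k + 1) (fun _ => 0) (small (elemBound β lam k)) ∩ {ψ | ∀ v ∈ V, 0 + 1 ≤ ψ v})
    (S' := Kc V η k (fun _ => 0) (small (elemBound β lam k))) (-1) (by
      rintro ψ ⟨hψ, hψ1⟩
      have h3 := cfg_shift (s := -1) (f' := fun _ => 0) hψ.1 (fun v hv => by have := hψ1 v hv; omega)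
      have h4 := good_shift (s := -1) hψ.2
      rw [show k + 1 + -1 = k by ring] at h3 h4
      exact ⟨h3, h4⟩)
  refine h0.trans ((mul_le_mul_right (h1.trans (mul_le_mul_right h2 _)) _).trans ?_)
  rw [← mul_assoc, ← mul_assoc, ← ENNReal.ofReal_mul (Real.exp_pos _).le,
    ← ENNReal.ofReal_mul (by positivity), ← Real.exp_add, ← Real.exp_add]
  refine mul_le_mul_left (ENNReal.ofReal_le_ofReal (Real.exp_le_exp.2 ?_)) _
  have : 0 ≤ qq β lam ^ (k + 1).toNat * V.card := mul_nonneg (pow_pos (qq_pos β lam) _).le (by positivity)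
  push_cast
  linarith

lemma lower_all {β lam : ℝ} (hβ : 1000 ≤ β) (hl0 : 0 < lam) (hl1 : lam ≤ 1)
    {V : Finset Site} (hV : connectedIn ((↑V : Set Site)ᶜ)) (η : Site → BSign) (j : ℕ) :
    ∀ k : ℤ, 0 ≤ k → ZE β lam η V (k + j) ≤
      ENNReal.ofReal (Real.exp (2 * qq β lam ^ (k + 1).toNat * V.card - lam * j * V.card)) *
        ZE β lam η V k := by
  induction j with
  | zero =>
    intro k hk
    have : ZE β lam η V (k + (0:ℕ)) = ZE β lam η V k := by simp
    rw [this]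
    refine le_mul_of_one_le_left' ?_
    rw [← ENNReal.ofReal_one]
    refine ENNReal.ofReal_le_ofReal (Real.one_le_exp ?_)
    have := mul_nonneg (pow_pos (qq_pos β lam) (k + 1).toNat).le (by positivity : (0:ℝ) ≤ V.card)
    push_cast; nlinarith
  | succ j ih =>
    intro k hk
    have h1 := ih (k + 1) (by omega)
    have h2 := lower_step hβ hl0 hl1 hV η hk
    rw [show k + ((j + 1 : ℕ) : ℤ) = k + 1 + j by push_cast; ring]
    refine h1.trans ((mul_le_mul_right h2 _).trans ?_)
    rw [← mul_assoc, ← ENNReal.ofReal_mul (Real.exp_pos _).le, ← Real.exp_add]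
    refine mul_le_mul_left (ENNReal.ofReal_le_ofReal (Real.exp_le_exp.2 ?_)) _
    have hpow : qq β lam ^ (k + 1 + 1).toNat = qq β lam ^ (k + 1).toNat * qq β lam := by
      rw [show (k + 1 + 1).toNat = (k + 1).toNat + 1 by omega, pow_succ]
    have hq10 : qq β lam ≤ 1 / 10 := by
      have h3 : qq β lam * Real.exp 100 ≤ 1 := by
        unfold qq
        rw [← Real.exp_add, Real.exp_le_one_iff]; linarith
      have := ten_le_exp
      have := qq_pos β lam
      nlinarith
    have hx := mul_nonneg (pow_pos (qq_pos β lam) (k + 1).toNat).le (by positivity : (0:ℝ) ≤ V.card)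
    rw [hpow]
    have h5 : qq β lam ^ (k + 1).toNat * qq β lam * V.card ≤
        qq β lam ^ (k + 1).toNat * V.card * (1 / 10) := by
      calc _ = qq β lam ^ (k + 1).toNat * V.card * qq β lam := by ring
        _ ≤ _ := by gcongr
    push_cast
    linarith

end

noncomputable section
open Filter
open scoped BigOperators ENNReal
attribute [local instance] Classical.propDecidable

/-- The nine offsets of the `3 × 3` neighbourhood. -/
def nine : Finset Site := Finset.Icc (-1 : ℤ) 1 ×ˢ Finset.Icc (-1 : ℤ) 1

lemma nine_card : nine.card = 9 := by
  unfold nine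
  rw [Finset.card_product]; rfl

lemma mem_nine {d : Site} (h1 : |d.1| ≤ 1) (h2 : |d.2| ≤ 1) : d ∈ nine := by
  unfold nine
  rw [abs_le] at h1 h2
  simp only [Finset.mem_product, Finset.mem_Icc]
  exact ⟨h1, h2⟩

lemma spike_good {V : Finset Site} {H : ℤ} {ψ : Site → ℤ} {v : Site} {D : ℝ} (hD : 1 ≤ D)
    (hψ : ψ ∈ goodP V H (small D)) (hn : ∀ d ∈ nine, ψ (v + d) = H) :
    Function.update ψ v 0 ∈ goodP V H (small D) := by
  have hst : ∀ y, starAdj v y → ψ y = H := by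
    intro y hy
    have h1 : |(y - v).1| ≤ 1 := by
      have := hy.2.1; rw [abs_sub_comm] at this; exact this
    have h2 : |(y - v).2| ≤ 1 := by
      have := hy.2.2; rw [abs_sub_comm] at this; exact this
    have := hn (y - v) (mem_nine h1 h2)
    rwa [add_sub_cancel] at this
  intro u hu hne
  by_cases huv : u = v
  · subst huv
    have h1 : compStar (dev V H (Function.update ψ u 0)) u ⊆ {u} := by
      refine her_stay rfl ?_
      intro y hy z hz hyz hzd
      rw [Set.mem_singleton_iff] at hy hz
      subst hy
      have := hzd.2
      rw [Function.update_of_ne hz] at this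
      exact this (hst z hyz)
    have h2 : fcl V H (Function.update ψ u 0) u ⊆ {u} := by
      have := fill_mono h1
      rwa [fill_singleton] at this
    intro x hx y hy
    have hx := h2 hx
    have hy := h2 hy
    rw [Set.mem_singleton_iff] at hx hy
    subst hx; subst hy
    simpa using hD
  · rw [Function.update_of_ne huv] at hne
    refine her_small D _ _ (fill_mono ?_) (hψ u hu hne)
    refine her_stay (self_mem_compStar _ _) ?_
    intro y hy z hz hyz hzd
    have hyd : y ∈ dev V H ψ := compStar_sub (S := dev V H ψ) ⟨hu, hne⟩ hy
    have hzv : z ≠ v := by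
      rintro rfl
      exact hyd.2 (hst y ⟨hyz.1.symm, by rw [abs_sub_comm]; exact hyz.2.1,
        by rw [abs_sub_comm]; exact hyz.2.2⟩)
    have hzd' : z ∈ dev V H ψ := ⟨hzd.1, by
      have := hzd.2
      rwa [Function.update_of_ne hzv] at this⟩
    exact hz (Relation.ReflTransGen.tail hy ⟨hyz, hyd, hzd'⟩)

lemma upper_site {β lam : ℝ} (hβ : 1000 ≤ β) (hl0 : 0 < lam) (hl1 : lam ≤ 1)
    {V : Finset Site} (hV : connectedIn ((↑V : Set Site)ᶜ)) (η : Site → BSign) {k : ℤ} (hk : 0 ≤ k)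
    (T : Finset Site) {v : Site} (hv : v ∈ interiorSites V) (hvT : v ∉ T) :
    Mw β lam V (Kc V η (k + 1) (fun u => if u ∈ T then 0 else 1) (small (elemBound β lam k))) ≤
      ENNReal.ofReal (Real.exp (-(1 / 2) * qq β lam ^ (k + 1).toNat)) *
      Mw β lam V (Kc V η (k + 1) (fun u => if u ∈ insert v T then 0 else 1)
        (small (elemBound β lam k))) := by
  set D := elemBound β lam k with hDdef
  set f : Site → ℤ := fun u => if u ∈ T then 0 else 1 with hf
  set f' : Site → ℤ := fun u => if u ∈ insert v T then 0 else 1 with hf'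
  have hf0 : ∀ u, 0 ≤ f u := fun u => by simp only [hf]; split_ifs <;> norm_num
  have hf1 : ∀ u, f u ≤ 1 := fun u => by simp only [hf]; split_ifs <;> norm_num
  have hf0' : ∀ u, 0 ≤ f' u := fun u => by simp only [hf']; split_ifs <;> norm_num
  have hff : ∀ u, f' u ≤ f u := fun u => by
    simp only [hf, hf']
    by_cases h1 : u ∈ T
    · simp [h1]
    · split_ifs <;> norm_num
  have hfv : f v = 1 := by simp [hf, hvT]
  have hfv' : f' v = 0 := by simp [hf']
  have hD1 : 1 ≤ D := one_le_elem hβ hl0 hl1 hk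
  obtain ⟨hvV, hvb⟩ := Finset.mem_sdiff.1 hv
  set G : Set (Site → ℤ) := Kc V η (k + 1) f (small D) ∩ {ψ | ∀ d ∈ nine, ψ (v + d) = k + 1} with hG
  set E : Set (Site → ℤ) := Kc V η (k + 1) f' (small D) ∩ {ψ | ψ v = 0} with hE
  have hX := Kc_ne_top hβ hl0 V η (k + 1) hf0 (small D)
  have hY := Kc_ne_top hβ hl0 V η (k + 1) hf0' (small D)
  have zero_nine : (0 : Site) ∈ nine := mem_nine (by simp) (by simp)
  have hGv : ∀ ψ ∈ G, ψ v = k + 1 := fun ψ hψ => by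
    have := hψ.2 0 zero_nine
    rwa [add_zero] at this
  -- spike
  have h1 : Mw β lam V G ≤ ENNReal.ofReal (Real.exp ((4 * β - lam) * ((k + 1 : ℤ) : ℝ))) * Mw β lam V E := by
    refine Mw_transport (fun ψ => Function.update ψ v 0) ?_ ?_ _ (Real.exp_pos _).le ?_
    · intro ψ hψ φ hφ h
      funext x
      by_cases hx : x = v
      · rw [hx, hGv ψ hψ, hGv φ hφ]
      · have := congrFun h x
        simpa [Function.update_of_ne hx] using this
    · intro ψ hψ
      refine ⟨⟨⟨?_, ?_, ?_⟩, spike_good hD1 hψ.1.2 hψ.2⟩, by simp⟩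
      · intro x hx
        have hxv : x ≠ v := by rintro rfl; exact hx hvV
        rw [Function.update_of_ne hxv]
        exact hψ.1.1.1 x hx
      · intro x hx
        by_cases hxv : x = v
        · subst hxv; simp [hfv']
        · rw [Function.update_of_ne hxv]
          exact (hff x).trans (hψ.1.1.2.1 x hx)
      · intro x hx
        have hxv : x ≠ v := by rintro rfl; exact hvb hx
        rw [Function.update_of_ne hxv]
        exact hψ.1.1.2.2 x hx
    · intro ψ hψ
      have := wt_spike β lam hvV (ψ := ψ) (H := k + 1) (by omega) (hGv ψ hψ) (by
        intro d hd
        refine hψ.2 d (mem_nine ?_ ?_) <;>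
        · simp only [dirs, Finset.mem_insert, Finset.mem_singleton] at hd
          rcases hd with rfl | rfl | rfl | rfl <;> norm_num)
      rw [this, ← mul_assoc, ← Real.exp_add]
      rw [show (4 * β - lam) * ((k + 1 : ℤ) : ℝ) + -(4 * β - lam) * ((k + 1 : ℤ) : ℝ) = 0 by ring]
      simp
  -- probability of the flat neighbourhood
  have h2 : Mw β lam V (Kc V η (k + 1) f (small D)) ≤ Mw β lam V G +
      ∑ d ∈ nine, ENNReal.ofReal (1 / 36) * Mw β lam V (Kc V η (k + 1) f (small D)) := by
    have hcov : Kc V η (k + 1) f (small D) ⊆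
        G ∪ (Kc V η (k + 1) f (small D) ∩ {ψ | ∃ d ∈ nine, ψ (v + d) ≠ k + 1}) := by
      intro ψ hψ
      by_cases h : ∀ d ∈ nine, ψ (v + d) = k + 1
      · exact Or.inl ⟨hψ, h⟩
      · push Not at h
        exact Or.inr ⟨hψ, h⟩
    refine (mass_cover _ hcov).trans (add_le_add_right ?_ _)
    refine (mass_biUnion_le _ nine (fun d => Kc V η (k + 1) f (small D) ∩
      {ψ | ψ (v + d) ≠ k + 1}) ?_).trans (Finset.sum_le_sum ?_)
    · rintro ψ ⟨hψ, d, hd, hne⟩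
      exact ⟨d, hd, hψ, hne⟩
    · intro d hd
      have hs := site_prob hβ hl0 hl1 hV η (k + 1) f (her_small D) (fun F h => h)
        (lam_elem hl0 k) (k + 1).toNat (by omega) (fun u hu => by have := hf1 u; omega)
        (elem_qq hβ hl1 hk) (v + d) (fun _ => True) 1 le_rfl
        (fun A hA _ _ => le_trans (by norm_num) (eb_ge_four ⟨_, hA⟩))
      refine (mass_mono _ ?_).trans (hs.trans (mul_le_mul_left (ENNReal.ofReal_le_ofReal ?_) _))
      · rintro ψ ⟨hψ, hne⟩
        refine ⟨hψ, v + d, ⟨?_, hne⟩, self_mem_fcl _ _ _ _, trivial⟩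
        by_contra hnot
        exact hne (hψ.1.1 _ hnot)
      · have e1 : Real.exp (-(β / 4 - 9) * (1 : ℕ)) * Real.exp (β / 4 - 9) = 1 := by
          rw [← Real.exp_add]; simp
        have e2 : (36 : ℝ) ≤ Real.exp (β / 4 - 9) := by
          have := Real.add_one_le_exp (β / 4 - 9)
          linarith
        have e3 := Real.exp_pos (-(β / 4 - 9) * (1 : ℕ))
        nlinarith
  -- disjoint union
  have h3 : Mw β lam V (Kc V η (k + 1) f (small D)) + Mw β lam V E ≤
      Mw β lam V (Kc V η (k + 1) f' (small D)) := by
    unfold Mw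
    rw [← mass_union_disj]
    · refine mass_mono _ (Set.union_subset (Kc_mono hff (fun _ h => h)) Set.inter_subset_left)
    · rw [Set.disjoint_left]
      intro ψ hψ hψ'
      have a1 := hψ.1.2.1 v hvV
      have a2 : ψ v = 0 := hψ'.2
      omega
  have hEt : Mw β lam V E ≠ ⊤ := ne_top_of_le_ne_top hY (le_trans le_add_self h3)
  have hGt : Mw β lam V G ≠ ⊤ := ne_top_of_le_ne_top hX (mass_mono _ Set.inter_subset_left)
  have r1 := toReal_le h1 hEt (Real.exp_pos _).le
  rw [Finset.sum_const, nine_card, nsmul_eq_mul] at h2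
  have r3 := ENNReal.toReal_mono hY h3
  rw [ENNReal.toReal_add hX hEt] at r3
  have r2 := ENNReal.toReal_mono (ENNReal.add_ne_top.2 ⟨hGt, ENNReal.mul_ne_top (by simp)
    (ENNReal.mul_ne_top ENNReal.ofReal_ne_top hX)⟩) h2
  rw [ENNReal.toReal_add hGt (ENNReal.mul_ne_top (by simp)
    (ENNReal.mul_ne_top ENNReal.ofReal_ne_top hX)), ENNReal.toReal_mul, ENNReal.toReal_mul,
    ENNReal.toReal_ofReal (by norm_num), ENNReal.toReal_natCast] at r2
  set X := Mw β lam V (Kc V η (k + 1) f (small D)) with hXd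
  set Y := Mw β lam V (Kc V η (k + 1) f' (small D)) with hYd
  have hq : qq β lam ^ (k + 1).toNat = Real.exp (-(4 * β - lam) * ((k + 1 : ℤ) : ℝ)) :=
    qq_pow (by omega)
  set q := qq β lam ^ (k + 1).toNat with hqd
  have hq0 : 0 < q := pow_pos (qq_pos β lam) _
  have hk1 : (0 : ℝ) ≤ ((k + 1 : ℤ) : ℝ) := by exact_mod_cast (by omega : (0 : ℤ) ≤ k + 1)
  have hq1 : q ≤ 1 := by
    rw [hq, Real.exp_le_one_iff]
    nlinarith
  have r4 : q * (Mw β lam V G).toReal ≤ (Mw β lam V E).toReal := by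
    have := mul_le_mul_of_nonneg_left r1 hq0.le
    rw [← mul_assoc, hq, ← Real.exp_add, show -(4 * β - lam) * ((k + 1 : ℤ) : ℝ) +
      (4 * β - lam) * ((k + 1 : ℤ) : ℝ) = 0 by ring, Real.exp_zero, one_mul] at this
    rw [hq]; exact this
  have hX0 : 0 ≤ X.toReal := ENNReal.toReal_nonneg
  have r5 : (3 / 4) * X.toReal ≤ (Mw β lam V G).toReal := by
    push_cast at r2
    linarith
  have hexp : Real.exp (q / 2) ≤ 1 + 3 / 4 * q := by
    have := Real.abs_exp_sub_one_sub_id_le (x := q / 2) (by rw [abs_le]; constructor <;> linarith)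
    have := (abs_le.1 this).2
    nlinarith
  have r6 : Real.exp (q / 2) * X.toReal ≤ Y.toReal := by
    have a := mul_le_mul_of_nonneg_left r5 hq0.le
    have b := mul_le_mul_of_nonneg_right hexp hX0
    nlinarith
  have r7 : X.toReal ≤ Real.exp (-(1 / 2) * q) * Y.toReal := by
    have := mul_le_mul_of_nonneg_left r6 (Real.exp_pos (-(1 / 2) * q)).le
    rw [← mul_assoc, ← Real.exp_add, show -(1 / 2) * q + q / 2 = 0 by ring, Real.exp_zero,
      one_mul] at this
    exact this
  rw [← ENNReal.ofReal_toReal hX, ← ENNReal.ofReal_toReal hY, ← ENNReal.ofReal_mul (Real.exp_pos _).le]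
  exact ENNReal.ofReal_le_ofReal r7

lemma upper_set {β lam : ℝ} (hβ : 1000 ≤ β) (hl0 : 0 < lam) (hl1 : lam ≤ 1)
    {V : Finset Site} (hV : connectedIn ((↑V : Set Site)ᶜ)) (η : Site → BSign) {k : ℤ} (hk : 0 ≤ k)
    (T : Finset Site) (hT : T ⊆ interiorSites V) :
    Mw β lam V (Kc V η (k + 1) (fun _ => 1) (small (elemBound β lam k))) ≤
      ENNReal.ofReal (Real.exp (-(1 / 2) * qq β lam ^ (k + 1).toNat * T.card)) *
      Mw β lam V (Kc V η (k + 1) (fun u => if u ∈ T then 0 else 1)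
        (small (elemBound β lam k))) := by
  induction T using Finset.induction_on with
  | empty => simp
  | insert v T hvT ih =>
    have h1 := ih ((Finset.subset_insert v T).trans hT)
    have h2 := upper_site hβ hl0 hl1 hV η hk T (hT (Finset.mem_insert_self v T)) hvT
    refine h1.trans ((mul_le_mul_right h2 _).trans (le_of_eq ?_))
    rw [← mul_assoc, ← ENNReal.ofReal_mul (Real.exp_pos _).le, ← Real.exp_add,
      Finset.card_insert_of_notMem hvT]
    congr 4
    push_cast
    ring

lemma upper_all {β lam : ℝ} (hβ : 1000 ≤ β) (hl0 : 0 < lam) (hl1 : lam ≤ 1)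
    {V : Finset Site} (hV : connectedIn ((↑V : Set Site)ᶜ)) (η : Site → BSign) {k m : ℤ} (hk : 0 ≤ k)
    (hm : k < m) :
    ZE β lam η V k ≤ ENNReal.ofReal (Real.exp (lam * ((m : ℝ) - k) * V.card -
      1 / 2 * qq β lam ^ (k + 1).toNat * (interiorSites V).card)) * ZE β lam η V m := by
  have h1 : ZE β lam η V k ≤ _ := shift_mass (β := β) (lam := lam) (V := V)
    (S := Kc V η k (fun _ => 0) (small (elemBound β lam k)))
    (S' := Kc V η (k + 1) (fun _ => 1) (small (elemBound β lam k))) 1 (by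
      intro ψ hψ
      exact ⟨cfg_shift hψ.1 (fun v hv => by have : 0 ≤ ψ v := hψ.1.2.1 v hv; omega),
        good_shift hψ.2⟩)
  have h2 := upper_set hβ hl0 hl1 hV η hk (interiorSites V) (Finset.Subset.refl _)
  have h3 : Mw β lam V (Kc V η (k + 1) (fun u => if u ∈ interiorSites V then 0 else 1)
      (small (elemBound β lam k))) ≤ ZE β lam η V (k + 1) :=
    mass_mono _ (Kc_mono (fun u => by split_ifs <;> norm_num)
      (fun F h => small_mono (elem_mono hβ (by omega)) (subset_refl _) h))
  have h4 := ZE_shift (lam := lam) hβ η V (k + 1) (s := m - (k + 1)) (by omega)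
  rw [add_sub_cancel] at h4
  refine h1.trans ((mul_le_mul_right (h2.trans (mul_le_mul_right (h3.trans h4) _)) _).trans
    (le_of_eq ?_))
  rw [← mul_assoc, ← mul_assoc, ← ENNReal.ofReal_mul (Real.exp_pos _).le,
    ← ENNReal.ofReal_mul (by positivity), ← Real.exp_add, ← Real.exp_add]
  congr 3
  push_cast
  ring

lemma part_one {β lam : ℝ} (hβ : 1000 ≤ β) (hl0 : 0 < lam) (hl1 : lam ≤ 1)
    {V : Finset Site} (hV : connectedIn ((↑V : Set Site)ᶜ)) (η : Site → BSign) {k m : ℤ} (hk : 0 ≤ k)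
    (hm : k < m) :
    Real.exp (-2 * (V.card : ℝ) * Real.exp (-(4 * β - lam) * ((k : ℝ) + 1))) ≤
                Real.exp (-lam * ((m : ℝ) - (k : ℝ)) * (V.card : ℝ)) *
                  (Zel β lam η k V / Zel β lam η m V) ∧
              Real.exp (-lam * ((m : ℝ) - (k : ℝ)) * (V.card : ℝ)) *
                  (Zel β lam η k V / Zel β lam η m V) ≤
                2 * Real.exp (-(1 / 2) * ((interiorSites V).card : ℝ) *
                  Real.exp (-(4 * β - lam) * ((k : ℝ) + 1))) := by
  have ht : ∀ j : ℤ, ZE β lam η V j ≠ ⊤ := fun j =>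
    Kc_ne_top hβ hl0 V η j (fun _ => le_rfl) _
  have hq : qq β lam ^ (k + 1).toNat = Real.exp (-(4 * β - lam) * ((k : ℝ) + 1)) := by
    rw [qq_pow (by omega)]; push_cast; rfl
  have hpos : 0 < Zel β lam η m V := by
    rw [Zel_ZE]
    exact ENNReal.toReal_pos (ZE_pos β lam η V (by omega)).ne' (ht m)
  have hlow := lower_all hβ hl0 hl1 hV η (m - k).toNat k hk
  have hj : (((m - k).toNat : ℕ) : ℤ) = m - k := Int.toNat_of_nonneg (by omega)
  have hjr : (((m - k).toNat : ℕ) : ℝ) = (m : ℝ) - k := by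
    have : ((((m - k).toNat : ℕ) : ℤ) : ℝ) = ((m - k : ℤ) : ℝ) := by rw [hj]
    push_cast at this ⊢
    exact_mod_cast this
  rw [hj, add_sub_cancel, hjr] at hlow
  have hl := toReal_le hlow (ht k) (Real.exp_pos _).le
  have hu := toReal_le (upper_all hβ hl0 hl1 hV η hk hm) (ht m) (Real.exp_pos _).le
  rw [← Zel_ZE, ← Zel_ZE, hq] at hl hu
  rw [← mul_div_assoc]
  constructor
  · rw [le_div_iff₀ hpos]
    refine (mul_le_mul_of_nonneg_left hl (Real.exp_pos _).le).trans (le_of_eq ?_)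
    rw [← mul_assoc, ← Real.exp_add]
    congr 2
    ring
  · rw [div_le_iff₀ hpos]
    have h := mul_le_mul_of_nonneg_left hu
      (Real.exp_pos (-lam * ((m : ℝ) - (k : ℝ)) * (V.card : ℝ))).le
    rw [← mul_assoc, ← Real.exp_add] at h
    have e : -lam * ((m : ℝ) - (k : ℝ)) * (V.card : ℝ) + (lam * ((m : ℝ) - k) * V.card -
      1 / 2 * Real.exp (-(4 * β - lam) * ((k : ℝ) + 1)) * (interiorSites V).card) =
      -(1 / 2) * ((interiorSites V).card : ℝ) * Real.exp (-(4 * β - lam) * ((k : ℝ) + 1)) := by ring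
    rw [e] at h
    have hp := mul_pos (Real.exp_pos (-(1 / 2) * ((interiorSites V).card : ℝ) *
      Real.exp (-(4 * β - lam) * ((k : ℝ) + 1)))) hpos
    linarith

end

/-- Theorem 3.6 of the paper. There is an absolute `β₀` such that
for every `β > β₀`, `λ ∈ (0,1]` and finite simply-connected `V ⊂ ℤ²`:
(1) for all integers `0 ≤ k < m` and every boundary signing `η`,
`exp(-2|V| e^{-(4β-λ)(k+1)}) ≤ e^{-λ(m-k)|V|} Z^el_{η,k,V}/Z^el_{η,m,V}
  ≤ 2 exp(-(1/2)|V̊| e^{-(4β-λ)(k+1)})`;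
(2) for every `h ≥ 0`, every `h`-elementary contour `γ` has
`W^rn_h(γ) ≤ e^{-(β-2)|γ|}`. -/
theorem statement7 :
    ∃ β₀ : ℝ, ∀ β : ℝ, β₀ < β → ∀ lam : ℝ, 0 < lam → lam ≤ 1 →
      ∀ V : Finset Site, SimplyConn V →
        ((∀ k m : ℤ, 0 ≤ k → k < m → ∀ η : Site → BSign,
            Real.exp (-2 * (V.card : ℝ) * Real.exp (-(4 * β - lam) * ((k : ℝ) + 1))) ≤
                Real.exp (-lam * ((m : ℝ) - (k : ℝ)) * (V.card : ℝ)) *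
                  (Zel β lam η k V / Zel β lam η m V) ∧
              Real.exp (-lam * ((m : ℝ) - (k : ℝ)) * (V.card : ℝ)) *
                  (Zel β lam η k V / Zel β lam η m V) ≤
                2 * Real.exp (-(1 / 2) * ((interiorSites V).card : ℝ) *
                  Real.exp (-(4 * β - lam) * ((k : ℝ) + 1)))) ∧
         (∀ h : ℤ, 0 ≤ h → ∀ γ : Contour, Contour.valid γ → IsElem β lam h γ →
            Wrn β lam h γ ≤ Real.exp (-(β - 2) * (γ.len : ℝ)))) := by
  refine ⟨1000, fun β hβ lam hl0 hl1 V hV => ⟨?_, ?_⟩⟩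
  · intro k m hk hm η
    exact part_one hβ.le hl0 hl1 hV.2 η hk hm
  · intro h hh γ hv he
    exact part_two hβ.le hl0 hl1 hh hv he
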